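/- Let 0 < ε < 1/10 and let OPT be the set of items in an optimal guillotine-separable packing into an N×N knapsack with rotations allowed, and suppose OPT contains no massive item. Then there is a universal constant C and a set APX ⊆ OPT with p(APX) ≥ (3/4 − C·ε)·p(OPT) that can be packed, with 90-degree rotations allowed, in a guillotine-separable container packing using a number of containers bounded by a constant depending only on ε. -/

import Mathlib

/-- An axis-aligned rectangle, given by the coordinates of its corners. -/
structure Rect where
  x1 : ℝ
  x2 : ℝ
  y1 : ℝ
  y2 : ℝ

namespace Rect

def width (r : Rect) : ℝ := r.x2 - r.x1

def height (r : Rect) : ℝ := r.y2 - r.y1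

def area (r : Rect) : ℝ := r.width * r.height

/-- The open interior of an axis-aligned rectangle. -/
def toSet (r : Rect) : Set (ℝ × ℝ) :=
  {p : ℝ × ℝ | r.x1 < p.1 ∧ p.1 < r.x2 ∧ r.y1 < p.2 ∧ p.2 < r.y2}

/-- `r.SubRect s` : the rectangle `r` is contained in the rectangle `s`. -/
def SubRect (r s : Rect) : Prop :=
  s.x1 ≤ r.x1 ∧ r.x2 ≤ s.x2 ∧ s.y1 ≤ r.y1 ∧ r.y2 ≤ s.y2

noncomputable instance (r s : Rect) : Decidable (r.SubRect s) :=
  inferInstanceAs (Decidable (s.x1 ≤ r.x1 ∧ r.x2 ≤ s.x2 ∧ s.y1 ≤ r.y1 ∧ r.y2 ≤ s.y2))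

end Rect

/-- The square knapsack `[0,N] × [0,N]`. -/
def knapsack (N : ℝ) : Rect := ⟨0, N, 0, N⟩

/-- A placement of the items of `S` (with prescribed widths and heights) as
pairwise non-overlapping axis-aligned rectangles inside the piece `P`. -/
structure IsPacking {ι : Type*} (wd ht : ι → ℝ) (S : Finset ι)
    (place : ι → Rect) (P : Rect) : Prop where
  hw : ∀ i ∈ S, (place i).width = wd i
  hh : ∀ i ∈ S, (place i).height = ht i
  hin : ∀ i ∈ S, (place i).SubRect P
  hdisj : ∀ i ∈ S, ∀ j ∈ S, i ≠ j → Disjoint (place i).toSet (place j).toSet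

/-- Guillotine separability of the placed items of `S` inside the piece `P`:
either the piece contains at most one item, or some axis-parallel end-to-end cut
splits the piece into two rectangular subpieces, crossing the interior of no item,
and the items of each subpiece are recursively guillotine separable. -/
inductive GuillotineSep {ι : Type*} (place : ι → Rect) : Rect → Finset ι → Prop
  | base (P : Rect) (S : Finset ι) (hS : S.card ≤ 1) : GuillotineSep place P S
  | vcut (P : Rect) (S : Finset ι) (c : ℝ) (h1 : P.x1 < c) (h2 : c < P.x2)
      (hcross : ∀ i ∈ S, (place i).x2 ≤ c ∨ c ≤ (place i).x1)
      (hL : GuillotineSep place ⟨P.x1, c, P.y1, P.y2⟩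
              (S.filter fun i => (place i).x2 ≤ c))
      (hR : GuillotineSep place ⟨c, P.x2, P.y1, P.y2⟩
              (S.filter fun i => ¬ (place i).x2 ≤ c)) :
      GuillotineSep place P S
  | hcut (P : Rect) (S : Finset ι) (c : ℝ) (h1 : P.y1 < c) (h2 : c < P.y2)
      (hcross : ∀ i ∈ S, (place i).y2 ≤ c ∨ c ≤ (place i).y1)
      (hB : GuillotineSep place ⟨P.x1, P.x2, P.y1, c⟩
              (S.filter fun i => (place i).y2 ≤ c))
      (hT : GuillotineSep place ⟨P.x1, P.x2, c, P.y2⟩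
              (S.filter fun i => ¬ (place i).y2 ≤ c)) :
      GuillotineSep place P S

/-- A guillotine-separable packing of the items of `S` into the piece `P`. -/
def GuillotinePacking {ι : Type*} (wd ht : ι → ℝ) (S : Finset ι)
    (place : ι → Rect) (P : Rect) : Prop :=
  IsPacking wd ht S place P ∧ GuillotineSep place P S

/-- A placement of the items of `S` with 90 degree rotations allowed: each item is
placed with its prescribed dimensions or with width and height exchanged. -/
structure IsPackingRot {ι : Type*} (wd ht : ι → ℝ) (S : Finset ι)
    (place : ι → Rect) (P : Rect) : Prop where
  hdims : ∀ i ∈ S, ((place i).width = wd i ∧ (place i).height = ht i) ∨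
      ((place i).width = ht i ∧ (place i).height = wd i)
  hin : ∀ i ∈ S, (place i).SubRect P
  hdisj : ∀ i ∈ S, ∀ j ∈ S, i ≠ j → Disjoint (place i).toSet (place j).toSet

/-- Labels of containers. -/
inductive CLabel
  | large
  | horizontal
  | vertical
  | area

/-- The constraints of a container packing: a large container contains a single item,
in a horizontal container the items are stacked one above another, in a vertical
container the items are placed side by side, and every item placed in an area
container has width (resp. height) at most an `ε`-fraction of the container's
width (resp. height). -/
def ContainerLabelOK {ι : Type*} (T : Finset ι) (place : ι → Rect)
    (k : ℕ) (cont : ℕ → Rect) (lab : ℕ → CLabel) (asg : ι → ℕ) (ε : ℝ) : Prop :=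
  (∀ j < k, lab j = CLabel.large →
      ∀ i ∈ T, ∀ i' ∈ T, asg i = j → asg i' = j → i = i') ∧
  (∀ j < k, lab j = CLabel.horizontal →
      ∀ i ∈ T, ∀ i' ∈ T, asg i = j → asg i' = j → i ≠ i' →
        (place i).y2 ≤ (place i').y1 ∨ (place i').y2 ≤ (place i).y1) ∧
  (∀ j < k, lab j = CLabel.vertical →
      ∀ i ∈ T, ∀ i' ∈ T, asg i = j → asg i' = j → i ≠ i' →
        (place i).x2 ≤ (place i').x1 ∨ (place i').x2 ≤ (place i).x1) ∧
  (∀ j < k, lab j = CLabel.area → ∀ i ∈ T, asg i = j →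
      (place i).width ≤ ε * (cont j).width ∧ (place i).height ≤ ε * (cont j).height)

/-- A container packing of the items of `S` into the piece `P` with 90 degree
rotations allowed, using at most `k` pairwise non-overlapping containers. -/
def IsContainerPackingRot {ι : Type*} (wd ht : ι → ℝ) (ε : ℝ) (S : Finset ι)
    (place : ι → Rect) (P : Rect) (k : ℕ) : Prop :=
  IsPackingRot wd ht S place P ∧
  ∃ (cont : ℕ → Rect) (lab : ℕ → CLabel) (asg : ι → ℕ),
    (∀ j < k, (cont j).SubRect P) ∧
    (∀ j < k, ∀ j' < k, j ≠ j' → Disjoint (cont j).toSet (cont j').toSet) ∧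
    (∀ i ∈ S, asg i < k ∧ (place i).SubRect (cont (asg i))) ∧
    ContainerLabelOK S place k cont lab asg ε

set_option linter.all false

/-- Bundled positive dimensions. -/
structure Dims (ι : Type) where
  w : ι → ℝ
  h : ι → ℝ
  wpos : ∀ i, 0 < w i
  hpos : ∀ i, 0 < h i

/-- transposed dimensions -/
def Dims.T {ι : Type} (D : Dims ι) : Dims ι := ⟨D.h, D.w, D.hpos, D.wpos⟩

/-- scaled dimensions -/
def Dims.sc {ι : Type} (D : Dims ι) (a b : ℝ) (ha : 0 < a) (hb : 0 < b) : Dims ι :=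
  ⟨fun i => a * D.w i, fun i => b * D.h i, fun i => mul_pos ha (D.wpos i),
    fun i => mul_pos hb (D.hpos i)⟩

/-- Position-free guillotine packability. -/
inductive Pk {ι : Type} [DecidableEq ι] (D : Dims ι) : ℝ → ℝ → Finset ι → Prop
  | leaf {w h : ℝ} {S : Finset ι} (hw : 0 ≤ w) (hh : 0 ≤ h) (hS : S.card ≤ 1)
      (hd : ∀ i ∈ S, D.w i ≤ w ∧ D.h i ≤ h) : Pk D w h S
  | vcut {w h w1 w2 : ℝ} {S S1 S2 : Finset ι} (h1 : Pk D w1 h S1) (h2 : Pk D w2 h S2)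
      (hw : w1 + w2 ≤ w) (hS : S ⊆ S1 ∪ S2) : Pk D w h S
  | hcut {w h h1 h2 : ℝ} {S S1 S2 : Finset ι} (p1 : Pk D w h1 S1) (p2 : Pk D w h2 S2)
      (hh : h1 + h2 ≤ h) (hS : S ⊆ S1 ∪ S2) : Pk D w h S

/-- Position-free guillotine container packability with at most `k` containers. -/
inductive Ct {ι : Type} [DecidableEq ι] (D : Dims ι) (ε : ℝ) (M : ι → Prop) :
    ℕ → ℝ → ℝ → Finset ι → Prop
  | empty {k : ℕ} {w h : ℝ} {S : Finset ι} (hw : 0 ≤ w) (hh : 0 ≤ h) (hS : S = ∅) :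
      Ct D ε M k w h S
  | vstack {k : ℕ} {w h : ℝ} {S : Finset ι} (hk : 1 ≤ k) (hw : 0 ≤ w) (hh : 0 ≤ h)
      (hd : ∀ i ∈ S, D.h i ≤ h) (hs : ∑ i ∈ S, D.w i ≤ w) : Ct D ε M k w h S
  | hstack {k : ℕ} {w h : ℝ} {S : Finset ι} (hk : 1 ≤ k) (hw : 0 ≤ w) (hh : 0 ≤ h)
      (hd : ∀ i ∈ S, D.w i ≤ w) (hs : ∑ i ∈ S, D.h i ≤ h) (hM : ∀ i ∈ S, ¬ M i) :
      Ct D ε M k w h S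
  | area {k : ℕ} {w h : ℝ} {S : Finset ι} (hk : 1 ≤ k)
      (hd : ∀ i ∈ S, D.w i ≤ ε * w ∧ D.h i ≤ ε * h) (hp : Pk D w h S) (hM : ∀ i ∈ S, ¬ M i) :
      Ct D ε M k w h S
  | vcut {k k1 k2 : ℕ} {w h w1 w2 : ℝ} {S S1 S2 : Finset ι} (h1 : Ct D ε M k1 w1 h S1)
      (h2 : Ct D ε M k2 w2 h S2) (hw : w1 + w2 ≤ w) (hS : S ⊆ S1 ∪ S2) (hk : k1 + k2 ≤ k) :
      Ct D ε M k w h S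
  | hcut {k k1 k2 : ℕ} {w h h1 h2 : ℝ} {S S1 S2 : Finset ι} (p1 : Ct D ε M k1 w h1 S1)
      (p2 : Ct D ε M k2 w h2 S2) (hh : h1 + h2 ≤ h) (hS : S ⊆ S1 ∪ S2) (hk : k1 + k2 ≤ k) :
      Ct D ε M k w h S

/-- no special items -/
def NoM {ι : Type} : ι → Prop := fun _ => False

section Basics
variable {ι : Type} [DecidableEq ι] {D : Dims ι} {ε : ℝ} {M : ι → Prop}

theorem sum_cover_le {f : ι → ℝ} (hf : ∀ i, 0 ≤ f i) {S S1 S2 : Finset ι} (h : S ⊆ S1 ∪ S2) :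
    ∑ i ∈ S, f i ≤ ∑ i ∈ S1, f i + ∑ i ∈ S2, f i := by
  have h1 := Finset.sum_le_sum_of_subset_of_nonneg h (f := f) (fun i _ _ => hf i)
  have h2 := Finset.sum_union_inter (s₁ := S1) (s₂ := S2) (f := f)
  have h3 : 0 ≤ ∑ i ∈ S1 ∩ S2, f i := Finset.sum_nonneg (fun i _ => hf i)
  linarith

theorem sum_mono_set {f : ι → ℝ} (hf : ∀ i, 0 ≤ f i) {S T : Finset ι} (h : S ⊆ T) :
    ∑ i ∈ S, f i ≤ ∑ i ∈ T, f i :=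
  Finset.sum_le_sum_of_subset_of_nonneg h (fun i _ _ => hf i)

theorem sum_sdiff' {f : ι → ℝ} {S T : Finset ι} (h : S ⊆ T) :
    ∑ i ∈ T, f i = ∑ i ∈ T \ S, f i + ∑ i ∈ S, f i := (Finset.sum_sdiff h).symm

theorem Dims.w0 (D : Dims ι) (i : ι) : 0 ≤ D.w i := (D.wpos i).le
theorem Dims.h0 (D : Dims ι) (i : ι) : 0 ≤ D.h i := (D.hpos i).le

theorem Pk.nonneg {w h : ℝ} {S : Finset ι} (hp : Pk D w h S) : 0 ≤ w ∧ 0 ≤ h := by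
  induction hp with
  | leaf hw hh _ _ => exact ⟨hw, hh⟩
  | vcut _ _ hw _ i1 i2 => exact ⟨by linarith [i1.1, i2.1], i1.2⟩
  | hcut _ _ hh _ i1 i2 => exact ⟨i1.1, by linarith [i1.2, i2.2]⟩

theorem Pk.empty {w h : ℝ} (hw : 0 ≤ w) (hh : 0 ≤ h) : Pk D w h ∅ :=
  Pk.leaf hw hh (by simp) (by simp)

theorem Pk.mono {w h w' h' : ℝ} {S : Finset ι} (hp : Pk D w h S) (hw : w ≤ w') (hh : h ≤ h') :
    Pk D w' h' S := by
  induction hp generalizing w' h' with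
  | leaf h1 h2 h3 h4 =>
    exact Pk.leaf (h1.trans hw) (h2.trans hh) h3
      (fun i hi => ⟨(h4 i hi).1.trans hw, (h4 i hi).2.trans hh⟩)
  | vcut _ _ hw' hS i1 i2 => exact Pk.vcut (i1 le_rfl hh) (i2 le_rfl hh) (hw'.trans hw) hS
  | hcut _ _ hh' hS i1 i2 => exact Pk.hcut (i1 hw le_rfl) (i2 hw le_rfl) (hh'.trans hh) hS

theorem Pk.subset {w h : ℝ} {S T : Finset ι} (hp : Pk D w h S) (hT : T ⊆ S) : Pk D w h T := by
  cases hp with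
  | leaf h1 h2 h3 h4 =>
    exact Pk.leaf h1 h2 ((Finset.card_le_card hT).trans h3) (fun i hi => h4 i (hT hi))
  | vcut a b hw' hS => exact Pk.vcut a b hw' (hT.trans hS)
  | hcut a b hh' hS => exact Pk.hcut a b hh' (hT.trans hS)

theorem Pk.dim_le {w h : ℝ} {S : Finset ι} (hp : Pk D w h S) :
    ∀ i ∈ S, D.w i ≤ w ∧ D.h i ≤ h := by
  induction hp with
  | leaf h1 h2 h3 h4 => exact h4
  | vcut a b hw' hS i1 i2 =>
    intro i hi
    rcases Finset.mem_union.1 (hS hi) with h | h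
    · exact ⟨by linarith [(i1 i h).1, b.nonneg.1], (i1 i h).2⟩
    · exact ⟨by linarith [(i2 i h).1, a.nonneg.1], (i2 i h).2⟩
  | hcut a b hw' hS i1 i2 =>
    intro i hi
    rcases Finset.mem_union.1 (hS hi) with h | h
    · exact ⟨(i1 i h).1, by linarith [(i1 i h).2, b.nonneg.2]⟩
    · exact ⟨(i2 i h).1, by linarith [(i2 i h).2, a.nonneg.2]⟩

theorem Pk.area_le {w h : ℝ} {S : Finset ι} (hp : Pk D w h S) :
    ∑ i ∈ S, D.w i * D.h i ≤ w * h := by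
  induction hp with
  | @leaf w h S h1 h2 h3 h4 =>
    rcases S.eq_empty_or_nonempty with rfl | ⟨x, hx⟩
    · simp; positivity
    · have hSx : S = {x} :=
        Finset.eq_singleton_iff_unique_mem.2 ⟨hx, fun y hy => Finset.card_le_one.1 h3 y hy x hx⟩
      have := h4 x hx
      rw [hSx, Finset.sum_singleton]
      exact mul_le_mul this.1 this.2 (D.h0 _) h1
  | vcut a b hw' hS i1 i2 =>
    have := sum_cover_le (f := fun i => D.w i * D.h i)
      (fun i => mul_nonneg (D.w0 i) (D.h0 i)) hS
    nlinarith [a.nonneg.2]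
  | hcut a b hw' hS i1 i2 =>
    have := sum_cover_le (f := fun i => D.w i * D.h i)
      (fun i => mul_nonneg (D.w0 i) (D.h0 i)) hS
    nlinarith [a.nonneg.1]

theorem Pk.tr {w h : ℝ} {S : Finset ι} (hp : Pk D w h S) : Pk D.T h w S := by
  induction hp with
  | leaf h1 h2 h3 h4 => exact Pk.leaf h2 h1 h3 (fun i hi => ⟨(h4 i hi).2, (h4 i hi).1⟩)
  | vcut _ _ hw hS i1 i2 => exact Pk.hcut i1 i2 hw hS
  | hcut _ _ hh hS i1 i2 => exact Pk.vcut i1 i2 hh hS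

theorem Pk.map {D' : Dims ι} {w h a b : ℝ} {S : Finset ι} (ha : 0 < a) (hb : 0 < b)
    (hp : Pk D w h S) : ∀ {T : Finset ι}, T ⊆ S →
    (∀ i ∈ T, D'.w i ≤ a * D.w i ∧ D'.h i ≤ b * D.h i) → Pk D' (a * w) (b * h) T := by
  induction hp with
  | leaf h1 h2 h3 h4 =>
    intro T hT hd
    refine Pk.leaf (by positivity) (by positivity) ((Finset.card_le_card hT).trans h3) ?_
    intro i hi
    have := h4 i (hT hi)
    exact ⟨(hd i hi).1.trans (by gcongr; exact this.1), (hd i hi).2.trans (by gcongr; exact this.2)⟩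
  | @vcut w h w1 w2 S S1 S2 _ _ hw hS i1 i2 =>
    intro T hT hd
    refine Pk.vcut (i1 (T := T ∩ S1) Finset.inter_subset_right
      (fun i hi => hd i (Finset.mem_inter.1 hi).1)) (i2 (T := T ∩ S2) Finset.inter_subset_right
      (fun i hi => hd i (Finset.mem_inter.1 hi).1)) (by nlinarith) ?_
    rw [← Finset.inter_union_distrib_left]
    exact Finset.subset_inter subset_rfl (hT.trans hS)
  | @hcut w h w1 w2 S S1 S2 _ _ hw hS i1 i2 =>
    intro T hT hd
    refine Pk.hcut (i1 (T := T ∩ S1) Finset.inter_subset_right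
      (fun i hi => hd i (Finset.mem_inter.1 hi).1)) (i2 (T := T ∩ S2) Finset.inter_subset_right
      (fun i hi => hd i (Finset.mem_inter.1 hi).1)) (by nlinarith) ?_
    rw [← Finset.inter_union_distrib_left]
    exact Finset.subset_inter subset_rfl (hT.trans hS)

theorem Pk.congr {D' : Dims ι} {w h : ℝ} {S : Finset ι} 
    (hp : Pk D w h S) (hd : ∀ i ∈ S, D'.w i ≤ D.w i ∧ D'.h i ≤ D.h i) : Pk D' w h S := by
  have := hp.map (D' := D') one_pos one_pos subset_rfl (by simpa using hd)
  simpa using this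

theorem Pk.scale {w h : ℝ} {S : Finset ι} (hp : Pk D w h S) {a b : ℝ} (ha : 0 < a) (hb : 0 < b) :
    Pk (D.sc a b ha hb) (a * w) (b * h) S :=
  hp.map ha hb subset_rfl (fun i _ => ⟨le_rfl, le_rfl⟩)

/-! ### Ct basics -/

theorem Ct.nonneg {k : ℕ} {w h : ℝ} {S : Finset ι} (hp : Ct D ε M k w h S) : 0 ≤ w ∧ 0 ≤ h := by
  induction hp with
  | empty hw hh _ => exact ⟨hw, hh⟩
  | vstack _ hw hh _ _ => exact ⟨hw, hh⟩
  | hstack _ hw hh _ _ _ => exact ⟨hw, hh⟩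
  | area _ _ hp => exact hp.nonneg
  | vcut _ _ hw _ _ i1 i2 => exact ⟨by linarith [i1.1, i2.1], i1.2⟩
  | hcut _ _ hh _ _ i1 i2 => exact ⟨i1.1, by linarith [i1.2, i2.2]⟩

theorem Ct.mono (hε : 0 ≤ ε) {k k' : ℕ} {w h w' h' : ℝ} {S : Finset ι} (hp : Ct D ε M k w h S)
    (hk : k ≤ k') (hw : w ≤ w') (hh : h ≤ h') : Ct D ε M k' w' h' S := by
  induction hp generalizing w' h' k' with
  | empty h1 h2 h3 => exact Ct.empty (h1.trans hw) (h2.trans hh) h3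
  | vstack h0 h1 h2 h3 h4 =>
    exact Ct.vstack (h0.trans hk) (h1.trans hw) (h2.trans hh)
      (fun i hi => (h3 i hi).trans hh) (h4.trans hw)
  | hstack h0 h1 h2 h3 h4 h5 =>
    exact Ct.hstack (h0.trans hk) (h1.trans hw) (h2.trans hh)
      (fun i hi => (h3 i hi).trans hw) (h4.trans hh) h5
  | area h0 h1 h2 h3 =>
    exact Ct.area (h0.trans hk) (fun i hi => ⟨(h1 i hi).1.trans (by gcongr),
      (h1 i hi).2.trans (by gcongr)⟩) (h2.mono hw hh) h3
  | vcut _ _ hw' hS hk' i1 i2 =>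
    exact Ct.vcut (i1 le_rfl le_rfl hh) (i2 le_rfl le_rfl hh) (hw'.trans hw) hS (hk'.trans hk)
  | hcut _ _ hh' hS hk' i1 i2 =>
    exact Ct.hcut (i1 le_rfl hw le_rfl) (i2 le_rfl hw le_rfl) (hh'.trans hh) hS (hk'.trans hk)

theorem Ct.subset {k : ℕ} {w h : ℝ} {S T : Finset ι} (hp : Ct D ε M k w h S) (hT : T ⊆ S) :
    Ct D ε M k w h T := by
  cases hp with
  | empty h1 h2 h3 => exact Ct.empty h1 h2 (by subst h3; exact Finset.subset_empty.1 hT)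
  | vstack h0 h1 h2 h3 h4 =>
    exact Ct.vstack h0 h1 h2 (fun i hi => h3 i (hT hi)) ((sum_mono_set D.w0 hT).trans h4)
  | hstack h0 h1 h2 h3 h4 h5 =>
    exact Ct.hstack h0 h1 h2 (fun i hi => h3 i (hT hi)) ((sum_mono_set D.h0 hT).trans h4)
      (fun i hi => h5 i (hT hi))
  | area h0 h1 h2 h3 =>
    exact Ct.area h0 (fun i hi => h1 i (hT hi)) (h2.subset hT) (fun i hi => h3 i (hT hi))
  | vcut a b hw' hS hk => exact Ct.vcut a b hw' (hT.trans hS) hk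
  | hcut a b hh' hS hk => exact Ct.hcut a b hh' (hT.trans hS) hk

theorem Ct.tr {k : ℕ} {w h : ℝ} {S : Finset ι} (hp : Ct D ε NoM k w h S) :
    Ct D.T ε NoM k h w S := by
  induction hp with
  | empty h1 h2 h3 => exact Ct.empty h2 h1 h3
  | vstack h0 h1 h2 h3 h4 => exact Ct.hstack h0 h2 h1 h3 h4 (fun i _ h => h)
  | hstack h0 h1 h2 h3 h4 h5 => exact Ct.vstack h0 h2 h1 h3 h4
  | area h0 h1 h2 h3 => exact Ct.area h0 (fun i hi => ⟨(h1 i hi).2, (h1 i hi).1⟩) h2.tr h3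
  | vcut _ _ hw hS hk i1 i2 => exact Ct.hcut i1 i2 hw hS hk
  | hcut _ _ hh hS hk i1 i2 => exact Ct.vcut i1 i2 hh hS hk

theorem Ct.map {D' : Dims ι} {k : ℕ} {w h a b : ℝ} {S : Finset ι} (ha : 0 < a) (hb : 0 < b)
    (hp : Ct D ε M k w h S) : ∀ {T : Finset ι}, T ⊆ S →
    (∀ i ∈ T, D'.w i ≤ a * D.w i ∧ D'.h i ≤ b * D.h i) → Ct D' ε M k (a * w) (b * h) T := by
  induction hp with
  | empty h1 h2 h3 =>
    intro T hT hd
    exact Ct.empty (by positivity) (by positivity) (by subst h3; exact Finset.subset_empty.1 hT)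
  | vstack h0 h1 h2 h3 h4 =>
    intro T hT hd
    refine Ct.vstack h0 (by positivity) (by positivity)
      (fun i hi => (hd i hi).2.trans (by have := h3 i (hT hi); gcongr)) ?_
    calc ∑ i ∈ T, D'.w i ≤ ∑ i ∈ T, a * D.w i := Finset.sum_le_sum (fun i hi => (hd i hi).1)
      _ = a * ∑ i ∈ T, D.w i := by rw [Finset.mul_sum]
      _ ≤ _ := by gcongr; exact (sum_mono_set D.w0 hT).trans h4
  | hstack h0 h1 h2 h3 h4 h5 =>
    intro T hT hd
    refine Ct.hstack h0 (by positivity) (by positivity)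
      (fun i hi => (hd i hi).1.trans (by have := h3 i (hT hi); gcongr)) ?_ (fun i hi => h5 i (hT hi))
    calc ∑ i ∈ T, D'.h i ≤ ∑ i ∈ T, b * D.h i := Finset.sum_le_sum (fun i hi => (hd i hi).2)
      _ = b * ∑ i ∈ T, D.h i := by rw [Finset.mul_sum]
      _ ≤ _ := by gcongr; exact (sum_mono_set D.h0 hT).trans h4
  | area h0 h1 h2 h3 =>
    intro T hT hd
    refine Ct.area h0 (fun i hi => ?_) (h2.map ha hb hT hd) (fun i hi => h3 i (hT hi))
    have h5 := h1 i (hT hi)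
    have h6 := hd i hi
    constructor
    · nlinarith
    · nlinarith
  | @vcut k k1 k2 w h w1 w2 S S1 S2 _ _ hw hS hk i1 i2 =>
    intro T hT hd
    refine Ct.vcut (i1 (T := T ∩ S1) Finset.inter_subset_right
      (fun i hi => hd i (Finset.mem_inter.1 hi).1)) (i2 (T := T ∩ S2) Finset.inter_subset_right
      (fun i hi => hd i (Finset.mem_inter.1 hi).1)) (by nlinarith) ?_ hk
    rw [← Finset.inter_union_distrib_left]
    exact Finset.subset_inter subset_rfl (hT.trans hS)
  | @hcut k k1 k2 w h w1 w2 S S1 S2 _ _ hw hS hk i1 i2 =>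
    intro T hT hd
    refine Ct.hcut (i1 (T := T ∩ S1) Finset.inter_subset_right
      (fun i hi => hd i (Finset.mem_inter.1 hi).1)) (i2 (T := T ∩ S2) Finset.inter_subset_right
      (fun i hi => hd i (Finset.mem_inter.1 hi).1)) (by nlinarith) ?_ hk
    rw [← Finset.inter_union_distrib_left]
    exact Finset.subset_inter subset_rfl (hT.trans hS)

/-- undo a scaling -/
theorem Ct.unscale {k : ℕ} {w h a b : ℝ} {S : Finset ι} (ha : 0 < a) (hb : 0 < b)
    (hp : Ct (D.sc a b ha hb) ε M k w h S) : Ct D ε M k (w / a) (h / b) S := by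
  have := hp.map (D' := D) (inv_pos.2 ha) (inv_pos.2 hb) subset_rfl (by
    intro i _
    simp only [Dims.sc]
    constructor
    · field_simp; exact le_rfl
    · field_simp; exact le_rfl)
  rwa [inv_mul_eq_div, inv_mul_eq_div] at this

theorem Ct.noM {k : ℕ} {w h : ℝ} {S : Finset ι} (hp : Ct D ε M k w h S) :
    Ct D ε NoM k w h S := by
  induction hp with
  | empty h1 h2 h3 => exact Ct.empty h1 h2 h3
  | vstack h0 h1 h2 h3 h4 => exact Ct.vstack h0 h1 h2 h3 h4
  | hstack h0 h1 h2 h3 h4 h5 => exact Ct.hstack h0 h1 h2 h3 h4 (fun i _ h => h)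
  | area h0 h1 h2 h3 => exact Ct.area h0 h1 h2 (fun i _ h => h)
  | vcut _ _ hw hS hk i1 i2 => exact Ct.vcut i1 i2 hw hS hk
  | hcut _ _ hh hS hk i1 i2 => exact Ct.hcut i1 i2 hh hS hk

/-- strengthening the special predicate when no item of `S` is special -/
theorem Ct.addM {M' : ι → Prop} {k : ℕ} {w h : ℝ} {S : Finset ι} (hp : Ct D ε M k w h S) :
    ∀ {T : Finset ι}, T ⊆ S → (∀ i ∈ T, ¬ M' i) → Ct D ε M' k w h T := by
  induction hp with
  | empty h1 h2 h3 =>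
    intro T hT hM
    exact Ct.empty h1 h2 (by subst h3; exact Finset.subset_empty.1 hT)
  | vstack h0 h1 h2 h3 h4 =>
    intro T hT hM
    exact Ct.vstack h0 h1 h2 (fun i hi => h3 i (hT hi)) ((sum_mono_set D.w0 hT).trans h4)
  | hstack h0 h1 h2 h3 h4 h5 =>
    intro T hT hM
    exact Ct.hstack h0 h1 h2 (fun i hi => h3 i (hT hi)) ((sum_mono_set D.h0 hT).trans h4) hM
  | area h0 h1 h2 h3 =>
    intro T hT hM
    exact Ct.area h0 (fun i hi => h1 i (hT hi)) (h2.subset hT) hM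
  | @vcut k k1 k2 w h w1 w2 S S1 S2 _ _ hw hS hk i1 i2 =>
    intro T hT hd
    refine Ct.vcut (i1 (T := T ∩ S1) Finset.inter_subset_right
      (fun i hi => hd i (Finset.mem_inter.1 hi).1)) (i2 (T := T ∩ S2) Finset.inter_subset_right
      (fun i hi => hd i (Finset.mem_inter.1 hi).1)) hw ?_ hk
    rw [← Finset.inter_union_distrib_left]
    exact Finset.subset_inter subset_rfl (hT.trans hS)
  | @hcut k k1 k2 w h w1 w2 S S1 S2 _ _ hw hS hk i1 i2 =>
    intro T hT hd
    refine Ct.hcut (i1 (T := T ∩ S1) Finset.inter_subset_right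
      (fun i hi => hd i (Finset.mem_inter.1 hi).1)) (i2 (T := T ∩ S2) Finset.inter_subset_right
      (fun i hi => hd i (Finset.mem_inter.1 hi).1)) hw ?_ hk
    rw [← Finset.inter_union_distrib_left]
    exact Finset.subset_inter subset_rfl (hT.trans hS)

theorem Pk.hstack {w h : ℝ} {S : Finset ι} (hw : 0 ≤ w) (hh : 0 ≤ h)
    (hd : ∀ i ∈ S, D.w i ≤ w) (hs : ∑ i ∈ S, D.h i ≤ h) : Pk D w h S := by
  induction S using Finset.induction_on generalizing h with
  | empty => exact Pk.empty hw hh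
  | insert a S ha ih =>
    rw [Finset.sum_insert ha] at hs
    have h1 : 0 ≤ ∑ i ∈ S, D.h i := Finset.sum_nonneg (fun i _ => D.h0 i)
    refine Pk.hcut (h1 := D.h a) (h2 := h - D.h a) (S1 := {a}) (S2 := S)
      (Pk.leaf hw (D.h0 a) (by simp) ?_) (ih (by linarith) ?_ (by linarith)) (by linarith) ?_
    · intro i hi
      rw [Finset.mem_singleton] at hi
      subst hi
      exact ⟨hd _ (Finset.mem_insert_self _ _), le_rfl⟩
    · intro i hi
      exact hd i (Finset.mem_insert_of_mem hi)
    · intro i hi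
      simpa using hi

theorem Pk.vstack {w h : ℝ} {S : Finset ι} (hw : 0 ≤ w) (hh : 0 ≤ h)
    (hd : ∀ i ∈ S, D.h i ≤ h) (hs : ∑ i ∈ S, D.w i ≤ w) : Pk D w h S :=
  (Pk.hstack (D := D.T) hh hw hd hs).tr

theorem Ct.toPk {k : ℕ} {w h : ℝ} {S : Finset ι} (hp : Ct D ε M k w h S) : Pk D w h S := by
  induction hp with
  | empty h1 h2 h3 => subst h3; exact Pk.empty h1 h2
  | vstack h0 h1 h2 h3 h4 => exact Pk.vstack h1 h2 h3 h4
  | hstack h0 h1 h2 h3 h4 h5 => exact Pk.hstack h1 h2 h3 h4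
  | area h0 h1 h2 h3 => exact h2
  | vcut _ _ hw hS hk i1 i2 => exact Pk.vcut i1 i2 hw hS
  | hcut _ _ hh hS hk i1 i2 => exact Pk.hcut i1 i2 hh hS

/-- horizontal stacking of finitely many container packings -/
theorem Ct.hsum {κ : Type} [DecidableEq κ] (J : Finset κ) {w : ℝ} (hw : 0 ≤ w) (k : κ → ℕ)
    (h : κ → ℝ) (S : κ → Finset ι) (hp : ∀ j ∈ J, Ct D ε M (k j) w (h j) (S j)) :
    Ct D ε M (∑ j ∈ J, k j) w (∑ j ∈ J, h j) (J.biUnion S) := by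
  induction J using Finset.induction_on with
  | empty => exact Ct.empty hw (by simp) (by simp)
  | insert a J ha ih =>
    rw [Finset.sum_insert ha, Finset.sum_insert ha, Finset.biUnion_insert]
    exact Ct.hcut (hp a (Finset.mem_insert_self _ _))
      (ih (fun j hj => hp j (Finset.mem_insert_of_mem hj))) le_rfl subset_rfl le_rfl

theorem Ct.vsum {κ : Type} [DecidableEq κ] (J : Finset κ) {h : ℝ} (hh : 0 ≤ h) (k : κ → ℕ)
    (w : κ → ℝ) (S : κ → Finset ι) (hp : ∀ j ∈ J, Ct D ε M (k j) (w j) h (S j)) :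
    Ct D ε M (∑ j ∈ J, k j) (∑ j ∈ J, w j) h (J.biUnion S) := by
  induction J using Finset.induction_on with
  | empty => exact Ct.empty (by simp) hh (by simp)
  | insert a J ha ih =>
    rw [Finset.sum_insert ha, Finset.sum_insert ha, Finset.biUnion_insert]
    exact Ct.vcut (hp a (Finset.mem_insert_self _ _))
      (ih (fun j hj => hp j (Finset.mem_insert_of_mem hj))) le_rfl subset_rfl le_rfl

theorem Pk.hsum {κ : Type} [DecidableEq κ] (J : Finset κ) {w : ℝ} (hw : 0 ≤ w)
    (h : κ → ℝ) (S : κ → Finset ι) (hp : ∀ j ∈ J, Pk D w (h j) (S j)) :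
    Pk D w (∑ j ∈ J, h j) (J.biUnion S) := by
  induction J using Finset.induction_on with
  | empty => simpa using Pk.empty hw le_rfl
  | insert a J ha ih =>
    rw [Finset.sum_insert ha, Finset.biUnion_insert]
    exact Pk.hcut (hp a (Finset.mem_insert_self _ _))
      (ih (fun j hj => hp j (Finset.mem_insert_of_mem hj))) le_rfl subset_rfl

end Basics

section Tools
variable {ι : Type} [DecidableEq ι] {D : Dims ι} {ε : ℝ} {M : ι → Prop}

/-- STRIP lemma: x-coordinates such that vertical strips can be removed. -/
theorem Pk.strip {w h : ℝ} {S : Finset ι} (hp : Pk D w h S) :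
    ∃ a : ι → ℝ, (∀ i ∈ S, 0 ≤ a i ∧ a i + D.w i ≤ w) ∧
      ∀ x η : ℝ, 0 ≤ x → 0 ≤ η → x + η ≤ w →
        Pk D (w - η) h (S.filter fun i => a i + D.w i ≤ x ∨ x + η ≤ a i) := by
  induction hp with
  | @leaf w h S h1 h2 h3 h4 =>
    refine ⟨fun _ => 0, fun i hi => ⟨le_rfl, by simpa using (h4 i hi).1⟩, ?_⟩
    intro x η hx hη hxη
    refine Pk.leaf (by linarith) h2
      ((Finset.card_le_card (Finset.filter_subset _ _)).trans h3) ?_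
    intro i hi
    rw [Finset.mem_filter] at hi
    refine ⟨?_, (h4 i hi.1).2⟩
    rcases hi.2 with h | h
    · linarith
    · have := (h4 i hi.1).1; linarith
  | @vcut w h w1 w2 S S1 S2 p1 p2 hw hS i1 i2 =>
    obtain ⟨a1, ha1, hs1⟩ := i1
    obtain ⟨a2, ha2, hs2⟩ := i2
    have n1 := p1.nonneg
    have n2 := p2.nonneg
    refine ⟨fun i => if i ∈ S1 then a1 i else w1 + a2 i, ?_, ?_⟩
    · intro i hi
      by_cases h1 : i ∈ S1
      · simp only [h1, if_true]
        have := ha1 i h1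
        exact ⟨this.1, by linarith⟩
      · simp only [h1, if_false]
        have := ha2 i (by have := hS hi; simp [h1] at this; exact this)
        exact ⟨by linarith, by linarith⟩
    · intro x η hx hη hxη
      rcases le_total (x + η) w1 with hc | hc
      · refine Pk.vcut (hs1 x η hx hη hc) p2 (by linarith) ?_
        intro i hi
        rw [Finset.mem_filter] at hi
        rw [Finset.mem_union, Finset.mem_filter]
        by_cases h1 : i ∈ S1
        · simp only [h1, if_true] at hi
          exact Or.inl ⟨h1, hi.2⟩
        · right
          have := hS hi.1; simp [h1] at this; exact this
      · rcases le_total w1 x with hc2 | hc2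
        · by_cases hc3 : x + η ≤ w1 + w2
          · refine Pk.vcut p1 (hs2 (x - w1) η (by linarith) hη (by linarith)) (by linarith) ?_
            intro i hi
            rw [Finset.mem_filter] at hi
            rw [Finset.mem_union, Finset.mem_filter]
            by_cases h1 : i ∈ S1
            · exact Or.inl h1
            · right
              simp only [h1, if_false] at hi
              refine ⟨by have := hS hi.1; simp [h1] at this; exact this, ?_⟩
              rcases hi.2 with h | h
              · left; linarith
              · right; linarith
          · push Not at hc3
            by_cases hc4 : x ≤ w1 + w2
            · refine Pk.vcut p1 (hs2 (x - w1) (w1 + w2 - x) (by linarith) (by linarith)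
                (by linarith)) (by linarith) ?_
              intro i hi
              rw [Finset.mem_filter] at hi
              rw [Finset.mem_union, Finset.mem_filter]
              by_cases h1 : i ∈ S1
              · exact Or.inl h1
              · right
                simp only [h1, if_false] at hi
                have hm : i ∈ S2 := by have := hS hi.1; simp [h1] at this; exact this
                refine ⟨hm, ?_⟩
                rcases hi.2 with h | h
                · left; linarith
                · right; linarith
            · push Not at hc4
              exact Pk.vcut p1 p2 (by linarith) ((Finset.filter_subset _ _).trans hS)
        · -- straddle
          have e1 := hs1 x (w1 - x) hx (by linarith) (by linarith)
          by_cases hc3 : x + η ≤ w1 + w2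
          · refine Pk.vcut e1 (hs2 0 (x + η - w1) le_rfl (by linarith) (by linarith))
              (by linarith) ?_
            intro i hi
            rw [Finset.mem_filter] at hi
            rw [Finset.mem_union, Finset.mem_filter, Finset.mem_filter]
            by_cases h1 : i ∈ S1
            · left
              simp only [h1, if_true] at hi
              refine ⟨h1, ?_⟩
              rcases hi.2 with h | h
              · left; linarith
              · right; linarith
            · right
              simp only [h1, if_false] at hi
              have hm : i ∈ S2 := by have := hS hi.1; simp [h1] at this; exact this
              refine ⟨hm, ?_⟩
              have := ha2 i hm
              have := D.wpos i
              rcases hi.2 with h | h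
              · left; linarith
              · right; linarith
          · push Not at hc3
            refine Pk.vcut e1 (hs2 0 w2 le_rfl (by linarith) (by linarith))
              (by linarith) ?_
            intro i hi
            rw [Finset.mem_filter] at hi
            rw [Finset.mem_union, Finset.mem_filter, Finset.mem_filter]
            by_cases h1 : i ∈ S1
            · left
              simp only [h1, if_true] at hi
              refine ⟨h1, ?_⟩
              rcases hi.2 with h | h
              · left; linarith
              · right; linarith
            · right
              simp only [h1, if_false] at hi
              have hm : i ∈ S2 := by have := hS hi.1; simp [h1] at this; exact this
              refine ⟨hm, ?_⟩
              have := ha2 i hm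
              have := D.wpos i
              rcases hi.2 with h | h
              · left; linarith
              · right; linarith
  | @hcut w h h1 h2 S S1 S2 p1 p2 hh hS i1 i2 =>
    obtain ⟨a1, ha1, hs1⟩ := i1
    obtain ⟨a2, ha2, hs2⟩ := i2
    refine ⟨fun i => if i ∈ S1 then a1 i else a2 i, ?_, ?_⟩
    · intro i hi
      by_cases h1 : i ∈ S1
      · simp only [h1, if_true]
        exact ha1 i h1
      · simp only [h1, if_false]
        exact ha2 i (by have := hS hi; simp [h1] at this; exact this)
    · intro x η hx hη hxη
      refine Pk.hcut (hs1 x η hx hη hxη) (hs2 x η hx hη hxη) hh ?_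
      intro i hi
      rw [Finset.mem_filter] at hi
      rw [Finset.mem_union, Finset.mem_filter, Finset.mem_filter]
      by_cases h1 : i ∈ S1
      · simp only [h1, if_true] at hi
        exact Or.inl ⟨h1, hi.2⟩
      · simp only [h1, if_false] at hi
        exact Or.inr ⟨by have := hS hi.1; simp [h1] at this; exact this, hi.2⟩

theorem Pk.stripY {w h : ℝ} {S : Finset ι} (hp : Pk D w h S) :
    ∃ a : ι → ℝ, (∀ i ∈ S, 0 ≤ a i ∧ a i + D.h i ≤ h) ∧
      ∀ x η : ℝ, 0 ≤ x → 0 ≤ η → x + η ≤ h →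
        Pk D w (h - η) (S.filter fun i => a i + D.h i ≤ x ∨ x + η ≤ a i) := by
  obtain ⟨a, h1, h2⟩ := hp.tr.strip
  exact ⟨a, h1, fun x η hx hη hxη => (h2 x η hx hη hxη).tr⟩

/-- Pigeonhole: each item belongs to at most `c` of the `n` classes. -/
theorem pigeon (p : ι → ℝ) (hp : ∀ i, 0 ≤ p i) (S : Finset ι) (n c : ℕ) (hn : 0 < n)
    (R : ℕ → Finset ι)
    (hR : ∀ i ∈ S, ((Finset.range n).filter (fun j => i ∈ R j)).card ≤ c) :
    ∃ j < n, (n : ℝ) * ∑ i ∈ S ∩ R j, p i ≤ c * ∑ i ∈ S, p i := by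
  by_contra hcon
  push Not at hcon
  have h1 : ∑ j ∈ Finset.range n, ∑ i ∈ S ∩ R j, p i ≤ c * ∑ i ∈ S, p i := by
    have : ∀ j, ∑ i ∈ S ∩ R j, p i = ∑ i ∈ S, if i ∈ R j then p i else 0 := by
      intro j
      rw [← Finset.sum_filter, Finset.filter_mem_eq_inter]
    simp_rw [this]
    rw [Finset.sum_comm, Finset.mul_sum]
    refine Finset.sum_le_sum (fun i hi => ?_)
    rw [← Finset.sum_filter, Finset.sum_const, nsmul_eq_mul]
    have := hR i hi
    exact mul_le_mul_of_nonneg_right (by exact_mod_cast this) (hp i)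
  have h2 : ∑ j ∈ Finset.range n, (c * ∑ i ∈ S, p i) <
      ∑ j ∈ Finset.range n, (n : ℝ) * ∑ i ∈ S ∩ R j, p i := by
    refine Finset.sum_lt_sum_of_nonempty (Finset.nonempty_range_iff.2 hn.ne') ?_
    intro j hj
    exact hcon j (Finset.mem_range.1 hj)
  rw [Finset.sum_const, Finset.card_range, nsmul_eq_mul, ← Finset.mul_sum] at h2
  have hn' : (0 : ℝ) < n := by exact_mod_cast hn
  have := lt_of_mul_lt_mul_left h2 hn'.le
  linarith

/-- disjoint version of the pigeonhole principle -/
theorem pigeon1 (p : ι → ℝ) (hp : ∀ i, 0 ≤ p i) (S : Finset ι) (n : ℕ) (hn : 0 < n)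
    (R : ℕ → Finset ι)
    (hR : ∀ i ∈ S, ∀ j < n, ∀ j' < n, j < j' → i ∈ R j → i ∈ R j' → False) :
    ∃ j < n, (n : ℝ) * ∑ i ∈ S ∩ R j, p i ≤ ∑ i ∈ S, p i := by
  have := pigeon p hp S n 1 hn R (by
    intro i hi
    rw [Finset.card_le_one]
    intro a ha b hb
    rw [Finset.mem_filter, Finset.mem_range] at ha hb
    rcases lt_trichotomy a b with h | h | h
    · exact (hR i hi a ha.1 b hb.1 h ha.2 hb.2).elim
    · exact h
    · exact (hR i hi b hb.1 a ha.1 h hb.2 ha.2).elim)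
  simpa using this

/-- Window lemma: among `n` windows of length `η` with spacing `Δ`, one is crossed by few items. -/
theorem window (p : ι → ℝ) (hp : ∀ i, 0 ≤ p i) (S : Finset ι) (a len : ι → ℝ) (n : ℕ)
    (hn : 0 < n) (x0 Δ η : ℝ) (hlen : ∀ i ∈ S, len i ≤ Δ - η) (hΔ : 0 ≤ Δ) :
    ∃ j < n, (n : ℝ) * ∑ i ∈ S \ S.filter (fun i => a i + len i ≤ x0 + j * Δ ∨
        x0 + j * Δ + η ≤ a i), p i ≤ ∑ i ∈ S, p i := by
  obtain ⟨j, hj, h⟩ := pigeon1 p hp S n hn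
    (fun j => S \ S.filter (fun i => a i + len i ≤ x0 + j * Δ ∨ x0 + j * Δ + η ≤ a i)) (by
      intro i hi j hj j' hj' hjj' h1 h2
      simp only [Finset.mem_sdiff, Finset.mem_filter, not_and, not_or, not_le] at h1 h2
      have e1 := h1.2 hi
      have e2 := h2.2 hi
      have e3 := hlen i hi
      have : ((j : ℝ) + 1) * Δ ≤ j' * Δ := by
        refine mul_le_mul_of_nonneg_right ?_ hΔ
        exact_mod_cast hjj'
      linarith [e1.2, e2.1])
  refine ⟨j, hj, ?_⟩
  rwa [Finset.inter_eq_right.2 Finset.sdiff_subset] at h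

/-- TOP lemma -/
theorem top_lemma (D : Dims ι) (μ b : ℝ) (hb : 0 ≤ b) (S : Finset ι)
    (hμ : ∀ i ∈ S, D.h i ≤ μ) (hs : b - μ < ∑ i ∈ S, D.h i) :
    ∃ (F : Finset ι) (W : ℝ), F ⊆ S ∧ 0 ≤ W ∧ (∀ i ∈ F, W ≤ D.w i) ∧ (∀ i ∈ S \ F, D.w i ≤ W) ∧
      b - μ < ∑ i ∈ F, D.h i ∧ ∑ i ∈ F, D.h i ≤ b := by
  induction hn : S.card using Nat.strong_induction_on generalizing S with
  | _ n ih =>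
    by_cases hc : ∑ i ∈ S, D.h i ≤ b
    · exact ⟨S, 0, subset_rfl, le_rfl, fun i _ => D.w0 i, by simp, hs, hc⟩
    · push Not at hc
      have hne : S.Nonempty := by
        rw [Finset.nonempty_iff_ne_empty]
        rintro rfl
        simp at hc; linarith
      obtain ⟨x, hx, hmin⟩ := Finset.exists_min_image S D.w hne
      have hsum : ∑ i ∈ S.erase x, D.h i = ∑ i ∈ S, D.h i - D.h x := by
        rw [← Finset.add_sum_erase S D.h hx]; ring
      obtain ⟨F, W, hF, h0, h1, h2, h3, h4⟩ := ih (S.erase x).card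
        (by rw [← hn]; exact Finset.card_erase_lt_of_mem hx) (S.erase x)
        (fun i hi => hμ i (Finset.mem_of_mem_erase hi))
        (by rw [hsum]; linarith [hμ x hx]) rfl
      refine ⟨F, max W (D.w x), hF.trans (Finset.erase_subset _ _), le_max_of_le_left h0,
        ?_, ?_, h3, h4⟩
      · intro i hi
        exact max_le (h1 i hi) (hmin i (Finset.mem_of_mem_erase (hF hi)))
      · intro i hi
        rw [Finset.mem_sdiff] at hi
        by_cases hix : i = x
        · subst hix; exact le_max_right _ _
        · exact le_max_of_le_left (h2 i (Finset.mem_sdiff.2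
            ⟨Finset.mem_erase.2 ⟨hix, hi.1⟩, hi.2⟩))

/-- next-fit style area packing -/
theorem nf_pack (D : Dims ι) (μ b : ℝ) (hμ0 : 0 ≤ μ) (hb : μ < b) (S : Finset ι) (W a : ℝ)
    (hW : 0 ≤ W) (hWa : W ≤ a)
    (hμ : ∀ i ∈ S, D.h i ≤ μ) (hw : ∀ i ∈ S, D.w i ≤ W)
    (ha : ∑ i ∈ S, D.w i * D.h i ≤ (b - μ) * (a - W)) : Pk D a b S := by
  induction hn : S.card using Nat.strong_induction_on generalizing S W a with
  | _ n ih =>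
    by_cases hc : ∑ i ∈ S, D.h i ≤ b
    · exact Pk.hstack (hW.trans hWa) (hμ0.trans hb.le) (fun i hi => (hw i hi).trans hWa) hc
    · push Not at hc
      obtain ⟨F, W2, hF, h0, h1, h2, h3, h4⟩ := top_lemma D μ b (by linarith) S hμ (by linarith)
      have hne : F.Nonempty := by
        rw [Finset.nonempty_iff_ne_empty]
        rintro rfl
        simp at h3; linarith
      obtain ⟨x, hx⟩ := hne
      have hW2 : W2 ≤ W := (h1 x hx).trans (hw x (hF hx))
      have hA : W2 * (b - μ) ≤ ∑ i ∈ F, D.w i * D.h i := by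
        calc W2 * (b - μ) ≤ W2 * ∑ i ∈ F, D.h i := by gcongr
          _ = ∑ i ∈ F, W2 * D.h i := by rw [Finset.mul_sum]
          _ ≤ _ := Finset.sum_le_sum (fun i hi => by
              have := D.h0 i; have := h1 i hi; gcongr)
      have hsp := sum_sdiff' (f := fun i => D.w i * D.h i) hF
      have hnn : 0 ≤ ∑ i ∈ S \ F, D.w i * D.h i :=
        Finset.sum_nonneg (fun i _ => mul_nonneg (D.w0 i) (D.h0 i))
      have hle : ∑ i ∈ S \ F, D.w i * D.h i ≤ (b - μ) * (a - W - W2) := by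
        nlinarith
      have hpos : 0 ≤ a - W - W2 := by
        by_contra hneg
        push Not at hneg
        nlinarith
      refine Pk.vcut (w1 := W) (w2 := a - W) (S1 := F) (S2 := S \ F)
        (Pk.hstack hW (hμ0.trans hb.le) (fun i hi => hw i (hF hi)) h4)
        (ih (S \ F).card ?_ (S \ F) W2 (a - W) h0 (by linarith)
          (fun i hi => hμ i (Finset.mem_sdiff.1 hi).1) h2 hle rfl) (by linarith) ?_
      · rw [← hn]
        exact Finset.card_lt_card (Finset.sdiff_ssubset hF ⟨x, hx⟩)
      · intro i hi
        by_cases hif : i ∈ F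
        · simp [hif]
        · simp [hif, hi]

/-- tall items occupy disjoint x-ranges -/
theorem Pk.tall_sum {w h : ℝ} {S : Finset ι} (hp : Pk D w h S) (τ : ℝ) (hτ : h < 2 * τ) :
    ∑ i ∈ S.filter (fun i => τ ≤ D.h i), D.w i ≤ w := by
  induction hp with
  | @leaf w h S h1 h2 h3 h4 =>
    rcases S.eq_empty_or_nonempty with rfl | ⟨x, hx⟩
    · simpa using h1
    · have hSx : S = {x} :=
        Finset.eq_singleton_iff_unique_mem.2 ⟨hx, fun y hy => Finset.card_le_one.1 h3 y hy x hx⟩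
      have := h4 x hx
      refine (sum_mono_set D.w0 (Finset.filter_subset _ _)).trans ?_
      rw [hSx, Finset.sum_singleton]
      exact this.1
  | @vcut w h w1 w2 S S1 S2 p1 p2 hw hS i1 i2 =>
    have := sum_cover_le (f := D.w) D.w0 (S := S.filter (fun i => τ ≤ D.h i))
      (S1 := S1.filter (fun i => τ ≤ D.h i)) (S2 := S2.filter (fun i => τ ≤ D.h i)) (by
        rw [← Finset.filter_union]
        exact Finset.filter_subset_filter _ hS)
    linarith [i1 hτ, i2 hτ]
  | @hcut w h h1 h2 S S1 S2 p1 p2 hh hS i1 i2 =>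
    have n1 := p1.nonneg
    have n2 := p2.nonneg
    rcases le_total h1 h2 with hc | hc
    · refine le_trans ?_ (i2 (by linarith))
      refine sum_mono_set D.w0 ?_
      intro i hi
      rw [Finset.mem_filter] at hi ⊢
      refine ⟨?_, hi.2⟩
      rcases Finset.mem_union.1 (hS hi.1) with h | h
      · have := (p1.dim_le i h).2; linarith [hi.2]
      · exact h
    · refine le_trans ?_ (i1 (by linarith))
      refine sum_mono_set D.w0 ?_
      intro i hi
      rw [Finset.mem_filter] at hi ⊢
      refine ⟨?_, hi.2⟩
      rcases Finset.mem_union.1 (hS hi.1) with h | h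
      · exact h
      · have := (p2.dim_le i h).2; linarith [hi.2]

theorem Pk.wide_sum {w h : ℝ} {S : Finset ι} (hp : Pk D w h S) (τ : ℝ) (hτ : w < 2 * τ) :
    ∑ i ∈ S.filter (fun i => τ ≤ D.w i), D.h i ≤ h := hp.tr.tall_sum τ hτ

theorem wt_emp (S : Finset ι) (q : ι → Prop) [DecidablePred q] (f : ι → ℝ) (c : ℝ)
    (hq : ∀ i ∈ S, ¬ q i) : ∑ i ∈ S.filter q, f i ≤ max c 0 := by
  rw [Finset.filter_false_of_mem hq]
  simp

theorem wt_key (D : Dims ι) {w h : ℝ} {S : Finset ι} (ω τ : ℝ)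
    (hω : w < 2 * ω) (hτ : h < 2 * τ) (w1 w2 : ℝ) (S1 S2 : Finset ι)
    (p1 : Pk D w1 h S1) (p2 : Pk D w2 h S2) (hw : w1 + w2 ≤ w) (hS : S ⊆ S1 ∪ S2) (hle : w2 ≤ w1)
    (ih : ∑ i ∈ (S ∩ S1).filter (fun i => ω ≤ D.w i), D.h i ≤ max (h - τ) 0 ∨
        ∑ i ∈ (S ∩ S1).filter (fun i => τ ≤ D.h i), D.w i ≤ max (w1 - ω) 0) :
    ∑ i ∈ S.filter (fun i => ω ≤ D.w i), D.h i ≤ max (h - τ) 0 ∨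
        ∑ i ∈ S.filter (fun i => τ ≤ D.h i), D.w i ≤ max (w - ω) 0 := by
  have n1 := p1.nonneg
  have n2 := p2.nonneg
  have hsub : S.filter (fun i => ω ≤ D.w i) ⊆ (S ∩ S1).filter (fun i => ω ≤ D.w i) := by
    intro i hi
    rw [Finset.mem_filter] at hi ⊢
    refine ⟨Finset.mem_inter.2 ⟨hi.1, ?_⟩, hi.2⟩
    rcases Finset.mem_union.1 (hS hi.1) with h | h
    · exact h
    · have := (p2.dim_le i h).1; linarith [hi.2]
  by_cases hc : w1 < ω
  · left
    apply wt_emp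
    intro i hi hi2
    rcases Finset.mem_union.1 (hS hi) with h | h
    · have := (p1.dim_le i h).1; linarith
    · have := (p2.dim_le i h).1; linarith
  · push Not at hc
    rcases ih with ih | ih
    · left; exact (sum_mono_set D.h0 hsub).trans ih
    · right
      have hcov := sum_cover_le (f := D.w) D.w0 (S := S.filter (fun i => τ ≤ D.h i))
        (S1 := (S ∩ S1).filter (fun i => τ ≤ D.h i)) (S2 := S2.filter (fun i => τ ≤ D.h i)) (by
          rw [← Finset.filter_union]
          refine Finset.filter_subset_filter _ ?_
          intro i hi
          have := hS hi
          simp only [Finset.mem_union, Finset.mem_inter] at this ⊢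
          tauto)
      have := p2.tall_sum τ hτ
      rw [max_eq_left (by linarith)] at ih
      refine le_max_of_le_left ?_
      linarith

/-- WT lemma -/
theorem Pk.wide_tall {w h : ℝ} {S : Finset ι} (hp : Pk D w h S) (ω τ : ℝ)
    (hno : ∀ i ∈ S, ¬ (ω ≤ D.w i ∧ τ ≤ D.h i)) (hω : w < 2 * ω) (hτ : h < 2 * τ) :
    ∑ i ∈ S.filter (fun i => ω ≤ D.w i), D.h i ≤ max (h - τ) 0 ∨
    ∑ i ∈ S.filter (fun i => τ ≤ D.h i), D.w i ≤ max (w - ω) 0 := by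
  have main : ∀ {w h : ℝ} {S : Finset ι}, Pk D w h S → ∀ T ⊆ S, 
      ∀ hno : (∀ i ∈ T, ¬ (ω ≤ D.w i ∧ τ ≤ D.h i)), w < 2 * ω → h < 2 * τ → 
      (∑ i ∈ T.filter (fun i => ω ≤ D.w i), D.h i ≤ max (h - τ) 0 ∨
        ∑ i ∈ T.filter (fun i => τ ≤ D.h i), D.w i ≤ max (w - ω) 0) := by
    intro w h S hp
    induction hp with
    | @leaf w h S h1 h2 h3 h4 =>
      intro T hT hno hω hτ
      rcases T.eq_empty_or_nonempty with rfl | ⟨x, hx⟩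
      · left; simp
      · have hSx : T = {x} := Finset.eq_singleton_iff_unique_mem.2
          ⟨hx, fun y hy => Finset.card_le_one.1 h3 y (hT hy) x (hT hx)⟩
        by_cases hcx : ω ≤ D.w x
        · right
          apply wt_emp
          intro i hi
          rw [hSx, Finset.mem_singleton] at hi
          subst hi
          intro h; exact hno _ hx ⟨hcx, h⟩
        · left
          apply wt_emp
          intro i hi
          rw [hSx, Finset.mem_singleton] at hi
          subst hi
          exact hcx
    | @vcut w h w1 w2 S S1 S2 p1 p2 hw hS i1 i2 =>
      intro T hT hno hω hτ
      have n1 := p1.nonneg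
      have n2 := p2.nonneg
      rcases le_total w2 w1 with hc | hc
      · exact wt_key D ω τ hω hτ w1 w2 S1 S2 p1 p2 hw (hT.trans hS) hc
          (i1 (T ∩ S1) Finset.inter_subset_right (fun i hi => hno i (Finset.mem_inter.1 hi).1)
            (by linarith) hτ)
      · exact wt_key D ω τ hω hτ w2 w1 S2 S1 p2 p1 (by linarith)
          (by rw [Finset.union_comm]; exact hT.trans hS) hc
          (i2 (T ∩ S2) Finset.inter_subset_right (fun i hi => hno i (Finset.mem_inter.1 hi).1)
            (by linarith) hτ)
    | @hcut w h h1 h2 S S1 S2 p1 p2 hh hS i1 i2 =>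
      intro T hT hno hω hτ
      have n1 := p1.nonneg
      have n2 := p2.nonneg
      rcases le_total h2 h1 with hc | hc
      · exact (wt_key D.T τ ω hτ hω h1 h2 S1 S2 p1.tr p2.tr hh (hT.trans hS) hc
          (i1 (T ∩ S1) Finset.inter_subset_right (fun i hi => hno i (Finset.mem_inter.1 hi).1)
            hω (by linarith)).symm).symm
      · exact (wt_key D.T τ ω hτ hω h2 h1 S2 S1 p2.tr p1.tr (by linarith)
          (by rw [Finset.union_comm]; exact hT.trans hS) hc
          (i2 (T ∩ S2) Finset.inter_subset_right (fun i hi => hno i (Finset.mem_inter.1 hi).1)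
            hω (by linarith)).symm).symm
  exact main hp S subset_rfl hno hω hτ

end Tools

section KRsec
variable {ι : Type} [DecidableEq ι]

theorem take_lemma (f : ι → ℝ) (hf : ∀ i, 0 ≤ f i) (μ l : ℝ) (hl : 0 ≤ l) (T : Finset ι)
    (hμ : ∀ i ∈ T, f i ≤ μ) :
    ∃ F ⊆ T, ∑ i ∈ F, f i ≤ l ∧ (F = T ∨ l - μ < ∑ i ∈ F, f i) := by
  induction T using Finset.induction_on with
  | empty => exact ⟨∅, subset_rfl, by simpa using hl, Or.inl rfl⟩
  | insert a T ha ih =>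
    obtain ⟨F, hF, h1, h2⟩ := ih (fun i hi => hμ i (Finset.mem_insert_of_mem hi))
    rcases h2 with rfl | h2
    · by_cases hc : f a + ∑ i ∈ F, f i ≤ l
      · exact ⟨insert a F, subset_rfl, by rwa [Finset.sum_insert ha], Or.inl rfl⟩
      · refine ⟨F, Finset.subset_insert _ _, h1, Or.inr ?_⟩
        have := hμ a (Finset.mem_insert_self _ _)
        linarith
    · exact ⟨F, hF.trans (Finset.subset_insert _ _), h1, Or.inr h2⟩

theorem fill_lemma {κ : Type} [DecidableEq κ] (f : ι → ℝ) (hf : ∀ i, 0 ≤ f i) (μ : ℝ)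
    (l : κ → ℝ) (J : Finset κ) (hl : ∀ j ∈ J, 0 ≤ l j) (T : Finset ι)
    (hμ : ∀ i ∈ T, f i ≤ μ) :
    ∃ A : κ → Finset ι, (∀ j, A j ⊆ T) ∧ (∀ j ∈ J, ∑ i ∈ A j, f i ≤ l j) ∧
      ∑ i ∈ T \ J.biUnion A, f i ≤ max 0 (∑ i ∈ T, f i - ∑ j ∈ J, (l j - μ)) := by
  induction J using Finset.induction_on with
  | empty => exact ⟨fun _ => ∅, by simp, by simp, by simp⟩
  | insert a J ha ih =>
    obtain ⟨A, h1, h2, h3⟩ := ih (fun j hj => hl j (Finset.mem_insert_of_mem hj))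
    obtain ⟨F, hF, h4, h5⟩ := take_lemma f hf μ (l a) (hl a (Finset.mem_insert_self _ _))
      (T \ J.biUnion A) (fun i hi => hμ i (Finset.mem_sdiff.1 hi).1)
    have hbi : (insert a J).biUnion (Function.update A a F) = F ∪ J.biUnion A := by
      rw [Finset.biUnion_insert, Function.update_self]
      congr 1
      refine Finset.biUnion_congr rfl (fun j hj => ?_)
      rw [Function.update_of_ne]
      rintro rfl; exact ha hj
    refine ⟨Function.update A a F, ?_, ?_, ?_⟩
    · intro j
      by_cases hj : j = a
      · subst hj; rw [Function.update_self]; exact hF.trans Finset.sdiff_subset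
      · rw [Function.update_of_ne hj]; exact h1 j
    · intro j hj
      by_cases hj' : j = a
      · subst hj'; rw [Function.update_self]; exact h4
      · rw [Function.update_of_ne hj']
        exact h2 j (Finset.mem_of_mem_insert_of_ne hj hj')
    · rw [hbi, Finset.sum_insert ha]
      have e : T \ (F ∪ J.biUnion A) = (T \ J.biUnion A) \ F := by
        ext i; simp only [Finset.mem_sdiff, Finset.mem_union]; tauto
      rw [e]
      have hs := sum_sdiff' (f := f) hF
      have hF0 : 0 ≤ ∑ i ∈ F, f i := Finset.sum_nonneg (fun i _ => hf i)
      rcases h5 with h5 | h5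
      · rw [h5]; simp
      · rcases le_total (∑ i ∈ T, f i - ∑ j ∈ J, (l j - μ)) 0 with hc | hc
        · rw [max_eq_left hc] at h3
          exact le_max_of_le_left (by linarith)
        · rw [max_eq_right hc] at h3
          exact le_max_of_le_right (by linarith)

theorem grp_lemma (D : Dims ι) (δ ν1 μ : ℝ) (hν1 : 0 ≤ ν1) (hμν : 0 ≤ μ) (m : ℕ) (S : Finset ι)
    (hμ : ∀ i ∈ S, D.h i ≤ μ) (hδ : ∀ i ∈ S, δ ≤ D.w i)
    (hs : ∑ i ∈ S, D.h i ≤ m * (ν1 - μ)) :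
    ∃ (cls : ι → ℕ) (u : ℕ → ℝ), (∀ k, δ ≤ u k) ∧ (∀ i ∈ S, cls i < m) ∧
      (∀ i ∈ S, u (cls i) ≤ D.w i) ∧ (∀ i ∈ S, ∀ k, cls i = k + 1 → D.w i ≤ u k) ∧
      (∀ k, ∑ i ∈ S.filter (fun i => cls i = k), D.h i ≤ ν1) ∧
      (∀ k, (∃ i ∈ S, cls i = k + 1) →
        ν1 - μ < ∑ i ∈ S.filter (fun i => cls i = k), D.h i) := by
  induction m generalizing S with
  | zero =>
    have : S = ∅ := by
      rw [Finset.eq_empty_iff_forall_notMem]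
      intro i hi
      have h1 := Finset.single_le_sum (f := D.h) (fun i _ => D.h0 i) hi
      have := D.hpos i
      simp at hs; linarith
    subst this
    exact ⟨fun _ => 0, fun _ => δ, by simp, by simp, by simp, by simp, by simpa using hν1, by simp⟩
  | succ m ih =>
    by_cases hc : ∑ i ∈ S, D.h i ≤ ν1 - μ
    · refine ⟨fun _ => 0, fun _ => δ, by simp, by simp, by simpa using hδ, by simp, ?_, by simp⟩
      intro k
      exact (sum_mono_set D.h0 (Finset.filter_subset _ _)).trans (by linarith)
    · push Not at hc
      obtain ⟨F, W, hF, h0, h1, h2, h3, h4⟩ := top_lemma D μ ν1 hν1 S hμ hc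
      have hsp := sum_sdiff' (f := D.h) hF
      obtain ⟨cls, u, g1, g2, g3, g4, g5, g6⟩ := ih (S \ F)
        (fun i hi => hμ i (Finset.mem_sdiff.1 hi).1) (fun i hi => hδ i (Finset.mem_sdiff.1 hi).1)
        (by push_cast at hs; linarith)
      have eF : S.filter (fun i => (if i ∈ F then 0 else cls i + 1) = 0) = F := by
        ext i
        rw [Finset.mem_filter]
        by_cases hi : i ∈ F
        · simp [hi, hF hi]
        · simp [hi]
      have eS : ∀ k, S.filter (fun i => (if i ∈ F then 0 else cls i + 1) = k + 1) =
          (S \ F).filter (fun i => cls i = k) := by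
        intro k
        ext i
        rw [Finset.mem_filter, Finset.mem_filter, Finset.mem_sdiff]
        by_cases hi : i ∈ F
        · simp [hi]
        · simp [hi]
      refine ⟨fun i => if i ∈ F then 0 else cls i + 1,
        fun k => Nat.casesOn k (max δ W) u, ?_, ?_, ?_, ?_, ?_, ?_⟩
      · intro k; cases k with
        | zero => exact le_max_left _ _
        | succ k => exact g1 k
      · intro i hi
        by_cases hiF : i ∈ F
        · simp [hiF]
        · simp only [hiF, if_false]
          have := g2 i (Finset.mem_sdiff.2 ⟨hi, hiF⟩); omega
      · intro i hi
        by_cases hiF : i ∈ F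
        · simp only [hiF, if_true]
          exact max_le (hδ i hi) (h1 i hiF)
        · simp only [hiF, if_false]
          exact g3 i (Finset.mem_sdiff.2 ⟨hi, hiF⟩)
      · intro i hi k hk
        by_cases hiF : i ∈ F
        · simp [hiF] at hk
        · simp only [hiF, if_false, add_left_inj] at hk
          cases k with
          | zero => exact le_max_of_le_right (h2 i (Finset.mem_sdiff.2 ⟨hi, hiF⟩))
          | succ k => exact g4 i (Finset.mem_sdiff.2 ⟨hi, hiF⟩) k hk
      · intro k
        cases k with
        | zero => rw [eF]; exact h4
        | succ k => rw [eS]; exact g5 k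
      · rintro k ⟨i, hi, hk⟩
        by_cases hiF : i ∈ F
        · simp [hiF] at hk
        · simp only [hiF, if_false, add_left_inj] at hk
          cases k with
          | zero => rw [eF]; exact h3
          | succ k => rw [eS]; exact g6 k ⟨i, Finset.mem_sdiff.2 ⟨hi, hiF⟩, hk⟩

/-- configurations of width at most `w` -/
def CfgSet {m : ℕ} (u : Fin m → ℝ) (w : ℝ) : Set (Fin m → ℝ) :=
  {v | ∃ c : Fin m → ℕ, (∀ k, v k = c k) ∧ ∑ k, (c k : ℝ) * u k ≤ w}

open scoped Pointwise in
theorem cfg_hull {D : Dims ι} {m : ℕ} (u : Fin m → ℝ) (cls : ι → ℕ)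
    {w h : ℝ} {S : Finset ι} (hp : Pk D w h S) : ∀ T ⊆ S,
    (∀ i ∈ T, ∀ k : Fin m, cls i = k → u k ≤ D.w i) →
    (fun k : Fin m => ∑ i ∈ T.filter (fun i => cls i = k), D.h i) ∈
      h • convexHull ℝ (CfgSet u w) := by
  have zero_mem : ∀ {w : ℝ}, 0 ≤ w → (0 : Fin m → ℝ) ∈ convexHull ℝ (CfgSet u w) := by
    intro w hw
    exact subset_convexHull ℝ _ ⟨0, by simp, by simpa using hw⟩
  have mono_h : ∀ {w h h' : ℝ} {v : Fin m → ℝ}, 0 ≤ w → 0 ≤ h → h ≤ h' →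
      v ∈ h • convexHull ℝ (CfgSet u w) → v ∈ h' • convexHull ℝ (CfgSet u w) := by
    intro w h h' v hw hh hh' hv
    rcases eq_or_lt_of_le (hh.trans hh') with h0 | h0
    · have : h = h' := by linarith
      rwa [← this]
    · obtain ⟨x, hx, rfl⟩ := hv
      refine ⟨(h / h') • x, ?_, ?_⟩
      · have := (convex_convexHull ℝ (CfgSet u w)).smul_mem_of_zero_mem (zero_mem hw) hx
          (t := h / h') ⟨by positivity, by rw [div_le_one h0]; exact hh'⟩
        exact this
      · simp only [smul_smul]
        congr 1
        field_simp
  have mono_w : ∀ {w w' : ℝ}, w ≤ w' → CfgSet u w ⊆ CfgSet u w' := by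
    rintro w w' hw v ⟨c, h1, h2⟩
    exact ⟨c, h1, h2.trans hw⟩
  have split : ∀ (T S1 : Finset ι), (fun k : Fin m => ∑ i ∈ T.filter (fun i => cls i = k), D.h i)
      = (fun k : Fin m => ∑ i ∈ (T ∩ S1).filter (fun i => cls i = k), D.h i) +
        (fun k : Fin m => ∑ i ∈ (T \ S1).filter (fun i => cls i = k), D.h i) := by
    intro T S1
    funext k
    simp only [Pi.add_apply]
    rw [← Finset.sum_union]
    · congr 1
      ext i; simp only [Finset.mem_filter, Finset.mem_union, Finset.mem_inter, Finset.mem_sdiff]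
      tauto
    · rw [Finset.disjoint_left]
      intro i; simp only [Finset.mem_filter, Finset.mem_inter, Finset.mem_sdiff]
      tauto
  induction hp with
  | @leaf w h S h1 h2 h3 h4 =>
    intro T hT hu
    rcases T.eq_empty_or_nonempty with rfl | ⟨x, hx⟩
    · refine ⟨0, zero_mem h1, ?_⟩
      funext k; simp
    · have hSx : T = {x} := Finset.eq_singleton_iff_unique_mem.2
          ⟨hx, fun y hy => Finset.card_le_one.1 h3 y (hT hy) x (hT hx)⟩
      by_cases hk : cls x < m
      · refine mono_h h1 (D.h0 x) (h4 x (hT hx)).2 ?_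
        refine ⟨fun k => ((if cls x = k then 1 else 0 : ℕ) : ℝ), ?_, ?_⟩
        · refine subset_convexHull ℝ _ ⟨fun k => if cls x = k then 1 else 0, fun k => rfl, ?_⟩
          have : ∀ k : Fin m, (((if cls x = k then 1 else 0 : ℕ)) : ℝ) * u k =
            if k = ⟨cls x, hk⟩ then u k else 0 := by
            intro k
            by_cases hkk : cls x = k
            · have : k = ⟨cls x, hk⟩ := Fin.ext hkk.symm
              simp [hkk]
            · have : ¬ k = ⟨cls x, hk⟩ := fun h => hkk (by rw [h])
              simp [hkk, this]
          simp_rw [this]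
          rw [Finset.sum_ite_eq' Finset.univ]
          simp only [Finset.mem_univ, if_true]
          exact (hu x hx ⟨cls x, hk⟩ rfl).trans (h4 x (hT hx)).1
        · funext k
          rw [hSx]
          by_cases hkk : cls x = k
          · simp [Finset.filter_singleton, hkk]
          · simp [Finset.filter_singleton, hkk]
      · refine mono_h h1 le_rfl h2 ⟨0, zero_mem h1, ?_⟩
        funext k
        rw [hSx, Finset.filter_singleton]
        have : ¬ cls x = k := by have := k.2; omega
        simp [this]
  | @vcut w h w1 w2 S S1 S2 p1 p2 hw hS i1 i2 =>
    intro T hT hu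
    have n1 := p1.nonneg
    rw [split T S1]
    have e1 := i1 (T ∩ S1) Finset.inter_subset_right (fun i hi => hu i (Finset.mem_inter.1 hi).1)
    have e2 := i2 (T \ S1) (by
      intro i hi
      rw [Finset.mem_sdiff] at hi
      have := hS (hT hi.1)
      simpa [hi.2] using this) (fun i hi => hu i (Finset.mem_sdiff.1 hi).1)
    have := Set.add_mem_add e1 e2
    rw [← smul_add, ← convexHull_add] at this
    refine Set.smul_set_mono (convexHull_mono ?_) this
    rintro _ ⟨v1, ⟨c1, a1, b1⟩, v2, ⟨c2, a2, b2⟩, rfl⟩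
    refine ⟨c1 + c2, fun k => by simp [a1, a2], ?_⟩
    simp only [Pi.add_apply, Nat.cast_add, add_mul, Finset.sum_add_distrib]
    linarith
  | @hcut w h h1 h2 S S1 S2 p1 p2 hh hS i1 i2 =>
    intro T hT hu
    have n1 := p1.nonneg
    have n2 := p2.nonneg
    rw [split T S1]
    have e1 := i1 (T ∩ S1) Finset.inter_subset_right (fun i hi => hu i (Finset.mem_inter.1 hi).1)
    have e2 := i2 (T \ S1) (by
      intro i hi
      rw [Finset.mem_sdiff] at hi
      have := hS (hT hi.1)
      simpa [hi.2] using this) (fun i hi => hu i (Finset.mem_sdiff.1 hi).1)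
    have := Set.add_mem_add e1 e2
    rw [← (convex_convexHull ℝ (CfgSet u w)).add_smul n1.2 n2.2] at this
    exact mono_h n1.1 (by linarith) hh this

/-- explicit configuration weights -/
theorem cfg_weights {D : Dims ι} {m : ℕ} (u : Fin m → ℝ) (n0 : ℕ) (hu : ∀ k, 1 ≤ (n0 : ℝ) * u k)
    (hu0 : ∀ k, 0 ≤ u k) (cls : ι → ℕ)
    {h : ℝ} {S : Finset ι} (hp : Pk D 1 h S)
    (hS : ∀ i ∈ S, ∀ k : Fin m, cls i = k → u k ≤ D.w i) :
    ∃ (C : Finset (Fin m → ℕ)) (l : (Fin m → ℕ) → ℝ), C.card ≤ (n0 + 1) ^ m ∧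
      (∀ c ∈ C, 0 ≤ l c) ∧ (∀ c ∈ C, ∀ k, c k ≤ n0) ∧ (∀ c ∈ C, ∑ k, (c k : ℝ) * u k ≤ 1) ∧
      ∑ c ∈ C, l c = h ∧
      ∀ k : Fin m, ∑ i ∈ S.filter (fun i => cls i = k), D.h i = ∑ c ∈ C, l c * c k := by
  classical
  obtain ⟨v, hv, hvk⟩ := cfg_hull u cls hp S subset_rfl hS
  have bound : ∀ c : Fin m → ℕ, ∑ k, (c k : ℝ) * u k ≤ 1 → ∀ k, c k ≤ n0 := by
    intro c hc k
    by_contra hcon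
    push Not at hcon
    have h1 := Finset.single_le_sum (f := fun k => (c k : ℝ) * u k)
      (fun k _ => mul_nonneg (Nat.cast_nonneg _) (hu0 k)) (Finset.mem_univ k)
    have h2 : ((n0 : ℝ) + 1) ≤ c k := by exact_mod_cast hcon
    have h3 := hu k
    have h4 := hu0 k
    have h5 : 0 < u k := by
      rcases eq_or_lt_of_le h4 with h | h
      · rw [← h] at h3; simp at h3; linarith
      · exact h
    nlinarith
  set C : Finset (Fin m → ℕ) := (Fintype.piFinset (fun _ : Fin m => Finset.range (n0 + 1))).filter
    (fun c => ∑ k, (c k : ℝ) * u k ≤ 1) with hC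
  let e : (Fin m → ℕ) → (Fin m → ℝ) := fun c k => c k
  have einj : Function.Injective e := by
    intro c c' hcc
    funext k
    have : (c k : ℝ) = c' k := congrFun hcc k
    exact_mod_cast this
  have hset : CfgSet u 1 = ((C.image e : Finset (Fin m → ℝ)) : Set (Fin m → ℝ)) := by
    ext v
    simp only [CfgSet, Set.mem_setOf_eq, Finset.coe_image, Set.mem_image, Finset.mem_coe]
    constructor
    · rintro ⟨c, h1, h2⟩
      refine ⟨c, ?_, funext (fun k => (h1 k).symm)⟩
      rw [hC, Finset.mem_filter, Fintype.mem_piFinset]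
      refine ⟨fun k => ?_, h2⟩
      rw [Finset.mem_range]
      have := bound c h2 k; omega
    · rintro ⟨c, h1, rfl⟩
      exact ⟨c, fun k => rfl, (Finset.mem_filter.1 h1).2⟩
  rw [hset, Finset.mem_convexHull'] at hv
  obtain ⟨lam, l0, l1, l2⟩ := hv
  have hh := hp.nonneg.2
  rw [Finset.sum_image (fun a _ b _ h => einj h)] at l1 l2
  refine ⟨C, fun c => h * lam (e c), ?_, ?_, ?_, ?_, ?_, ?_⟩
  · refine (Finset.card_filter_le _ _).trans ?_
    rw [Fintype.card_piFinset]
    simp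
  · intro c hc
    exact mul_nonneg hh (l0 _ (Finset.mem_image_of_mem e hc))
  · intro c hc
    exact bound c (Finset.mem_filter.1 hc).2
  · intro c hc
    exact (Finset.mem_filter.1 hc).2
  · rw [← Finset.mul_sum, l1, mul_one]
  · intro k
    have h1 := congrFun hvk k
    have h2 := congrFun l2 k
    simp only [Pi.smul_apply, smul_eq_mul, Finset.sum_apply] at h1 h2
    rw [← h1, ← h2, Finset.mul_sum]
    refine Finset.sum_congr rfl (fun c _ => ?_)
    simp only [e]; ring

end KRsec

theorem lt_of_half {ε x y : ℝ} (h1 : ε ≤ 1 / 2) (hx : 0 ≤ x) (hy : 0 < y)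
    (h : y ≤ ε * x) : y < x := by nlinarith

set_option maxHeartbeats 2000000 in
theorem KR0 (ε ν δ : ℝ) (hε : 0 < ε) (hε1 : ε ≤ 1 / 2) (hν : 0 < ν) (hν1 : ν ≤ 1) (hδ : 0 < δ)
    (hδ1 : δ ≤ 1) : ∃ (δ' μ : ℝ) (K : ℕ), 0 < δ' ∧ δ' < δ ∧ 0 < μ ∧
    ∀ (ι : Type) [DecidableEq ι] (D : Dims ι) (S : Finset ι) (h : ℝ), h ≤ 1 → Pk D 1 h S →
      (∀ i ∈ S, D.h i ≤ μ) → (∀ i ∈ S, D.w i ≤ δ' ∨ δ < D.w i) →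
      Ct D ε NoM K 1 (h + ν) S := by
  set m : ℕ := ⌈16 / (δ * ν)⌉₊ with hm
  set n0 : ℕ := ⌈1 / δ⌉₊ with hn0
  set Q : ℕ := (n0 + 1) ^ m with hQ
  set R : ℝ := 64 * (m + m * (Q * n0) + 3 * Q + 1) with hR
  have hRpos : 64 ≤ R := by
    have : (0:ℝ) ≤ m + m * (Q * n0) + 3 * Q := by positivity
    rw [hR]; linarith
  set μ : ℝ := ε * ν / R with hμdef
  have hμ0 : 0 < μ := by rw [hμdef]; positivity
  have hμR : μ * R = ε * ν := by rw [hμdef]; field_simp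
  have hεν : ε * ν ≤ ν / 2 := by nlinarith
  set δ' : ℝ := min (δ / 2) (ε * ν / 64) with hδ'
  have hδ'0 : 0 < δ' := by rw [hδ']; positivity
  have hδ'1 : δ' ≤ ε * ν / 64 := min_le_right _ _
  have hδ'2 : δ' ≤ δ / 2 := min_le_left _ _
  have b1 : μ * (m + m * (Q * n0)) ≤ ν / 64 := by
    have : μ * (m + m * (Q * n0)) * 64 ≤ μ * R := by
      rw [hR]
      have : (0:ℝ) ≤ 3 * Q + 1 := by positivity
      nlinarith
    nlinarith
  have b2 : 3 * Q * μ ≤ ε * ν / 64 := by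
    have : 3 * Q * μ * 64 ≤ μ * R := by
      rw [hR]
      have : (0:ℝ) ≤ m + m * (Q * n0) + 1 := by positivity
      nlinarith
    nlinarith
  have b3 : μ ≤ ε * ν / 64 := by
    have : μ * 64 ≤ μ * R := by gcongr
    linarith
  have hmδ : 16 ≤ m * (δ * ν) := by
    have : 16 / (δ * ν) ≤ m := Nat.le_ceil _
    rwa [div_le_iff₀ (by positivity)] at this
  have hn0δ : 1 ≤ n0 * δ := by
    have : 1 / δ ≤ n0 := Nat.le_ceil _
    rwa [div_le_iff₀ (by positivity)] at this
  have hεν2 : ε * ν ≤ ε := mul_le_of_le_one_right hε.le hν1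
  have hfin : ν / 16 ≤ (ν / 2 - μ) * (1 - δ') := by
    have t1 : μ ≤ ν / 64 := by linarith
    have t2 : δ' ≤ 1 / 2 := by linarith
    have t3 : 0 ≤ (ν / 2 - μ - ν / 4) * (1 - δ') := mul_nonneg (by linarith) (by linarith)
    have t4 : 0 ≤ ν / 4 * (1 / 2 - δ') := mul_nonneg (by linarith) (by linarith)
    linarith
  refine ⟨δ', μ, Q * (m * n0 + 1) + 2, hδ'0, by linarith, hμ0, ?_⟩
  intro ι _ D S h hh1 hp hμ hgap
  have hh0 := hp.nonneg.2
  set Wd := S.filter (fun i => δ < D.w i) with hWd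
  set Nr := S.filter (fun i => ¬ δ < D.w i) with hNr
  have harea := hp.area_le
  have hsplit : ∑ i ∈ Wd, D.w i * D.h i + ∑ i ∈ Nr, D.w i * D.h i = ∑ i ∈ S, D.w i * D.h i :=
    Finset.sum_filter_add_sum_filter_not S _ _
  have hNr0 : 0 ≤ ∑ i ∈ Nr, D.w i * D.h i :=
    Finset.sum_nonneg (fun i _ => mul_nonneg (D.w0 i) (D.h0 i))
  have hWdm : ∀ i ∈ Wd, i ∈ S ∧ δ < D.w i := fun i hi => Finset.mem_filter.1 hi
  have hNrm : ∀ i ∈ Nr, i ∈ S ∧ D.w i ≤ δ' := by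
    intro i hi
    have := Finset.mem_filter.1 hi
    refine ⟨this.1, ?_⟩
    rcases hgap i this.1 with h | h
    · exact h
    · exact absurd h this.2
  have hWh : δ * ∑ i ∈ Wd, D.h i ≤ 1 := by
    have : δ * ∑ i ∈ Wd, D.h i ≤ ∑ i ∈ Wd, D.w i * D.h i := by
      rw [Finset.mul_sum]
      refine Finset.sum_le_sum (fun i hi => ?_)
      have := D.h0 i
      have := (hWdm i hi).2
      gcongr
    linarith
  obtain ⟨cls, u, g1, g2, g3, g4, g5, g6⟩ := grp_lemma D δ (ν / 8) μ (by positivity) hμ0.le m Wd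
    (fun i hi => hμ i (hWdm i hi).1) (fun i hi => (hWdm i hi).2.le) (by
      have e1 : ν / 16 ≤ ν / 8 - μ := by linarith
      have e2 : (m : ℝ) * (ν / 16) ≤ m * (ν / 8 - μ) := by gcongr
      have e3 : δ * (∑ i ∈ Wd, D.h i) ≤ δ * (m * (ν / 16)) := by linarith
      have := le_of_mul_le_mul_left e3 hδ
      linarith)
  have u1 : ∀ k : Fin m, 0 ≤ u k := fun k => hδ.le.trans (g1 k)
  obtain ⟨C, l, c1, c2, c3, c4, c5, c6⟩ := cfg_weights (D := D) (fun k : Fin m => u k) n0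
    (fun k => by
      have := g1 k
      calc (1:ℝ) ≤ n0 * δ := hn0δ
        _ ≤ n0 * u k := by gcongr)
    u1 (fun i => if i ∈ Wd then cls i else m) hp (by
      intro i hi k hk
      by_cases hiW : i ∈ Wd
      · simp only [hiW, if_true] at hk
        rw [← hk]; exact g3 i hiW
      · simp only [hiW, if_false] at hk
        have := k.2; omega)
  have c6' : ∀ k : Fin m, ∑ i ∈ Wd.filter (fun i => cls i = k), D.h i = ∑ c ∈ C, l c * c k := by
    intro k
    rw [← c6 k]
    congr 1
    ext i
    simp only [Finset.mem_filter]
    constructor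
    · rintro ⟨h1, h2⟩
      simp only [h1, if_true]
      exact ⟨(hWdm i h1).1, h2⟩
    · rintro ⟨h1, h2⟩
      by_cases hiW : i ∈ Wd
      · simp only [hiW, if_true] at h2
        exact ⟨hiW, h2⟩
      · simp only [hiW, if_false] at h2
        have := k.2; omega
  have hlle : ∀ c ∈ C, l c ≤ h := by
    intro c hc
    rw [← c5]; exact Finset.single_le_sum (f := l) c2 hc
  -- slots
  let J : Fin m → Finset ((Fin m → ℕ) × ℕ) := fun k =>
    (C ×ˢ Finset.range n0).filter (fun q => q.2 < q.1 k)
  have hJm : ∀ k, ∀ q ∈ J k, q.1 ∈ C ∧ q.2 < q.1 k := by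
    intro k q hq
    have := Finset.mem_filter.1 hq
    exact ⟨(Finset.mem_product.1 this.1).1, this.2⟩
  have hJcard : ∀ k, ((J k).card : ℝ) ≤ Q * n0 := by
    intro k
    have h1 : (J k).card ≤ Q * n0 := by
      refine (Finset.card_filter_le _ _).trans ?_
      rw [Finset.card_product, Finset.card_range]
      gcongr
    exact_mod_cast h1
  have hcnt : ∀ a : ℕ, a ≤ n0 → ((Finset.range n0).filter (fun t => t < a)).card = a := by
    intro a ha
    have : (Finset.range n0).filter (fun t => t < a) = Finset.range a := by
      ext t; simp only [Finset.mem_filter, Finset.mem_range]; omega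
    rw [this, Finset.card_range]
  have hJsum : ∀ k, ∑ q ∈ J k, l q.1 = ∑ c ∈ C, l c * c k := by
    intro k
    simp only [J]
    rw [Finset.sum_filter, Finset.sum_product]
    refine Finset.sum_congr rfl (fun c hc => ?_)
    simp only
    rw [← Finset.sum_filter, Finset.sum_const, hcnt _ (c3 c hc k), nsmul_eq_mul, mul_comm]
  have hfill : ∀ k : Fin m, ∃ A : (Fin m → ℕ) × ℕ → Finset ι,
      (∀ q, A q ⊆ Wd.filter (fun i => cls i = k + 1)) ∧
      (∀ q ∈ J k, ∑ i ∈ A q, D.h i ≤ l q.1) ∧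
      ∑ i ∈ Wd.filter (fun i => cls i = k + 1) \ (J k).biUnion A, D.h i ≤ μ * (1 + Q * n0) := by
    intro k
    obtain ⟨A, a1, a2, a3⟩ := fill_lemma D.h D.h0 μ (fun q : (Fin m → ℕ) × ℕ => l q.1) (J k)
      (fun q hq => c2 _ (hJm k q hq).1) (Wd.filter (fun i => cls i = k + 1))
      (fun i hi => hμ i (hWdm i (Finset.mem_filter.1 hi).1).1)
    refine ⟨A, a1, a2, a3.trans ?_⟩
    refine max_le (by positivity) ?_
    rw [Finset.sum_sub_distrib, hJsum, Finset.sum_const, nsmul_eq_mul]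
    have hJc := hJcard k
    have e1 : ((J k).card : ℝ) * μ ≤ Q * n0 * μ := by gcongr
    have e2 : 0 ≤ ∑ c ∈ C, l c * c k :=
      Finset.sum_nonneg (fun c hc => mul_nonneg (c2 c hc) (Nat.cast_nonneg _))
    by_cases hne : ∃ i ∈ Wd, cls i = k + 1
    · have e3 := g6 k hne
      have e4 := g5 (k + 1)
      rw [c6' k] at e3
      linarith
    · have : Wd.filter (fun i => cls i = k + 1) = ∅ := by
        rw [Finset.filter_eq_empty_iff]
        intro i hi hik
        exact hne ⟨i, hi, hik⟩
      rw [this, Finset.sum_empty]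
      linarith
  choose A a1 a2 a3 using hfill
  -- columns of one configuration
  have hcols : ∀ c ∈ C, Ct D ε NoM (m * n0) (∑ k, (c k : ℝ) * u k) (l c)
      (((Finset.univ ×ˢ Finset.range n0).filter (fun q : Fin m × ℕ => q.2 < c q.1)).biUnion
        (fun q => A q.1 (c, q.2))) := by
    intro c hc
    have := Ct.vsum (D := D) (ε := ε) (M := NoM)
      ((Finset.univ ×ˢ Finset.range n0).filter (fun q : Fin m × ℕ => q.2 < c q.1))
      (c2 c hc) (fun _ => 1) (fun q => u q.1) (fun q => A q.1 (c, q.2)) (by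
        intro q hq
        have hq2 := (Finset.mem_filter.1 hq)
        have hqJ : (c, q.2) ∈ J q.1 := by
          simp only [J, Finset.mem_filter, Finset.mem_product]
          exact ⟨⟨hc, (Finset.mem_product.1 hq2.1).2⟩, hq2.2⟩
        refine Ct.hstack le_rfl (u1 q.1) (c2 c hc) ?_ (a2 q.1 _ hqJ) (fun _ _ h => h)
        intro i hi
        have := Finset.mem_filter.1 (a1 q.1 _ hi)
        exact g4 i this.1 _ this.2)
    refine this.mono hε.le ?_ (le_of_eq ?_) le_rfl
    · rw [Finset.sum_const, smul_eq_mul, mul_one]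
      refine (Finset.card_filter_le _ _).trans ?_
      simp
    · rw [Finset.sum_filter, Finset.sum_product]
      refine Finset.sum_congr rfl (fun k _ => ?_)
      simp only
      rw [← Finset.sum_filter, Finset.sum_const, hcnt _ (c3 c hc k), nsmul_eq_mul]
  -- narrow items
  let fr : (Fin m → ℕ) → ℝ := fun c => 1 - ∑ k, (c k : ℝ) * u k
  have hfr0 : ∀ c ∈ C, 0 ≤ fr c := fun c hc => by simp only [fr]; linarith [c4 c hc]
  have hfr1 : ∀ c, fr c ≤ 1 := fun c => by
    simp only [fr]
    have : 0 ≤ ∑ k : Fin m, (c k : ℝ) * u k :=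
      Finset.sum_nonneg (fun k _ => mul_nonneg (Nat.cast_nonneg _) (u1 k))
    linarith
  set Us := C.filter (fun c => δ' ≤ ε * fr c ∧ μ ≤ ε * l c) with hUs
  have hUsm : ∀ c ∈ Us, c ∈ C ∧ δ' ≤ ε * fr c ∧ μ ≤ ε * l c := fun c hc => Finset.mem_filter.1 hc
  have hcap : ∀ c ∈ Us, 0 ≤ l c - μ ∧ 0 ≤ fr c - δ' ∧ μ < l c := by
    intro c hc
    obtain ⟨h1, h2, h3⟩ := hUsm c hc
    have t1 := lt_of_half hε1 (c2 c h1) hμ0 h3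
    have t2 := lt_of_half hε1 (hfr0 c h1) hδ'0 h2
    exact ⟨by linarith, by linarith, t1⟩
  obtain ⟨B, B1, B2, B3⟩ := fill_lemma (fun i => D.w i * D.h i)
    (fun i => mul_nonneg (D.w0 i) (D.h0 i)) (δ' * μ) (fun c => (l c - μ) * (fr c - δ')) Us
    (fun c hc => mul_nonneg (hcap c hc).1 (hcap c hc).2.1) Nr
    (fun i hi => mul_le_mul (hNrm i hi).2 (hμ i (hNrm i hi).1) (D.h0 i) hδ'0.le)
  have hleft : ∑ i ∈ Nr \ Us.biUnion B, D.w i * D.h i ≤ ν / 16 := by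
    refine B3.trans (max_le (by positivity) ?_)
    -- each configuration
    have key : ∀ c ∈ C, l c * fr c - (l c * (2 * δ' / ε) + 3 * μ / ε) ≤
        if δ' ≤ ε * fr c ∧ μ ≤ ε * l c then (l c - μ) * (fr c - δ') - δ' * μ else 0 := by
      intro c hc
      have hl0 := c2 c hc
      have hl1 := (hlle c hc).trans hh1
      have hf0 := hfr0 c hc
      have hf1 := hfr1 c
      have q1 : δ' ≤ δ' / ε := by rw [le_div_iff₀ hε]; nlinarith
      have q2 : μ ≤ μ / ε := by rw [le_div_iff₀ hε]; nlinarith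
      have q3 : 2 * δ' / ε = 2 * (δ' / ε) := by ring
      have q4 : 3 * μ / ε = 3 * (μ / ε) := by ring
      rw [q3, q4]
      have q5 : 0 ≤ l c * (δ' / ε) := by positivity
      have q6 : 0 ≤ μ / ε := by positivity
      split_ifs with hif
      · have t1 : l c * δ' ≤ l c * (δ' / ε) := by gcongr
        have t2 : μ * fr c ≤ μ * 1 := by gcongr
        linarith
      · rw [not_and_or, not_le, not_le] at hif
        rcases hif with hif | hif
        · have : fr c ≤ δ' / ε := by rw [le_div_iff₀ hε]; linarith
          have : l c * fr c ≤ l c * (δ' / ε) := by gcongr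
          linarith
        · have t1 : l c ≤ μ / ε := by rw [le_div_iff₀ hε]; linarith
          have : l c * fr c ≤ l c * 1 := by gcongr
          linarith
    have key2 := Finset.sum_le_sum key
    rw [← Finset.sum_filter, Finset.sum_sub_distrib, Finset.sum_add_distrib, ← Finset.sum_mul,
      c5, Finset.sum_const, nsmul_eq_mul] at key2
    have hCQ : (C.card : ℝ) ≤ Q := by exact_mod_cast c1
    have e1 : (C.card : ℝ) * (3 * μ / ε) ≤ Q * (3 * μ / ε) := by
      have : 0 ≤ 3 * μ / ε := by positivity
      gcongr
    have e2 : (Q : ℝ) * (3 * μ / ε) ≤ ν / 64 := by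
      have : (Q : ℝ) * (3 * μ / ε) = (3 * Q * μ) / ε := by ring
      rw [this, div_le_iff₀ hε]; linarith
    have e3 : h * (2 * δ' / ε) ≤ ν / 32 := by
      have : 2 * δ' / ε ≤ ν / 32 := by rw [div_le_iff₀ hε]; linarith
      have h3 : 0 ≤ 2 * δ' / ε := by positivity
      calc h * (2 * δ' / ε) ≤ 1 * (2 * δ' / ε) := by gcongr
        _ ≤ ν / 32 := by linarith
    have e4 : ∑ c ∈ C, l c * fr c = h - ∑ k : Fin m, u k * ∑ c ∈ C, l c * c k := by
      simp only [fr]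
      simp_rw [mul_sub, mul_one]
      rw [Finset.sum_sub_distrib, c5]
      congr 1
      simp_rw [Finset.mul_sum]
      rw [Finset.sum_comm]
      refine Finset.sum_congr rfl (fun k _ => Finset.sum_congr rfl (fun c _ => by ring))
    have e5 : ∑ k : Fin m, u k * ∑ c ∈ C, l c * c k ≤ ∑ i ∈ Wd, D.w i * D.h i := by
      have : ∀ k : Fin m, u k * ∑ c ∈ C, l c * c k ≤
          ∑ i ∈ Wd.filter (fun i => cls i = k), D.w i * D.h i := by
        intro k
        rw [← c6' k, Finset.mul_sum]
        refine Finset.sum_le_sum (fun i hi => ?_)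
        have hi' := Finset.mem_filter.1 hi
        have := g3 i hi'.1
        rw [hi'.2] at this
        have := D.h0 i
        gcongr
      refine (Finset.sum_le_sum (fun k _ => this k)).trans ?_
      rw [← Finset.sum_biUnion]
      · refine sum_mono_set (fun i => mul_nonneg (D.w0 i) (D.h0 i)) ?_
        intro i hi
        obtain ⟨k, _, hk⟩ := Finset.mem_biUnion.1 hi
        exact (Finset.mem_filter.1 hk).1
      · intro k _ k' _ hkk
        rw [Function.onFun, Finset.disjoint_left]
        intro i hi hi'
        apply hkk
        ext
        rw [← (Finset.mem_filter.1 hi).2, ← (Finset.mem_filter.1 hi').2]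
    linarith
  -- regions
  have hreg : ∀ c ∈ C, Ct D ε NoM (m * n0 + 1) 1 (l c)
      ((((Finset.univ ×ˢ Finset.range n0).filter (fun q : Fin m × ℕ => q.2 < c q.1)).biUnion
        (fun q => A q.1 (c, q.2))) ∪ (if c ∈ Us then B c else ∅)) := by
    intro c hc
    have hr : Ct D ε NoM 1 (fr c) (l c) (if c ∈ Us then B c else ∅) := by
      split_ifs with hcU
      · obtain ⟨h1, h2, h3⟩ := hUsm c hcU
        refine Ct.area le_rfl ?_ ?_ (fun _ _ h => h)
        · intro i hi
          have := hNrm i (B1 c hi)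
          exact ⟨this.2.trans h2, (hμ i this.1).trans h3⟩
        · exact nf_pack D μ (l c) hμ0.le (hcap c hcU).2.2 (B c) δ' (fr c) hδ'0.le
            (by linarith [(hcap c hcU).2.1]) (fun i hi => hμ i (hNrm i (B1 c hi)).1)
            (fun i hi => (hNrm i (B1 c hi)).2) (B2 c hcU)
      · exact Ct.empty (hfr0 c hc) (c2 c hc) rfl
    exact Ct.vcut (hcols c hc) hr (by simp only [fr]; linarith) subset_rfl le_rfl
  have hall := Ct.hsum C (by norm_num : (0:ℝ) ≤ 1) (fun _ => m * n0 + 1) l _ hreg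
  rw [c5, Finset.sum_const, smul_eq_mul] at hall
  -- class zero and overflow
  set Z := Wd.filter (fun i => cls i = 0) ∪ Finset.univ.biUnion
    (fun k : Fin m => Wd.filter (fun i => cls i = k + 1) \ (J k).biUnion (A k)) with hZ
  have hZsub : Z ⊆ Wd := by
    intro i hi
    rcases Finset.mem_union.1 hi with h | h
    · exact (Finset.mem_filter.1 h).1
    · obtain ⟨k, _, hk⟩ := Finset.mem_biUnion.1 h
      exact (Finset.mem_filter.1 (Finset.mem_sdiff.1 hk).1).1
  have hZh : ∑ i ∈ Z, D.h i ≤ ν / 2 := by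
    have e1 := sum_cover_le (f := D.h) D.h0 (subset_rfl : Z ⊆ _)
    have e2 := g5 0
    have e3 : ∑ i ∈ Finset.univ.biUnion (fun k : Fin m => Wd.filter (fun i => cls i = k + 1) \
        (J k).biUnion (A k)), D.h i ≤ ∑ k : Fin m, μ * (1 + Q * n0) := by
      rw [Finset.sum_biUnion]
      · exact Finset.sum_le_sum (fun k _ => a3 k)
      · intro k _ k' _ hkk
        rw [Function.onFun, Finset.disjoint_left]
        intro i hi hi'
        apply hkk
        have h1 := (Finset.mem_filter.1 (Finset.mem_sdiff.1 hi).1).2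
        have h2 := (Finset.mem_filter.1 (Finset.mem_sdiff.1 hi').1).2
        ext; omega
    rw [Finset.sum_const, Finset.card_univ, Fintype.card_fin, nsmul_eq_mul] at e3
    have e4 : (m : ℝ) * (μ * (1 + Q * n0)) = μ * (m + m * (Q * n0)) := by ring
    linarith
  have hZct : Ct D ε NoM 1 1 (ν / 2) Z :=
    Ct.hstack le_rfl (by norm_num) (by positivity)
      (fun i hi => (hp.dim_le i (hWdm i (hZsub hi)).1).1) hZh (fun _ _ h => h)
  have hLct : Ct D ε NoM 1 1 (ν / 2) (Nr \ Us.biUnion B) := by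
    refine Ct.area le_rfl ?_ ?_ (fun _ _ h => h)
    · intro i hi
      have := hNrm i (Finset.mem_sdiff.1 hi).1
      refine ⟨this.2.trans (by linarith), (hμ i this.1).trans (by linarith)⟩
    · refine nf_pack D μ (ν / 2) hμ0.le (by linarith) _ δ' 1 hδ'0.le (by linarith)
        (fun i hi => hμ i (hNrm i (Finset.mem_sdiff.1 hi).1).1)
        (fun i hi => (hNrm i (Finset.mem_sdiff.1 hi).1).2) (hleft.trans hfin)
  refine Ct.hcut (h1 := h) (h2 := ν) hall (Ct.hcut (k := 2) hZct hLct (by linarith) subset_rfl le_rfl)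
    le_rfl ?_ (by gcongr)
  intro i hi
  by_cases hiW : i ∈ Wd
  · have hcl := g2 i hiW
    rcases Nat.eq_zero_or_pos (cls i) with h0 | h0
    · exact Finset.mem_union_right _ (Finset.mem_union_left _ (Finset.mem_union_left _
        (Finset.mem_filter.2 ⟨hiW, h0⟩)))
    · obtain ⟨k, hk⟩ : ∃ k, cls i = k + 1 := ⟨cls i - 1, by omega⟩
      have hkm : k < m := by omega
      by_cases hin : i ∈ (J ⟨k, hkm⟩).biUnion (A ⟨k, hkm⟩)
      · obtain ⟨q, hq, hiq⟩ := Finset.mem_biUnion.1 hin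
        refine Finset.mem_union_left _ (Finset.mem_biUnion.2 ⟨q.1, (hJm _ q hq).1, ?_⟩)
        refine Finset.mem_union_left _ (Finset.mem_biUnion.2 ⟨(⟨k, hkm⟩, q.2), ?_, hiq⟩)
        have := Finset.mem_filter.1 hq
        refine Finset.mem_filter.2 ⟨Finset.mem_product.2 ⟨Finset.mem_univ _,
          (Finset.mem_product.1 this.1).2⟩, this.2⟩
      · refine Finset.mem_union_right _ (Finset.mem_union_left _ (Finset.mem_union_right _
          (Finset.mem_biUnion.2 ⟨⟨k, hkm⟩, Finset.mem_univ _, Finset.mem_sdiff.2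
            ⟨Finset.mem_filter.2 ⟨hiW, hk⟩, hin⟩⟩)))
  · have hiN : i ∈ Nr := by
      rw [hNr, Finset.mem_filter]
      refine ⟨hi, fun h => hiW (Finset.mem_filter.2 ⟨hi, h⟩)⟩
    by_cases hin : i ∈ Us.biUnion B
    · obtain ⟨c, hc, hic⟩ := Finset.mem_biUnion.1 hin
      refine Finset.mem_union_left _ (Finset.mem_biUnion.2 ⟨c, (hUsm c hc).1, ?_⟩)
      refine Finset.mem_union_right _ ?_
      simp only [hc, if_true]; exact hic
    · exact Finset.mem_union_right _ (Finset.mem_union_right _ (Finset.mem_sdiff.2 ⟨hiN, hin⟩))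

theorem exists_pos_lb (f : ℕ → ℝ) (hf : ∀ k, 0 < f k) (n : ℕ) :
    ∃ m : ℝ, 0 < m ∧ ∀ k < n, m ≤ f k := by
  induction n with
  | zero => exact ⟨1, one_pos, by simp⟩
  | succ n ih =>
    obtain ⟨m, hm, h⟩ := ih
    refine ⟨min m (f n), lt_min hm (hf n), fun k hk => ?_⟩
    rcases Nat.lt_succ_iff_lt_or_eq.1 hk with h1 | h1
    · exact (min_le_left _ _).trans (h k h1)
    · subst h1; exact min_le_right _ _

theorem le_sum_range (K : ℕ → ℕ) (n k : ℕ) (hk : k < n) : K k ≤ ∑ j ∈ Finset.range n, K j :=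
  Finset.single_le_sum (f := K) (fun _ _ => Nat.zero_le _) (Finset.mem_range.2 hk)

section
variable {ι : Type} [DecidableEq ι]

/-- pigeonhole over the bands `(δ (j+1), δ j]`, two functions at once -/
theorem band2 (ε : ℝ) (hε : 0 < ε) (p : ι → ℝ) (hp : ∀ i, 0 ≤ p i) (S : Finset ι) (f : ι → ℝ)
    (δ : ℕ → ℝ) (hδ : ∀ k, δ (k + 1) ≤ δ k) :
    ∃ j < ⌈1 / ε⌉₊, ∑ i ∈ S \ S.filter (fun i => f i ≤ δ (j + 1) ∨ δ j < f i), p i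
      ≤ ε * ∑ i ∈ S, p i := by
  have han : Antitone δ := antitone_nat_of_succ_le hδ
  have hn : 0 < ⌈1 / ε⌉₊ := Nat.ceil_pos.2 (by positivity)
  obtain ⟨j, hj, h⟩ := pigeon1 p hp S ⌈1 / ε⌉₊ hn
    (fun j => S \ S.filter (fun i => f i ≤ δ (j + 1) ∨ δ j < f i)) (by
      intro i hi j hj j' hj' hjj h1 h2
      simp only [Finset.mem_sdiff, Finset.mem_filter, hi, true_and, not_or, not_le, not_lt] at h1 h2
      have := han (Nat.succ_le_of_lt hjj)
      simp only [Nat.succ_eq_add_one] at this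
      linarith)
  refine ⟨j, hj, ?_⟩
  rw [Finset.inter_eq_right.2 Finset.sdiff_subset] at h
  have h1 : 1 / ε ≤ (⌈1 / ε⌉₊ : ℝ) := Nat.le_ceil _
  have h2 : 0 ≤ ∑ i ∈ S \ S.filter (fun i => f i ≤ δ (j + 1) ∨ δ j < f i), p i :=
    Finset.sum_nonneg (fun i _ => hp i)
  have h3 := (mul_le_mul_of_nonneg_right h1 h2).trans h
  rw [div_mul_eq_mul_div, one_mul, div_le_iff₀ hε] at h3
  linarith

end

theorem Pk.empty_of_w {ι : Type} [DecidableEq ι] {D : Dims ι} {w h : ℝ} {S : Finset ι}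
    (hp : Pk D w h S) (hw : w ≤ 0) : S = ∅ := by
  rw [Finset.eq_empty_iff_forall_notMem]
  intro i hi
  have := (hp.dim_le i hi).1
  linarith [D.wpos i]

theorem Pk.empty_of_h {ι : Type} [DecidableEq ι] {D : Dims ι} {w h : ℝ} {S : Finset ι}
    (hp : Pk D w h S) (hw : h ≤ 0) : S = ∅ := by
  rw [Finset.eq_empty_iff_forall_notMem]
  intro i hi
  have := (hp.dim_le i hi).2
  linarith [D.hpos i]

/-- Full Kenyon–Rémila type lemma, arbitrary width. -/
theorem KR (ε ν : ℝ) (hε : 0 < ε) (hε1 : ε ≤ 1 / 2) (hν : 0 < ν) (hν1 : ν ≤ 1) :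
    ∃ (μ : ℝ) (K : ℕ), 0 < μ ∧
    ∀ (ι : Type) [DecidableEq ι] (D : Dims ι) (p : ι → ℝ) (S : Finset ι) (W h : ℝ),
      (∀ i, 0 ≤ p i) → h ≤ 1 → Pk D W h S → (∀ i ∈ S, D.h i ≤ μ) →
      ∃ S' ⊆ S, ∑ i ∈ S \ S', p i ≤ ε * ∑ i ∈ S, p i ∧ Ct D ε NoM K W (h + ν) S' := by
  have H := fun δ : {x : ℝ // 0 < x ∧ x ≤ 1} => KR0 ε ν δ.1 hε hε1 hν hν1 δ.2.1 δ.2.2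
  choose d m K hd1 hd2 hm HK using H
  let ds : ℕ → {x : ℝ // 0 < x ∧ x ≤ 1} := fun k => Nat.rec ⟨1, one_pos, le_rfl⟩
    (fun _ x => ⟨d x, hd1 x, (hd2 x).le.trans x.2.2⟩) k
  have hds : ∀ k, (ds (k + 1)).1 = d (ds k) := fun k => rfl
  obtain ⟨μ, hμ, hμ'⟩ := exists_pos_lb (fun k => m (ds k)) (fun k => hm _) ⌈1 / ε⌉₊
  refine ⟨μ, ∑ k ∈ Finset.range ⌈1 / ε⌉₊, K (ds k), hμ, ?_⟩
  intro ι _ D p S W h hp hh hP hS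
  rcases hP.nonneg.1.eq_or_lt with hW | hW
  · have := hP.empty_of_w hW.ge
    subst this
    exact ⟨∅, subset_rfl, by simp, Ct.empty hP.nonneg.1 (by linarith [hP.nonneg.2]) rfl⟩
  have hP1 := hP.scale (inv_pos.2 hW) one_pos
  rw [inv_mul_cancel₀ hW.ne', one_mul] at hP1
  obtain ⟨j, hj, hb⟩ := band2 ε hε p hp S (D.sc W⁻¹ 1 (inv_pos.2 hW) one_pos).w
    (fun k => (ds k).1) (fun k => by rw [hds]; exact (hd2 _).le)
  refine ⟨_, Finset.filter_subset _ _, hb, ?_⟩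
  have h1 := HK (ds j) ι (D.sc W⁻¹ 1 (inv_pos.2 hW) one_pos) _ h hh
    (hP1.subset (Finset.filter_subset (fun i => (D.sc W⁻¹ 1 (inv_pos.2 hW) one_pos).w i
      ≤ (ds (j + 1)).1 ∨ (ds j).1 < (D.sc W⁻¹ 1 (inv_pos.2 hW) one_pos).w i) S))
    (by
      intro i hi
      have := hS i (Finset.mem_filter.1 hi).1
      have h2 := hμ' j hj
      simp only [Dims.sc, one_mul]
      linarith)
    (by
      intro i hi
      have := (Finset.mem_filter.1 hi).2
      rwa [hds] at this)
  have h2 := h1.unscale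
  refine h2.mono hε.le (le_sum_range (fun k => K (ds k)) _ j hj) ?_ ?_
  · simp
  · simp

/-- Solvable up to a small loss. -/
def Sol {ι : Type} [DecidableEq ι] (D : Dims ι) (ε e : ℝ) (M : ι → Prop) (p : ι → ℝ) (k : ℕ)
    (w h : ℝ) (S : Finset ι) : Prop :=
  ∃ S' ⊆ S, ∑ i ∈ S \ S', p i ≤ e * ∑ i ∈ S, p i ∧ (∀ i ∈ S, M i → i ∈ S') ∧ Ct D ε M k w h S'

section
variable {ι : Type} [DecidableEq ι] {D : Dims ι} {ε e : ℝ} {M : ι → Prop} {p : ι → ℝ}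

theorem Sol.mono (hε : 0 ≤ ε) {k k' : ℕ} {w h w' h' : ℝ} {S : Finset ι}
    (hp : Sol D ε e M p k w h S) (hk : k ≤ k') (hw : w ≤ w') (hh : h ≤ h') :
    Sol D ε e M p k' w' h' S := by
  obtain ⟨S', h1, h2, h3, h4⟩ := hp
  exact ⟨S', h1, h2, h3, h4.mono hε hk hw hh⟩

theorem Sol.of_ct (hp : ∀ i, 0 ≤ p i) (he : 0 ≤ e) {k : ℕ} {w h : ℝ} {S : Finset ι}
    (hc : Ct D ε M k w h S) : Sol D ε e M p k w h S :=
  ⟨S, subset_rfl, by simp; exact mul_nonneg he (Finset.sum_nonneg (fun i _ => hp i)),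
    fun i hi _ => hi, hc⟩

theorem sol_aux {S S1 S2 S1' S2' : Finset ι} (hp : ∀ i, 0 ≤ p i) (hd : Disjoint S1 S2)
    (hS : S = S1 ∪ S2)
    (l1 : ∑ i ∈ S1 \ S1', p i ≤ e * ∑ i ∈ S1, p i) (l2 : ∑ i ∈ S2 \ S2', p i ≤ e * ∑ i ∈ S2, p i) :
    ∑ i ∈ S \ (S1' ∪ S2'), p i ≤ e * ∑ i ∈ S, p i := by
  subst hS
  have h1 : (S1 ∪ S2) \ (S1' ∪ S2') ⊆ (S1 \ S1') ∪ (S2 \ S2') := by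
    intro i; simp only [Finset.mem_sdiff, Finset.mem_union]; tauto
  have h2 := sum_cover_le hp h1
  rw [Finset.sum_union hd]
  linarith

theorem Sol.vcut (hp : ∀ i, 0 ≤ p i) {k1 k2 : ℕ} {w h w1 w2 : ℝ} {S S1 S2 : Finset ι}
    (h1 : Sol D ε e M p k1 w1 h S1) (h2 : Sol D ε e M p k2 w2 h S2) (hw : w1 + w2 ≤ w)
    (hd : Disjoint S1 S2) (hS : S = S1 ∪ S2) : Sol D ε e M p (k1 + k2) w h S := by
  obtain ⟨S1', a1, b1, c1, d1⟩ := h1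
  obtain ⟨S2', a2, b2, c2, d2⟩ := h2
  refine ⟨S1' ∪ S2', hS ▸ Finset.union_subset_union a1 a2, sol_aux hp hd hS b1 b2, ?_,
    Ct.vcut d1 d2 hw subset_rfl le_rfl⟩
  intro i hi hM
  subst hS
  rcases Finset.mem_union.1 hi with h | h
  · exact Finset.mem_union_left _ (c1 i h hM)
  · exact Finset.mem_union_right _ (c2 i h hM)

theorem Sol.hcut (hp : ∀ i, 0 ≤ p i) {k1 k2 : ℕ} {w h w1 w2 : ℝ} {S S1 S2 : Finset ι}
    (h1 : Sol D ε e M p k1 w w1 S1) (h2 : Sol D ε e M p k2 w w2 S2) (hw : w1 + w2 ≤ h)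
    (hd : Disjoint S1 S2) (hS : S = S1 ∪ S2) : Sol D ε e M p (k1 + k2) w h S := by
  obtain ⟨S1', a1, b1, c1, d1⟩ := h1
  obtain ⟨S2', a2, b2, c2, d2⟩ := h2
  refine ⟨S1' ∪ S2', hS ▸ Finset.union_subset_union a1 a2, sol_aux hp hd hS b1 b2, ?_,
    Ct.hcut d1 d2 hw subset_rfl le_rfl⟩
  intro i hi hM
  subst hS
  rcases Finset.mem_union.1 hi with h | h
  · exact Finset.mem_union_left _ (c1 i h hM)
  · exact Finset.mem_union_right _ (c2 i h hM)

theorem Sol.vsum (hp : ∀ i, 0 ≤ p i) {κ : Type} [DecidableEq κ] (J : Finset κ) {h : ℝ} (hh : 0 ≤ h) (k : ℕ)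
    (w : κ → ℝ) (S : κ → Finset ι) (hJ : ∀ j ∈ J, Sol D ε e M p k (w j) h (S j))
    (hd : ∀ a b, a ≠ b → Disjoint (S a) (S b)) :
    Sol D ε e M p (J.card * k) (∑ j ∈ J, w j) h (J.biUnion S) := by
  induction J using Finset.induction_on with
  | empty => 
    exact ⟨∅, by simp, by simp, by simp, Ct.empty (by simp) hh rfl⟩
  | insert a J ha ih =>
    rw [Finset.sum_insert ha, Finset.card_insert_of_notMem ha, Finset.biUnion_insert, add_mul, one_mul,
      add_comm (J.card * k)]
    refine Sol.vcut hp (hJ a (Finset.mem_insert_self _ _))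
      (ih (fun j hj => hJ j (Finset.mem_insert_of_mem hj))) le_rfl ?_ rfl
    rw [Finset.disjoint_biUnion_right]
    intro b hb
    exact hd a b (by rintro rfl; exact ha hb)

/-- index set of column types -/
def JT (r n : ℕ) : Finset (ℕ × ℕ) := (Finset.range n ×ˢ Finset.range n).filter
  (fun t => t.2 = 0 ∨ (r ≤ t.1 ∧ r ≤ t.2 ∧ t.1 + t.2 ≤ n + 2))

def RunC (D : Dims ι) (γ μ : ℝ) (r n : ℕ) (w b : ℝ) (S : Finset ι) : Prop :=
  ∃ (c : ι → ℕ × (ℕ × ℕ)) (ws : ℝ) (wt : ℕ × ℕ → ℝ), 0 ≤ ws ∧ (∀ t, 0 ≤ wt t) ∧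
    ws + ∑ t ∈ JT r n, wt t ≤ w ∧
    Pk D w (γ - b + μ) (S.filter (fun i => c i = (0, (0, 0)))) ∧
    (∀ i ∈ S, c i = (0, (0, 0)) → D.h i ≤ μ) ∧
    (∀ i ∈ S, D.h i ≤ n * γ) ∧
    ∑ i ∈ S.filter (fun i => c i = (1, (0, 0))), D.w i ≤ ws ∧
    (∀ t ∈ JT r n, Pk D (wt t) (t.1 * γ) (S.filter (fun i => c i = (2, t))) ∧
      Pk D (wt t) (t.2 * γ) (S.filter (fun i => c i = (3, t)))) ∧
    ∀ i ∈ S, c i = (0, (0, 0)) ∨ c i = (1, (0, 0)) ∨ ∃ t ∈ JT r n, c i = (2, t) ∨ c i = (3, t)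

end

section
variable {ι : Type} [DecidableEq ι] {D : Dims ι}

theorem filter_comb {κ : Type} [DecidableEq κ] {S S1 S2 : Finset ι} (hS : S ⊆ S1 ∪ S2)
    (c1 c2 : ι → κ) (t : κ) :
    S.filter (fun i => (if i ∈ S1 then c1 i else c2 i) = t) ⊆
      S1.filter (fun i => c1 i = t) ∪ S2.filter (fun i => c2 i = t) := by
  intro i hi
  rw [Finset.mem_filter] at hi
  have h := Finset.mem_union.1 (hS hi.1)
  by_cases h1 : i ∈ S1
  · rw [if_pos h1] at hi
    exact Finset.mem_union_left _ (Finset.mem_filter.2 ⟨h1, hi.2⟩)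
  · rw [if_neg h1] at hi
    exact Finset.mem_union_right _ (Finset.mem_filter.2 ⟨h.resolve_left h1, hi.2⟩)

theorem RunC.v {γ μ : ℝ} {r n : ℕ} {w w1 w2 b : ℝ} {S S1 S2 : Finset ι}
    (h1 : RunC D γ μ r n w1 b S1) (h2 : RunC D γ μ r n w2 b S2) (hw : w1 + w2 ≤ w)
    (hS : S ⊆ S1 ∪ S2) : RunC D γ μ r n w b S := by
  obtain ⟨c1, ws1, wt1, a1, b1, d1, e1, f1, g1, i1, j1, k1⟩ := h1
  obtain ⟨c2, ws2, wt2, a2, b2, d2, e2, f2, g2, i2, j2, k2⟩ := h2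
  have key : ∀ i ∈ S, i ∈ S1 ∨ (i ∉ S1 ∧ i ∈ S2) := by
    intro i hi
    have := Finset.mem_union.1 (hS hi)
    tauto
  refine ⟨fun i => if i ∈ S1 then c1 i else c2 i, ws1 + ws2, fun t => wt1 t + wt2 t, by linarith,
    fun t => by linarith [b1 t, b2 t], ?_, Pk.vcut e1 e2 hw (filter_comb hS c1 c2 _), ?_, ?_, ?_, ?_, ?_⟩
  · rw [Finset.sum_add_distrib]; linarith
  · intro i hi
    rcases key i hi with h | ⟨h, h'⟩
    · simp only [h, if_true]; exact f1 i h
    · simp only [h, if_false]; exact f2 i h'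
  · intro i hi
    rcases key i hi with h | ⟨h, h'⟩
    · exact g1 i h
    · exact g2 i h'
  · have := sum_cover_le D.w0 (filter_comb hS c1 c2 (1, (0, 0)))
    linarith
  · intro t ht
    exact ⟨Pk.vcut (j1 t ht).1 (j2 t ht).1 le_rfl (filter_comb hS c1 c2 _),
      Pk.vcut (j1 t ht).2 (j2 t ht).2 le_rfl (filter_comb hS c1 c2 _)⟩
  · intro i hi
    rcases key i hi with h | ⟨h, h'⟩
    · simp only [h, if_true]; exact k1 i h
    · simp only [h, if_false]; exact k2 i h'

theorem RunC.addO {γ μ : ℝ} {r n : ℕ} {w h1 b : ℝ} {S S1 S2 : Finset ι}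
    (p1 : Pk D w h1 S1) (hf : ∀ i ∈ S1, D.h i ≤ μ) (hn : ∀ i ∈ S, D.h i ≤ n * γ)
    (h2 : RunC D γ μ r n w (b + h1) S2)
    (hS : S ⊆ S1 ∪ S2) : RunC D γ μ r n w b S := by
  obtain ⟨c2, ws2, wt2, a2, b2, d2, e2, f2, g2, i2, j2, k2⟩ := h2
  have key : ∀ i ∈ S, i ∈ S1 ∨ (i ∉ S1 ∧ i ∈ S2) := by
    intro i hi
    have := Finset.mem_union.1 (hS hi)
    tauto
  have fc := fun t => filter_comb hS (fun _ => ((0 : ℕ), ((0 : ℕ), (0 : ℕ)))) c2 t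
  have fc' : ∀ t : ℕ × (ℕ × ℕ), t ≠ (0, (0, 0)) →
      S.filter (fun i => (if i ∈ S1 then (0, (0, 0)) else c2 i) = t) ⊆
      S2.filter (fun i => c2 i = t) := by
    intro t ht
    refine (fc t).trans ?_
    rw [Finset.filter_false_of_mem (s := S1) (fun i _ => ht.symm), Finset.empty_union]
  refine ⟨fun i => if i ∈ S1 then (0, (0, 0)) else c2 i, ws2, wt2, a2, b2, d2,
    Pk.hcut (p1.subset (Finset.filter_subset _ _)) e2 (by linarith) (fc _), ?_, hn, ?_, ?_, ?_⟩
  · intro i hi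
    rcases key i hi with h | ⟨h, h'⟩
    · intro _; exact hf i h
    · simp only [h, if_false]; exact f2 i h'
  · exact (sum_mono_set D.w0 (fc' (1, (0, 0)) (by simp))).trans i2
  · intro t ht
    exact ⟨(j2 t ht).1.subset (fc' _ (by simp)), (j2 t ht).2.subset (fc' _ (by simp))⟩
  · intro i hi
    rcases key i hi with h | ⟨h, h'⟩
    · simp [h]
    · simp only [h, if_false]; exact k2 i h'

theorem RunC.one {γ μ : ℝ} {r n : ℕ} {w b : ℝ} {S O S1 S2 : Finset ι} (t : ℕ × ℕ)
    (ht : t ∈ JT r n) (hγ : 0 ≤ γ)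
    (hO : Pk D w (γ - b + μ) O) (hf : ∀ i ∈ O, D.h i ≤ μ) (hn : ∀ i ∈ S, D.h i ≤ n * γ)
    (h1 : Pk D w (t.1 * γ) S1) (h2 : Pk D w (t.2 * γ) S2)
    (hS : S ⊆ O ∪ S1 ∪ S2) : RunC D γ μ r n w b S := by
  have key : ∀ i ∈ S, i ∈ O ∨ (i ∉ O ∧ i ∈ S1) ∨ (i ∉ O ∧ i ∉ S1 ∧ i ∈ S2) := by
    intro i hi
    have := hS hi
    simp only [Finset.mem_union] at this
    tauto
  have hw := hO.nonneg.1
  refine ⟨fun i => if i ∈ O then (0, (0, 0)) else if i ∈ S1 then (2, t) else (3, t), 0,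
    fun t' => if t' = t then w else 0, le_rfl, ?_, ?_, hO.subset ?_, ?_, hn, ?_, ?_, ?_⟩
  · intro t'; dsimp; split_ifs <;> simp [hw]
  · simp [ht]
  · intro i hi
    rw [Finset.mem_filter] at hi
    rcases key i hi.1 with h | ⟨h, h'⟩ | ⟨h, h', _⟩
    · exact h
    · simp [h, h'] at hi
    · simp [h, h'] at hi
  · intro i hi
    rcases key i hi with h | ⟨h, h'⟩ | ⟨h, h', _⟩
    · intro _; exact hf i h
    · simp [h, h']
    · simp [h, h']
  · refine le_of_eq (Finset.sum_eq_zero ?_)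
    intro i hi
    rw [Finset.mem_filter] at hi
    rcases key i hi.1 with h | ⟨h, h'⟩ | ⟨h, h', _⟩
    · simp [h] at hi
    · simp [h, h'] at hi
    · simp [h, h'] at hi
  · intro t' ht'
    by_cases htt : t' = t
    · subst htt
      simp only [if_true]
      refine ⟨h1.subset ?_, h2.subset ?_⟩
      · intro i hi
        rw [Finset.mem_filter] at hi
        rcases key i hi.1 with h | ⟨h, h'⟩ | ⟨h, h', _⟩
        · simp [h] at hi
        · exact h'
        · simp [h, h'] at hi
      · intro i hi
        rw [Finset.mem_filter] at hi
        rcases key i hi.1 with h | ⟨h, h'⟩ | ⟨h, h', h''⟩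
        · simp [h] at hi
        · simp [h, h'] at hi
        · exact h''
    · have e2 : ∀ q : ℕ, q = 2 ∨ q = 3 → S.filter (fun i => (if i ∈ O then ((0:ℕ), ((0:ℕ), (0:ℕ))) else
          if i ∈ S1 then (2, t) else (3, t)) = (q, t')) = ∅ := by
        intro q hq
        rw [Finset.filter_eq_empty_iff]
        intro i hi hh
        split_ifs at hh <;> simp only [Prod.mk.injEq] at hh
        · omega
        · exact htt hh.2.symm
        · exact htt hh.2.symm
      simp only [htt, if_false]
      rw [e2 2 (by simp), e2 3 (by simp)]
      exact ⟨Pk.empty le_rfl (by positivity), Pk.empty le_rfl (by positivity)⟩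
  · intro i hi
    rcases key i hi with h | ⟨h, h'⟩ | ⟨h, h', _⟩
    · simp [h]
    · right; right; exact ⟨t, ht, by simp [h, h']⟩
    · right; right; exact ⟨t, ht, by simp [h, h']⟩

theorem RunC.leaf {γ μ : ℝ} {r n : ℕ} {w b : ℝ} {S : Finset ι} (hγ : 0 ≤ γ) (hb : b ≤ γ) (hμ : 0 ≤ μ) (hw : 0 ≤ w)
    (hS : S.card ≤ 1) (hd : ∀ i ∈ S, D.w i ≤ w) (hn : ∀ i ∈ S, D.h i ≤ n * γ) :
    RunC D γ μ r n w b S := by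
  refine ⟨fun i => if D.h i ≤ μ then (0, (0, 0)) else (1, (0, 0)), w, fun _ => 0, hw, fun _ => le_rfl,
    by simp, ?_, ?_, hn, ?_, ?_, ?_⟩
  · refine Pk.leaf hw (by linarith) ((Finset.card_le_card (Finset.filter_subset _ _)).trans hS) ?_
    intro i hi
    rw [Finset.mem_filter] at hi
    refine ⟨hd i hi.1, ?_⟩
    by_cases h : D.h i ≤ μ
    · linarith
    · simp [h] at hi
  · intro i hi
    by_cases h : D.h i ≤ μ
    · simp [h]
    · simp [h]
  · rcases S.eq_empty_or_nonempty with h0 | ⟨x, hx⟩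
    · subst h0; simpa using hw
    · have hSx : S = {x} :=
        Finset.eq_singleton_iff_unique_mem.2 ⟨hx, fun y hy => Finset.card_le_one.1 hS y hy x hx⟩
      refine (sum_mono_set D.w0 (Finset.filter_subset _ _)).trans ?_
      rw [hSx, Finset.sum_singleton]; exact hd x hx
  · intro t ht
    constructor
    · rw [Finset.filter_false_of_mem]
      · exact Pk.empty le_rfl (by positivity)
      · intro i hi hh; dsimp only at hh; split_ifs at hh <;> simp at hh
    · rw [Finset.filter_false_of_mem]
      · exact Pk.empty le_rfl (by positivity)
      · intro i hi hh; dsimp only at hh; split_ifs at hh <;> simp at hh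
  · intro i hi
    by_cases h : D.h i ≤ μ
    · simp [h]
    · simp [h]

/-- splitting a slab of flat items -/
theorem Pk.splitY {w h μ t : ℝ} {S : Finset ι} (hp : Pk D w h S) (hf : ∀ i ∈ S, D.h i ≤ μ)
    (hμ : 0 ≤ μ) (ht : 0 ≤ t) (hth : t ≤ h) : ∃ S1 ⊆ S, Pk D w (t + μ) S1 ∧ Pk D w (h - t) (S \ S1) := by
  obtain ⟨a, ha, hs⟩ := hp.stripY
  refine ⟨S.filter (fun i => a i < t), Finset.filter_subset _ _, ?_, ?_⟩
  · by_cases h1 : t + μ ≤ h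
    · have := hs (t + μ) (h - (t + μ)) (by linarith) (by linarith) (by linarith)
      rw [sub_sub_cancel] at this
      refine this.subset ?_
      intro i hi
      rw [Finset.mem_filter] at hi ⊢
      exact ⟨hi.1, Or.inl (by linarith [hf i hi.1])⟩
    · exact (hp.subset (Finset.filter_subset _ _)).mono le_rfl (by linarith)
  · have := hs 0 t le_rfl ht (by linarith)
    refine this.subset ?_
    intro i hi
    simp only [Finset.mem_sdiff, Finset.mem_filter, not_and, not_lt] at hi ⊢
    exact ⟨hi.1, Or.inr (by linarith [hi.2 hi.1])⟩

theorem mem_JT {r n a b : ℕ} : (a, b) ∈ JT r n ↔ (a < n ∧ b < n) ∧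
    (b = 0 ∨ (r ≤ a ∧ r ≤ b ∧ a + b ≤ n + 2)) := by
  simp [JT]

theorem RunC.slab {γ μ : ℝ} {r n : ℕ} {w h1 h2 b : ℝ} {S S1 S2 : Finset ι} (hγ : 0 < γ) (hn0 : 1 ≤ n)
    (hμ : 0 ≤ μ) (hb : 0 ≤ b) (hbγ : b < γ)
    (p1 : Pk D w h1 S1) (p2 : Pk D w h2 S2) (hf : ∀ i ∈ S1, D.h i ≤ μ)
    (hh : h1 + h2 ≤ n * γ - b) (hn : ∀ i ∈ S, D.h i ≤ n * γ)
    (ih : ∀ b, 0 ≤ b → b < γ → h2 ≤ n * γ - b → RunC D γ μ r n w b S2)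
    (hS : S ⊆ S1 ∪ S2) : RunC D γ μ r n w b S := by
  have hp1 := p1.nonneg
  have hp2 := p2.nonneg
  by_cases hc : b + h1 < γ
  · exact RunC.addO p1 hf hn (ih (b + h1) (by linarith [hp1.2]) hc (by linarith)) hS
  · push Not at hc
    obtain ⟨L, hL, q1, q2⟩ := p1.splitY (t := γ - b) hf hμ (by linarith) (by linarith)
    refine RunC.one (n - 1, 0) (mem_JT.2 ⟨⟨by omega, by omega⟩, Or.inl rfl⟩) hγ.le
      (O := L) (S1 := (S1 \ L) ∪ S2) (S2 := ∅) q1 (fun i hi => hf i (hL hi)) hn ?_ 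
      (Pk.empty hp1.1 (by simp)) ?_
    · refine Pk.hcut q2 p2 ?_ subset_rfl
      push_cast [Nat.cast_sub hn0]
      linarith
    · intro i hi
      have := hS hi
      simp only [Finset.mem_union, Finset.mem_sdiff] at this ⊢
      tauto

theorem cover_inter {S S1 S2 T : Finset ι} (hS : S ⊆ S1 ∪ S2) (hT : T ⊆ S) :
    T ⊆ (T ∩ S1) ∪ (T ∩ S2) := by
  rw [← Finset.inter_union_distrib_left]
  exact Finset.subset_inter subset_rfl (hT.trans hS)

theorem RunC.both {γ μ : ℝ} {r n : ℕ} (hγ : 0 < γ) (hr : 1 ≤ r) (hn0 : 1 ≤ n) (hμ : 0 ≤ μ)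
    {w h1 h2 b : ℝ} {S S1 S2 : Finset ι} (hb : 0 ≤ b) (hbγ : b < γ)
    (p1 : Pk D w h1 S1) (p2 : Pk D w h2 S2) (hc1 : r * γ < h1) (hc2 : r * γ < h2)
    (hh : h1 + h2 ≤ n * γ - b) (hn : ∀ i ∈ S, D.h i ≤ n * γ)
    (hS : S ⊆ S1 ∪ S2) : RunC D γ μ r n w b S := by
  have a1 : (r : ℝ) < h1 / γ := (lt_div_iff₀ hγ).2 hc1
  have a2 : (r : ℝ) < h2 / γ := (lt_div_iff₀ hγ).2 hc2
  have a3 : h1 / γ + h2 / γ ≤ n := by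
    rw [← add_div, div_le_iff₀ hγ]; linarith
  have b1 := Nat.le_ceil (h1 / γ)
  have b2 := Nat.le_ceil (h2 / γ)
  have c1 := Nat.ceil_lt_add_one (a := h1 / γ) (by linarith [(Nat.cast_nonneg r : (0:ℝ) ≤ r)])
  have c2 := Nat.ceil_lt_add_one (a := h2 / γ) (by linarith [(Nat.cast_nonneg r : (0:ℝ) ≤ r)])
  have hr' : (1:ℝ) ≤ r := by exact_mod_cast hr
  refine RunC.one (⌈h1 / γ⌉₊, ⌈h2 / γ⌉₊) (mem_JT.2 ⟨⟨?_, ?_⟩, Or.inr ⟨?_, ?_, ?_⟩⟩) hγ.le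
    (O := ∅) (S1 := S1) (S2 := S2) (Pk.empty p1.nonneg.1 (by linarith)) (by simp) hn 
    (p1.mono le_rfl ?_) (p2.mono le_rfl ?_) (by simpa using hS)
  · have : (⌈h1 / γ⌉₊ : ℝ) < n := by linarith
    exact_mod_cast this
  · have : (⌈h2 / γ⌉₊ : ℝ) < n := by linarith
    exact_mod_cast this
  · have : (r : ℝ) ≤ ⌈h1 / γ⌉₊ := by linarith
    exact_mod_cast this
  · have : (r : ℝ) ≤ ⌈h2 / γ⌉₊ := by linarith
    exact_mod_cast this
  · have : (⌈h1 / γ⌉₊ : ℝ) + ⌈h2 / γ⌉₊ < n + 2 := by linarith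
    have h3 : ⌈h1 / γ⌉₊ + ⌈h2 / γ⌉₊ < n + 2 := by exact_mod_cast this
    omega
  · exact (div_le_iff₀ hγ).1 b1
  · exact (div_le_iff₀ hγ).1 b2

theorem RunC.exists {γ μ : ℝ} {r n : ℕ} (hγ : 0 < γ) (hr : 1 ≤ r) (hn0 : 1 ≤ n) (hμ : 0 ≤ μ)
    {w h : ℝ} {S : Finset ι} (hp : Pk D w h S) : ∀ T ⊆ S, (∀ i ∈ T, D.h i ≤ μ ∨ r * γ < D.h i) →
    ∀ b, 0 ≤ b → b < γ → h ≤ n * γ - b → RunC D γ μ r n w b T := by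
  induction hp with
  | leaf hw hh hS hd =>
    intro T hT hb' b hb hbγ hh'
    exact RunC.leaf hγ.le hbγ.le hμ hw ((Finset.card_le_card hT).trans hS)
      (fun i hi => (hd i (hT hi)).1)
      (fun i hi => by linarith [(hd i (hT hi)).2])
  | @vcut w h w1 w2 S S1 S2 p1 p2 hw hS i1 i2 =>
    intro T hT hb' b hb hbγ hh'
    exact RunC.v (i1 (T ∩ S1) Finset.inter_subset_right
      (fun i hi => hb' i (Finset.mem_inter.1 hi).1) b hb hbγ hh')
      (i2 (T ∩ S2) Finset.inter_subset_right
      (fun i hi => hb' i (Finset.mem_inter.1 hi).1) b hb hbγ hh') hw (cover_inter hS hT)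
  | @hcut w h h1 h2 S S1 S2 p1 p2 hh hS i1 i2 =>
    intro T hT hb' b hb hbγ hh'
    have q1 := p1.subset (Finset.inter_subset_right (s₁ := T))
    have q2 := p2.subset (Finset.inter_subset_right (s₁ := T))
    have hn : ∀ i ∈ T, D.h i ≤ n * γ := fun i hi => by
      linarith [((Pk.hcut p1 p2 hh hS).dim_le i (hT hi)).2]
    by_cases hc1 : h1 ≤ r * γ
    · refine RunC.slab hγ hn0 hμ hb hbγ q1 q2 ?_ (by linarith) hn ?_ (cover_inter hS hT)
      · intro i hi
        have := (q1.dim_le i hi).2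
        exact (hb' i (Finset.mem_inter.1 hi).1).resolve_right (by linarith)
      · exact i2 _ Finset.inter_subset_right (fun i hi => hb' i (Finset.mem_inter.1 hi).1)
    by_cases hc2 : h2 ≤ r * γ
    · refine RunC.slab hγ hn0 hμ hb hbγ q2 q1 ?_ (by linarith) hn ?_
        (by rw [Finset.union_comm]; exact cover_inter hS hT)
      · intro i hi
        have := (q2.dim_le i hi).2
        exact (hb' i (Finset.mem_inter.1 hi).1).resolve_right (by linarith)
      · exact i1 _ Finset.inter_subset_right (fun i hi => hb' i (Finset.mem_inter.1 hi).1)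
    exact RunC.both hγ hr hn0 hμ hb hbγ q1 q2 (not_le.1 hc1) (not_le.1 hc2) (by linarith) hn
      (cover_inter hS hT)

end

/-- the height bound -/
noncomputable def xh (r n : ℕ) : ℝ := if n < r then n else n + (6 / r * n - 5)

theorem xh_div {r n : ℕ} (hr : 6 ≤ r) (h : r ≤ n) : (6:ℝ) ≤ 6 / r * n := by
  have hn : (r:ℝ) ≤ n := by exact_mod_cast h
  have hr0 : (0:ℝ) < r := by exact_mod_cast (show 0 < r by omega)
  rw [div_mul_eq_mul_div, le_div_iff₀ hr0]; linarith

theorem xh_ge {r n : ℕ} (hr : 6 ≤ r) : (n:ℝ) ≤ xh r n := by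
  unfold xh
  split_ifs with h
  · exact le_rfl
  · linarith [xh_div hr (not_lt.1 h)]

theorem xh_ge1 {r n : ℕ} (hr : 6 ≤ r) (h : r ≤ n) : (n:ℝ) + 1 ≤ xh r n := by
  rw [xh, if_neg (by omega)]; linarith [xh_div hr h]

theorem xh_drop {r n a : ℕ} (hr : 6 ≤ r) (h : r ≤ n) (ha : a < n) : xh r a + 1 ≤ xh r n := by
  have h1 : (a:ℝ) + 1 ≤ n := by exact_mod_cast ha
  have h2 := xh_div hr h
  rw [xh, xh, if_neg (show ¬ n < r by omega)]
  split_ifs with h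
  · linarith
  · have : (6:ℝ) / r * a ≤ 6 / r * n := by gcongr
    linarith

theorem xh_type {r n a b : ℕ} (hr : 6 ≤ r) (h : r ≤ n) (ha : r ≤ a) (hb : r ≤ b)
    (hab : a + b ≤ n + 2) : xh r a + xh r b + 1 ≤ xh r n := by
  have h1 : (a:ℝ) + b ≤ n + 2 := by exact_mod_cast hab
  rw [xh, xh, xh, if_neg (show ¬ n < r by omega), if_neg (show ¬ a < r by omega),
    if_neg (show ¬ b < r by omega)]
  have h2 : (6:ℝ) / r * (a + b) ≤ 6 / r * (n + 2) := by gcongr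
  have hr6 : (6:ℝ) ≤ r := by exact_mod_cast hr
  have h3 : (6:ℝ) / r ≤ 1 := by rw [div_le_one (by linarith)]; exact hr6
  have e1 : (6:ℝ) / r * (a + b) = 6 / r * a + 6 / r * b := by ring
  have e2 : (6:ℝ) / r * (n + 2) = 6 / r * n + 2 * (6 / r) := by ring
  linarith

theorem xh_JT {r n : ℕ} (hr : 6 ≤ r) (h : r ≤ n) (t : ℕ × ℕ) (ht : t ∈ JT r n) :
    xh r t.1 + xh r t.2 + 1 ≤ xh r n := by
  obtain ⟨a, b⟩ := t
  rw [mem_JT] at ht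
  rcases ht.2 with h0 | ⟨h1, h2, h3⟩
  · subst h0
    have := xh_drop hr h ht.1.1
    have e : xh r 0 = 0 := by rw [xh, if_pos (by omega)]; simp
    dsimp only
    rw [e]; linarith
  · exact xh_type hr h h1 h2 h3

/-- what the flat-item lemma provides -/
def KRProp (ε ν μ : ℝ) (K : ℕ) : Prop :=
    ∀ (ι : Type) [DecidableEq ι] (D : Dims ι) (p : ι → ℝ) (S : Finset ι) (W h : ℝ),
      (∀ i, 0 ≤ p i) → h ≤ 1 → Pk D W h S → (∀ i ∈ S, D.h i ≤ μ) →
      ∃ S' ⊆ S, ∑ i ∈ S \ S', p i ≤ ε * ∑ i ∈ S, p i ∧ Ct D ε NoM K W (h + ν) S'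

theorem KRProp.sol {ε ν μ : ℝ} {K : ℕ} (H : KRProp ε ν μ K) 
    {ι : Type} [DecidableEq ι] (D : Dims ι) (M : ι → Prop) (p : ι → ℝ) (S : Finset ι) (W h : ℝ)
      (hp : ∀ i, 0 ≤ p i) (hh : h ≤ 1) (hP : Pk D W h S) (hμ : ∀ i ∈ S, D.h i ≤ μ)
      (hM : ∀ i ∈ S, M i → μ < D.h i) : Sol D ε ε M p K W (h + ν) S := by
  obtain ⟨S', h1, h2, h3⟩ := H ι D p S W h hp hh hP hμ
  have h4 : ∀ i ∈ S, ¬ M i := fun i hi hm => absurd (hM i hi hm) (not_lt.2 (hμ i hi))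
  exact ⟨S', h1, h2, fun i hi hm => absurd hm (h4 i hi),
    h3.addM subset_rfl (fun i hi => h4 i (h1 hi))⟩

theorem RAn_step {ε ν γ μ : ℝ} {K0 K r n : ℕ} (hε : 0 < ε) (hν : 0 < ν) (hγ : 0 < γ) (hμ : 0 < μ)
    (hr : 6 ≤ r) (hrγ : r * γ ≤ 1) (hγμ : γ + μ ≤ 1) (H : KRProp ε ν μ K0) (hn : r ≤ n)
    {ι : Type} [DecidableEq ι] (D : Dims ι) (M : ι → Prop) (p : ι → ℝ) (S : Finset ι) (W : ℝ)
    (ih : ∀ m < n, ∀ (S : Finset ι) (W : ℝ), (∀ i ∈ S, D.h i ≤ μ ∨ r * γ < D.h i) →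
      (∀ i ∈ S, M i → μ < D.h i) → Pk D W (m * γ) S →
      Sol D ε ε M p K W ((γ + μ + ν) * xh r m) S)
    (hp : ∀ i, 0 ≤ p i) (hb : ∀ i ∈ S, D.h i ≤ μ ∨ r * γ < D.h i)
    (hM : ∀ i ∈ S, M i → μ < D.h i) (hP : Pk D W (n * γ) S) :
    Sol D ε ε M p (K0 + (1 + (JT r n).card * (K + K))) W ((γ + μ + ν) * xh r n) S := by
  have hγ' : 0 < γ + μ + ν := by linarith
  have hx1 := xh_ge1 hr hn
  have hn0 : (0:ℝ) ≤ n := by positivity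
  obtain ⟨c, ws, wt, a1, b1, d1, e1, f1, g1, i1, j1, k1⟩ :=
    RunC.exists hγ (by omega : 1 ≤ r) (by omega : 1 ≤ n) hμ.le hP S subset_rfl hb 0 le_rfl hγ
      (by linarith)
  have hsub : ∀ t, S.filter (fun i => c i = t) ⊆ S := fun t => Finset.filter_subset _ _
  rw [sub_zero] at e1
  have sO := H.sol D M p _ W _ hp hγμ e1
    (fun i hi => f1 i (Finset.mem_filter.1 hi).1 (Finset.mem_filter.1 hi).2)
    (fun i hi => hM i (hsub _ hi))
  have sS : Sol D ε ε M p 1 ws ((γ + μ + ν) * (xh r n - 1)) (S.filter (fun i => c i = (1, (0, 0)))) := by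
    refine Sol.of_ct hp hε.le (Ct.vstack le_rfl a1 (mul_nonneg hγ'.le (by linarith)) ?_ i1)
    intro i hi
    refine (g1 i (hsub _ hi)).trans ?_
    have : (n:ℝ) * γ ≤ (xh r n - 1) * (γ + μ + ν) := by
      apply mul_le_mul <;> linarith
    linarith
  have sT : ∀ t ∈ JT r n, Sol D ε ε M p (K + K) (wt t) ((γ + μ + ν) * (xh r n - 1))
      (S.filter (fun i => c i = (2, t)) ∪ S.filter (fun i => c i = (3, t))) := by
    intro t ht
    have ht' := ht
    have hmem := (mem_JT (r := r) (n := n) (a := t.1) (b := t.2)).1 ht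
    have q1 := ih t.1 hmem.1.1 _ (wt t) (fun i hi => hb i (hsub _ hi))
      (fun i hi => hM i (hsub _ hi)) (j1 t ht).1
    have q2 := ih t.2 hmem.1.2 _ (wt t) (fun i hi => hb i (hsub _ hi))
      (fun i hi => hM i (hsub _ hi)) (j1 t ht).2
    refine Sol.hcut hp q1 q2 ?_ ?_ rfl
    · rw [← mul_add]
      exact mul_le_mul_of_nonneg_left (by linarith [xh_JT hr hn t ht]) hγ'.le
    · rw [Finset.disjoint_filter]
      intro i _ h1 h2
      rw [h1] at h2; simp at h2
  have sV := Sol.vsum hp (JT r n) (mul_nonneg hγ'.le (by linarith)) (K + K) wt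
    (fun t => S.filter (fun i => c i = (2, t)) ∪ S.filter (fun i => c i = (3, t))) sT (by
      intro a b hab
      rw [Finset.disjoint_left]
      intro i hi hi'
      simp only [Finset.mem_union, Finset.mem_filter] at hi hi'
      rcases hi with hi | hi <;> rcases hi' with hi' | hi' <;> rw [hi.2] at hi' <;>
        simp [hab] at hi')
  have sW := Sol.vcut hp sS sV d1 (by
      rw [Finset.disjoint_left]
      intro i hi hi'
      simp only [Finset.mem_biUnion, Finset.mem_union, Finset.mem_filter] at hi hi'
      rcases hi' with ⟨t, _, h | h⟩ <;> rw [hi.2] at h <;> simp at h) rfl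
  refine Sol.hcut hp sO sW ?_ ?_ ?_
  · have : (γ + μ + ν) * xh r n = (γ + μ + ν) + (γ + μ + ν) * (xh r n - 1) := by ring
    rw [this]
  · rw [Finset.disjoint_left]
    intro i hi hi'
    simp only [Finset.mem_biUnion, Finset.mem_union, Finset.mem_filter] at hi hi'
    rcases hi' with h | ⟨t, _, h | h⟩ <;> rw [hi.2] at h <;> simp at h
  · ext i
    simp only [Finset.mem_biUnion, Finset.mem_union, Finset.mem_filter]
    constructor
    · intro hi
      rcases k1 i hi with h | h | ⟨t, ht, h | h⟩
      · left; exact ⟨hi, h⟩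
      · right; left; exact ⟨hi, h⟩
      · right; right; exact ⟨t, ht, Or.inl ⟨hi, h⟩⟩
      · right; right; exact ⟨t, ht, Or.inr ⟨hi, h⟩⟩
    · rintro (h | h | ⟨t, _, h | h⟩) <;> exact h.1

theorem RAn {ε ν γ μ : ℝ} {K0 r : ℕ} (hε : 0 < ε) (hν : 0 < ν) (hγ : 0 < γ) (hμ : 0 < μ)
    (hr : 6 ≤ r) (hrγ : r * γ ≤ 1) (hγμ : γ + μ ≤ 1) (H : KRProp ε ν μ K0) (n : ℕ) :
    ∃ K : ℕ, ∀ m < n, ∀ (ι : Type) [DecidableEq ι] (D : Dims ι) (M : ι → Prop) (p : ι → ℝ),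
      (∀ i, 0 ≤ p i) → ∀ (S : Finset ι) (W : ℝ),
      (∀ i ∈ S, D.h i ≤ μ ∨ r * γ < D.h i) → (∀ i ∈ S, M i → μ < D.h i) → Pk D W (m * γ) S →
      Sol D ε ε M p K W ((γ + μ + ν) * xh r m) S := by
  have hγ' : 0 < γ + μ + ν := by linarith
  induction n with
  | zero => exact ⟨0, by simp⟩
  | succ n ih =>
    obtain ⟨K, hK⟩ := ih
    refine ⟨K + (K0 + (1 + (JT r n).card * (K + K))), ?_⟩
    intro m hm ι _ D M p hp S W hb hM hP
    rcases Nat.lt_succ_iff_lt_or_eq.1 hm with h | h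
    · exact (hK m h ι D M p hp S W hb hM hP).mono hε.le (by omega) le_rfl le_rfl
    subst h
    by_cases hmr : r ≤ m
    · exact (RAn_step hε hν hγ hμ hr hrγ hγμ H hmr D M p S W (fun m' hm' => hK m' hm' ι D M p hp)
        hp hb hM hP).mono hε.le (by omega) le_rfl le_rfl
    · rcases Nat.eq_zero_or_pos m with h0 | h0
      · subst h0
        have := hP.empty_of_h (by simp)
        subst this
        exact ⟨∅, subset_rfl, by simp, by simp, Ct.empty hP.nonneg.1
          (mul_nonneg hγ'.le ((by positivity : (0:ℝ) ≤ ((0:ℕ):ℝ)).trans (xh_ge hr))) rfl⟩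
      · have hm1 : (1:ℝ) ≤ m := by exact_mod_cast h0
        have hmr' : (m:ℝ) < r := by exact_mod_cast not_le.1 hmr
        have hmγ : (m:ℝ) * γ < r * γ := by gcongr
        refine (H.sol D M p S W _ hp (by linarith) hP ?_ hM).mono hε.le (by omega) le_rfl ?_
        · intro i hi
          have := (hP.dim_le i hi).2
          exact (hb i hi).resolve_right (by linarith)
        · rw [xh, if_pos (not_le.1 hmr)]
          have : ν ≤ ν * m := by nlinarith
          have : 0 ≤ μ * m := by positivity
          linarith

/-- what the resource augmentation lemma provides -/
def RAProp (ε θ : ℝ) (K : ℕ) : Prop :=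
    ∀ (ι : Type) [DecidableEq ι] (D : Dims ι) (p : ι → ℝ) (S : Finset ι) (W H : ℝ),
      (∀ i, 0 ≤ p i) → Pk D W H S →
      Sol D ε (2 * ε) (fun i => θ * H ≤ D.h i) p K W ((1 + θ) * H) S

/-- one level of the resource augmentation lemma -/
theorem RA_level (ε θ ρ : ℝ) (hε : 0 < ε) (hε1 : ε ≤ 1 / 2) (hθ : 0 < θ) (hθ1 : θ ≤ 1)
    (hρ : 0 < ρ) (hρθ : ρ < θ) : ∃ (μ : ℝ) (K : ℕ), 0 < μ ∧ μ < ρ ∧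
    ∀ (ι : Type) [DecidableEq ι] (D : Dims ι) (p : ι → ℝ) (S : Finset ι) (W : ℝ),
      (∀ i, 0 ≤ p i) → (∀ i ∈ S, D.h i ≤ μ ∨ ρ < D.h i) → Pk D W 1 S →
      Sol D ε ε (fun i => θ ≤ D.h i) p K W (1 + θ) S := by
  set r : ℕ := ⌈48 / θ⌉₊ with hr
  have hr1 : 48 / θ ≤ r := Nat.le_ceil _
  have hr2 : (48:ℝ) ≤ r := le_trans (by rw [le_div_iff₀ hθ]; linarith) hr1
  have hr48 : 48 ≤ r := by exact_mod_cast hr2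
  have hr3 : 6 / r ≤ θ / 8 := by
    rw [div_le_iff₀ (by linarith)]
    rw [div_le_iff₀ hθ] at hr1
    linarith
  set γ : ℝ := ρ / r with hγ
  have hγ0 : 0 < γ := by positivity
  have hrγ : r * γ = ρ := by rw [hγ]; field_simp
  have hγ1 : γ ≤ θ / 48 := by
    rw [hγ, div_le_iff₀ (by linarith)]
    have : θ / 48 * 48 ≤ θ / 48 * r := by gcongr
    linarith
  set ν : ℝ := θ / 16 * γ with hν
  have hν0 : 0 < ν := by positivity
  have hν1 : ν ≤ 1 := by rw [hν]; nlinarith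
  obtain ⟨μ0, K0, hμ0, hK0⟩ := KR ε ν hε hε1 hν0 hν1
  set μ : ℝ := min μ0 (min ν (ρ / 2)) with hμ
  have hμpos : 0 < μ := by positivity
  have hμν : μ ≤ ν := (min_le_right _ _).trans (min_le_left _ _)
  have hμρ : μ ≤ ρ / 2 := (min_le_right _ _).trans (min_le_right _ _)
  have hH : KRProp ε ν μ K0 := fun ι _ D p S W h hp hh hP hS =>
    hK0 ι D p S W h hp hh hP (fun i hi => (hS i hi).trans (min_le_left _ _))
  have hνγ : ν ≤ γ / 16 := by rw [hν]; nlinarith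
  set L : ℕ := ⌈1 / γ⌉₊ with hL
  obtain ⟨K, hK⟩ := RAn hε hν0 hγ0 hμpos (r := r) (by omega) (by linarith) (by linarith) hH (L + 1)
  refine ⟨μ, K, hμpos, by linarith, ?_⟩
  intro ι _ D p S W hp hb hP
  have hL1 : 1 ≤ L * γ := (div_le_iff₀ hγ0).1 (Nat.le_ceil (1 / γ))
  have hL2 : L * γ ≤ 1 + γ := by
    have := Nat.ceil_lt_add_one (a := 1 / γ) (by positivity)
    have h2 : (L:ℝ) * γ ≤ (1 / γ + 1) * γ := by gcongr
    rwa [add_mul, one_div, inv_mul_cancel₀ hγ0.ne', one_mul] at h2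
  refine (hK L (by omega) ι D _ p hp S W (by rw [hrγ]; exact hb) ?_ (hP.mono le_rfl hL1)).mono
    hε.le le_rfl le_rfl ?_
  · intro i _ hi; linarith
  · have h1 : γ + μ + ν ≤ γ * (1 + θ / 8) := by linarith
    have hL0 : (0:ℝ) ≤ L := by positivity
    have h2 : xh r L ≤ L * (1 + θ / 8) := by
      have : 6 / r * L ≤ θ / 8 * L := by gcongr
      rw [xh]; split_ifs
      · have : 0 ≤ θ / 8 * L := by positivity
        linarith
      · linarith
    calc (γ + μ + ν) * xh r L ≤ (γ * (1 + θ / 8)) * (L * (1 + θ / 8)) := by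
          apply mul_le_mul h1 h2 (hL0.trans (xh_ge (by omega))) (by positivity)
      _ = (L * γ) * ((1 + θ / 8) * (1 + θ / 8)) := by ring
      _ ≤ (1 + θ / 48) * ((1 + θ / 8) * (1 + θ / 8)) := by gcongr; linarith
      _ ≤ 1 + θ := by nlinarith [mul_nonneg hθ.le hθ.le, mul_nonneg (mul_nonneg hθ.le hθ.le) hθ.le]

theorem RA (ε θ : ℝ) (hε : 0 < ε) (hε1 : ε ≤ 1 / 2) (hθ : 0 < θ) (hθ1 : θ ≤ 1) :
    ∃ K, RAProp ε θ K := by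
  have H := fun ρ : {x : ℝ // 0 < x ∧ x < θ} => RA_level ε θ ρ.1 hε hε1 hθ hθ1 ρ.2.1 ρ.2.2
  choose m K hm1 hm2 HK using H
  let ds : ℕ → {x : ℝ // 0 < x ∧ x < θ} := fun k => Nat.rec ⟨θ / 2, by linarith, by linarith⟩
    (fun _ x => ⟨m x, hm1 x, (hm2 x).trans x.2.2⟩) k
  have hds : ∀ k, (ds (k + 1)).1 = m (ds k) := fun k => rfl
  refine ⟨∑ k ∈ Finset.range ⌈1 / ε⌉₊, K (ds k), ?_⟩
  intro ι _ D p S W H hp hP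
  have hp0 : ∀ T : Finset ι, 0 ≤ ∑ i ∈ T, p i := fun T => Finset.sum_nonneg (fun i _ => hp i)
  rcases hP.nonneg.2.eq_or_lt with hH | hH
  · have := hP.empty_of_h hH.ge
    subst this
    exact ⟨∅, subset_rfl, by simp, by simp, Ct.empty hP.nonneg.1 (by rw [← hH]; simp) rfl⟩
  have hP1 := hP.scale one_pos (inv_pos.2 hH)
  rw [inv_mul_cancel₀ hH.ne', one_mul] at hP1
  set D1 := D.sc 1 H⁻¹ one_pos (inv_pos.2 hH) with hD1
  have hh1 : ∀ i, D1.h i = H⁻¹ * D.h i := fun i => rfl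
  have hM : ∀ i, θ ≤ D1.h i ↔ θ * H ≤ D.h i := by
    intro i
    rw [hh1, inv_mul_eq_div, le_div_iff₀ hH]
  obtain ⟨j, hj, hb⟩ := band2 ε hε p hp S D1.h
    (fun k => (ds k).1) (fun k => by rw [hds]; exact (hm2 _).le)
  obtain ⟨S', h1, h2, h3, h4⟩ := HK (ds j) ι D1 p _ W hp
    (fun i hi => by have := (Finset.mem_filter.1 hi).2; rwa [hds] at this)
    (hP1.subset (Finset.filter_subset (fun i => D1.h i ≤ (ds (j + 1)).1 ∨ (ds j).1 < D1.h i) S))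
  refine ⟨S', h1.trans (Finset.filter_subset _ _), ?_, ?_, ?_⟩
  · have h5 : S \ S' ⊆ (S \ S.filter (fun i => D1.h i ≤ (ds (j + 1)).1 ∨ (ds j).1 < D1.h i)) ∪
        (S.filter (fun i => D1.h i ≤ (ds (j + 1)).1 ∨ (ds j).1 < D1.h i) \ S') := by
      intro i; simp only [Finset.mem_sdiff, Finset.mem_union]; tauto
    have h6 := sum_cover_le hp h5
    have h7 := sum_mono_set hp (Finset.filter_subset
      (fun i => D1.h i ≤ (ds (j + 1)).1 ∨ (ds j).1 < D1.h i) S)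
    have h8 := mul_le_mul_of_nonneg_left h7 hε.le
    linarith
  · intro i hi hθi
    refine h3 i (Finset.mem_filter.2 ⟨hi, Or.inr ?_⟩) ((hM i).2 hθi)
    have := (hM i).2 hθi
    linarith [(ds j).2.2]
  · have h5 := h4.unscale
    have e : (fun i => θ ≤ D1.h i) = (fun i => θ * H ≤ D.h i) := funext (fun i => propext (hM i))
    rw [e] at h5
    refine h5.mono hε.le (le_sum_range (fun k => K (ds k)) _ j hj) (by simp) ?_
    rw [div_inv_eq_mul]

/-- guillotine trees with loose items `G` and at most `n` solved leaves containing `Q` -/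
inductive PkO {ι : Type} [DecidableEq ι] (D : Dims ι) (ε : ℝ) (K : ℕ) :
    ℕ → ℝ → ℝ → Finset ι → Finset ι → Prop
  | leaf {n : ℕ} {w h : ℝ} {Q G : Finset ι} (hw : 0 ≤ w) (hh : 0 ≤ h) (hQ : Q = ∅)
      (hG : G.card ≤ 1) (hd : ∀ i ∈ G, D.w i ≤ w ∧ D.h i ≤ h) : PkO D ε K n w h Q G
  | sol {n : ℕ} {w h : ℝ} {Q G : Finset ι} (hn : 1 ≤ n) (hc : Ct D ε NoM K w h Q) (hG : G = ∅) :
      PkO D ε K n w h Q G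
  | vcut {n n1 n2 : ℕ} {w h w1 w2 : ℝ} {Q Q1 Q2 G G1 G2 : Finset ι} (h1 : PkO D ε K n1 w1 h Q1 G1)
      (h2 : PkO D ε K n2 w2 h Q2 G2) (hw : w1 + w2 ≤ w) (hQ : Q ⊆ Q1 ∪ Q2) (hG : G ⊆ G1 ∪ G2)
      (hn : n1 + n2 ≤ n) : PkO D ε K n w h Q G
  | hcut {n n1 n2 : ℕ} {w h h1 h2 : ℝ} {Q Q1 Q2 G G1 G2 : Finset ι} (p1 : PkO D ε K n1 w h1 Q1 G1)
      (p2 : PkO D ε K n2 w h2 Q2 G2) (hh : h1 + h2 ≤ h) (hQ : Q ⊆ Q1 ∪ Q2) (hG : G ⊆ G1 ∪ G2)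
      (hn : n1 + n2 ≤ n) : PkO D ε K n w h Q G

section
variable {ι : Type} [DecidableEq ι] {D : Dims ι} {ε : ℝ} {K : ℕ}

theorem PkO.nonneg {n : ℕ} {w h : ℝ} {Q G : Finset ι} (hp : PkO D ε K n w h Q G) :
    0 ≤ w ∧ 0 ≤ h := by
  induction hp with
  | leaf hw hh _ _ => exact ⟨hw, hh⟩
  | sol _ hc _ => exact hc.nonneg
  | vcut _ _ hw _ _ _ i1 i2 => exact ⟨by linarith [i1.1, i2.1], i1.2⟩
  | hcut _ _ hh _ _ _ i1 i2 => exact ⟨i1.1, by linarith [i1.2, i2.2]⟩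

theorem PkO.mono (hε : 0 ≤ ε) {K' n n' : ℕ} {w h w' h' : ℝ} {Q G : Finset ι}
    (hp : PkO D ε K n w h Q G) (hK : K ≤ K') (hn : n ≤ n') (hw : w ≤ w') (hh : h ≤ h') :
    PkO D ε K' n' w' h' Q G := by
  induction hp generalizing n' w' h' with
  | leaf h1 h2 h3 h4 h5 =>
    exact PkO.leaf (h1.trans hw) (h2.trans hh) h3 h4
      (fun i hi => ⟨(h5 i hi).1.trans hw, (h5 i hi).2.trans hh⟩)
  | sol h1 h2 h3 => exact PkO.sol (h1.trans hn) (h2.mono hε hK hw hh) h3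
  | vcut _ _ hw' hQ hG hn' i1 i2 =>
    exact PkO.vcut (i1 le_rfl le_rfl hh) (i2 le_rfl le_rfl hh) (hw'.trans hw) hQ hG (hn'.trans hn)
  | hcut _ _ hh' hQ hG hn' i1 i2 =>
    exact PkO.hcut (i1 le_rfl hw le_rfl) (i2 le_rfl hw le_rfl) (hh'.trans hh) hQ hG (hn'.trans hn)

theorem PkO.subset {n : ℕ} {w h : ℝ} {Q G Q' G' : Finset ι} (hp : PkO D ε K n w h Q G)
    (hQ' : Q' ⊆ Q) (hG' : G' ⊆ G) : PkO D ε K n w h Q' G' := by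
  cases hp with
  | leaf h1 h2 h3 h4 h5 =>
    exact PkO.leaf h1 h2 (by subst h3; exact Finset.subset_empty.1 hQ')
      ((Finset.card_le_card hG').trans h4) (fun i hi => h5 i (hG' hi))
  | sol h1 h2 h3 => exact PkO.sol h1 (h2.subset hQ') (by subst h3; exact Finset.subset_empty.1 hG')
  | vcut a b hw hQ hG hn => exact PkO.vcut a b hw (hQ'.trans hQ) (hG'.trans hG) hn
  | hcut a b hw hQ hG hn => exact PkO.hcut a b hw (hQ'.trans hQ) (hG'.trans hG) hn

theorem PkO.tr {n : ℕ} {w h : ℝ} {Q G : Finset ι} (hp : PkO D ε K n w h Q G) :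
    PkO D.T ε K n h w Q G := by
  induction hp with
  | leaf h1 h2 h3 h4 h5 => exact PkO.leaf h2 h1 h3 h4 (fun i hi => ⟨(h5 i hi).2, (h5 i hi).1⟩)
  | sol h1 h2 h3 => exact PkO.sol h1 h2.tr h3
  | vcut _ _ hw hQ hG hn i1 i2 => exact PkO.hcut i1 i2 hw hQ hG hn
  | hcut _ _ hw hQ hG hn i1 i2 => exact PkO.vcut i1 i2 hw hQ hG hn

theorem Pk.toO {w h : ℝ} {S : Finset ι} (hp : Pk D w h S) : PkO D ε K 0 w h ∅ S := by
  induction hp with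
  | leaf h1 h2 h3 h4 => exact PkO.leaf h1 h2 rfl h3 h4
  | vcut _ _ hw hS i1 i2 => exact PkO.vcut i1 i2 hw (by simp) hS le_rfl
  | hcut _ _ hw hS i1 i2 => exact PkO.hcut i1 i2 hw (by simp) hS le_rfl

/-- nested slabs around a core -/
inductive Nest (D : Dims ι) : ℝ → ℝ → ℝ → ℝ → Finset ι → Finset ι → ℝ → ℝ → Prop
  | nil {w h : ℝ} (hw : 0 ≤ w) (hh : 0 ≤ h) : Nest D 0 0 w h ∅ ∅ w h
  | vs {V V' U w h w' wc hc l : ℝ} {A B X A' : Finset ι} (hX : Pk D l h X)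
      (hN : Nest D V' U w' h A' B wc hc) (hV : V = l + V') (hw : w = l + w') (hA : A = X ∪ A') :
      Nest D V U w h A B wc hc
  | hs {V U U' w h h' wc hc l : ℝ} {A B X B' : Finset ι} (hX : Pk D w l X)
      (hN : Nest D V U' w h' A B' wc hc) (hU : U = l + U') (hh : h = l + h') (hB : B = X ∪ B') :
      Nest D V U w h A B wc hc

theorem Nest.tr {V U w h wc hc : ℝ} {A B : Finset ι} (hN : Nest D V U w h A B wc hc) :
    Nest D.T U V h w B A hc wc := by
  induction hN with
  | nil hw hh => exact Nest.nil hh hw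
  | vs hX _ hV hw hA ih => exact Nest.hs hX.tr ih hV hw hA
  | hs hX _ hV hw hA ih => exact Nest.vs hX.tr ih hV hw hA

theorem Nest.dims {V U w h wc hc : ℝ} {A B : Finset ι} (hN : Nest D V U w h A B wc hc) :
    0 ≤ V ∧ 0 ≤ U ∧ 0 ≤ wc ∧ 0 ≤ hc ∧ w = V + wc ∧ h = U + hc := by
  induction hN with
  | nil hw hh => exact ⟨le_rfl, le_rfl, hw, hh, by ring, by ring⟩
  | vs hX _ hV hw hA ih =>
    obtain ⟨a, b, c, d, e, f⟩ := ih
    exact ⟨by linarith [hX.nonneg.1], b, c, d, by linarith, f⟩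
  | hs hX _ hV hw hA ih => 
    obtain ⟨a, b, c, d, e, f⟩ := ih
    exact ⟨a, by linarith [hX.nonneg.2], c, d, e, by linarith⟩

/-- adding an innermost vertical slab -/
theorem Nest.snocv {V U w h wc hc wc' l : ℝ} {A B X : Finset ι} (hN : Nest D V U w h A B wc hc) :
    Pk D l hc X → wc = l + wc' → 0 ≤ wc' → Nest D (V + l) U w h (A ∪ X) B wc' hc := by
  induction hN with
  | @nil w h hw hh =>
    intro hX hl hw'
    exact Nest.vs hX (Nest.nil hw' hh) (by ring) hl (by simp)
  | vs hX _ hV hw hA ih =>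
    intro hY hl hw'
    refine Nest.vs hX (ih hY hl hw') (by rw [hV]; ring) hw (by rw [hA, Finset.union_assoc])
  | hs hX _ hV hw hA ih => 
    intro hY hl hw'
    exact Nest.hs hX (ih hY hl hw') hV hw hA

theorem Nest.toPk {V U w h wc hc : ℝ} {A B C : Finset ι} (hN : Nest D V U w h A B wc hc) :
    Pk D wc hc C → Pk D w h (A ∪ B ∪ C) := by
  induction hN with
  | nil hw hh => intro h; simpa using h
  | vs hX _ hV hw hA ih =>
    intro h
    refine Pk.vcut hX (ih h) hw.ge ?_
    subst hA; intro i; simp only [Finset.mem_union]; tauto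
  | hs hX _ hV hw hA ih => 
    intro h
    refine Pk.hcut hX (ih h) hw.ge ?_
    subst hA; intro i; simp only [Finset.mem_union]; tauto

/-- wrap the ring of a nest around a tree -/
theorem Nest.wrap {V U w h wc hc : ℝ} {A B : Finset ι} (hN : Nest D V U w h A B wc hc) {n : ℕ}
    {Q G : Finset ι} : PkO D ε K n wc hc Q G → PkO D ε K n w h Q (A ∪ B ∪ G) := by
  induction hN with
  | nil hw hh => intro h; simpa using h
  | vs hX _ hV hw hA ih =>
    intro h
    refine PkO.vcut hX.toO (ih h) hw.ge (by simp) ?_ (by simp)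
    subst hA; intro i; simp only [Finset.mem_union]; tauto
  | hs hX _ hV hw hA ih => 
    intro h
    refine PkO.hcut hX.toO (ih h) hw.ge (by simp) ?_ (by simp)
    subst hA; intro i; simp only [Finset.mem_union]; tauto

theorem area_cover {S S1 S2 : Finset ι} (h : S ⊆ S1 ∪ S2) :
    ∑ i ∈ S, D.w i * D.h i ≤ ∑ i ∈ S1, D.w i * D.h i + ∑ i ∈ S2, D.w i * D.h i :=
  sum_cover_le (f := fun i => D.w i * D.h i) (fun i => mul_nonneg (D.w0 i) (D.h0 i)) h

theorem Pk.area_le' {w h : ℝ} {S : Finset ι} (hp : Pk D w h S) (hh : h ≤ 1) :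
    ∑ i ∈ S, D.w i * D.h i ≤ w := by
  have := hp.area_le
  nlinarith [hp.nonneg.1]

theorem Pk.area_le'' {w h : ℝ} {S : Finset ι} (hp : Pk D w h S) (hh : w ≤ 1) :
    ∑ i ∈ S, D.w i * D.h i ≤ h := by
  have := hp.area_le
  nlinarith [hp.nonneg.2]

theorem Nest.ring_area {V U w h wc hc : ℝ} {A B : Finset ι} (hN : Nest D V U w h A B wc hc) :
    w ≤ 1 → h ≤ 1 → ∑ i ∈ A ∪ B, D.w i * D.h i ≤ V + U := by
  induction hN with
  | nil hw hh => intro _ _; simp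
  | @vs V V' U w h w' wc hc l A B X A' hX hN hV hw hA ih =>
    intro h1 h2
    have := ih (by linarith [hX.nonneg.1]) h2
    have h3 := hX.area_le' h2
    subst hA
    have := area_cover (D := D) (S := X ∪ A' ∪ B) (S1 := X) (S2 := A' ∪ B) (by
      intro i; simp only [Finset.mem_union]; tauto)
    linarith
  | @hs V U U' w h h' wc hc l A B X B' hX hN hV hw hA ih => 
    intro h1 h2
    have := ih h1 (by linarith [hX.nonneg.2])
    have h3 := hX.area_le'' h1
    subst hA
    have := area_cover (D := D) (S := A ∪ (X ∪ B')) (S1 := X) (S2 := A ∪ B') (by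
      intro i; simp only [Finset.mem_union]; tauto)
    linarith

theorem set_a {F B C Q G X : Finset ι} (h : F ∪ B ∪ C ⊆ Q ∪ G) :
    F ∪ (X ∪ B) ∪ C ⊆ Q ∪ (X ∪ G) := by
  intro i hi
  have := @h i
  simp only [Finset.mem_union] at this hi ⊢
  tauto

theorem set_b {A B C Q G X Y : Finset ι} (h : Q ∪ G ⊆ A ∪ B ∪ C) (hY : Y ⊆ X) :
    Q ∪ (Y ∪ G) ⊆ A ∪ (X ∪ B) ∪ C := by
  intro i hi
  have h1 := @h i
  have h2 := @hY i
  simp only [Finset.mem_union] at h1 h2 hi ⊢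
  tauto

theorem set_c {A B C Q G X Y : Finset ι} (h : Q ∪ G ⊆ A ∪ B ∪ C) (hY : Y ⊆ X) :
    Q ∪ (Y ∪ G) ⊆ (X ∪ A) ∪ B ∪ C := by
  intro i hi
  have h1 := @h i
  have h2 := @hY i
  simp only [Finset.mem_union] at h1 h2 hi ⊢
  tauto

theorem set_d {F F' B C Q G Y : Finset ι} (h : F ∪ B ∪ C ⊆ Q ∪ G) (hF : F' ⊆ Y ∪ F) :
    F' ∪ B ∪ C ⊆ Q ∪ (Y ∪ G) := by
  intro i hi
  have h1 := @h i
  have h2 := @hF i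
  simp only [Finset.mem_union] at h1 h2 hi ⊢
  tauto

theorem Nest.win {V U w h wc hc : ℝ} {A B C : Finset ι} (hN : Nest D V U w h A B wc hc)
    (hC : Pk D wc hc C) : w ≤ 1 → h ≤ 1 → ∃ a : ι → ℝ, (∀ i ∈ A, 0 ≤ a i) ∧
      ∀ x η t : ℝ, 0 ≤ x → 0 ≤ η → 0 ≤ t →
      x + η ≤ V → ∃ (Q G : Finset ι) (WQ HQ : ℝ),
        (A.filter (fun i => a i + D.w i ≤ x ∨ x + η ≤ a i)) ∪ B ∪ C ⊆ Q ∪ G ∧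
        Q ∪ G ⊆ A ∪ B ∪ C ∧
        Pk D (WQ - t - η) HQ Q ∧ WQ ≤ w + t ∧ 
        ∑ i ∈ G, D.w i * D.h i ≤ x + U ∧
        ∀ Q', Ct D ε NoM K WQ HQ Q' → PkO D ε K 1 (w + t) h Q' G := by
  induction hN with
  | @nil w h hw hh =>
    intro h1 h2
    refine ⟨fun _ => 0, by simp, fun x η t hx hη ht hxη => ?_⟩
    have : x = 0 := by linarith
    have : η = 0 := by linarith
    subst x; subst η
    exact ⟨C, ∅, w + t, h, by simp, by simp, by simpa using hC, le_rfl, by simp,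
      fun Q' hQ' => PkO.sol le_rfl hQ' rfl⟩
  | @hs V U U' w h h' wc hc l A B X B' hX hN hV hw hA ih => 
    intro h1 h2
    obtain ⟨a, ha0, ha⟩ := ih hC h1 (by linarith [hX.nonneg.2])
    refine ⟨a, ha0, fun x η t hx hη ht hxη => ?_⟩
    obtain ⟨Q, G, WQ, HQ, q1, q1', q2, q3, q5, q6⟩ := ha x η t hx hη ht hxη
    refine ⟨Q, X ∪ G, WQ, HQ, ?_, ?_, q2, q3, ?_, ?_⟩
    · rw [hA]; exact set_a q1
    · rw [hA]; exact set_b q1' subset_rfl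
    · have h3 := hX.area_le'' h1
      have := area_cover (D := D) (subset_refl (X ∪ G))
      linarith
    · intro Q' hQ'
      exact PkO.hcut (hX.mono (by linarith) le_rfl).toO (q6 Q' hQ') hw.ge (by simp) subset_rfl (by simp)
  | @vs V V' U w h w' wc hc l A B X A' hX hN hV hw hA ih =>
    intro h1 h2
    obtain ⟨a, ha0, ha⟩ := ih hC (by linarith [hX.nonneg.1]) h2
    obtain ⟨c, hc1, hc2⟩ := hX.strip
    have hU : 0 ≤ U := hN.dims.2.1
    have hin := hN.toPk hC
    have hl := hX.nonneg.1
    have hh0 := hX.nonneg.2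
    refine ⟨fun i => if i ∈ X then c i else l + a i, ?_, fun x η t hx hη ht hxη => ?_⟩
    · intro i hi
      by_cases hiX : i ∈ X
      · simp only [if_pos hiX]; exact (hc1 i hiX).1
      · simp only [if_neg hiX]
        rw [hA, Finset.mem_union] at hi
        linarith [ha0 i (hi.resolve_left hiX)]
    have mem : ∀ i, (i ∈ A.filter (fun i => (if i ∈ X then c i else l + a i) + D.w i ≤ x ∨
        x + η ≤ (if i ∈ X then c i else l + a i))) →
        (i ∈ X ∧ (c i + D.w i ≤ x ∨ x + η ≤ c i)) ∨
        (i ∈ A' ∧ i ∉ X ∧ (l + a i + D.w i ≤ x ∨ x + η ≤ l + a i)) := by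
      intro i hi
      rw [Finset.mem_filter, hA, Finset.mem_union] at hi
      by_cases hiX : i ∈ X
      · rw [if_pos hiX] at hi; exact Or.inl ⟨hiX, hi.2⟩
      · rw [if_neg hiX] at hi; exact Or.inr ⟨hi.1.resolve_left hiX, hiX, hi.2⟩
    by_cases hxl : l ≤ x
    · obtain ⟨Q, G, WQ, HQ, q1, q1', q2, q3, q5, q6⟩ := ha (x - l) η t (by linarith) hη ht (by linarith)
      refine ⟨Q, X ∪ G, WQ, HQ, set_d q1 ?_, ?_, q2, by linarith, ?_, ?_⟩
      · intro i hi
        rcases mem i hi with h6 | ⟨h6, h7, h8⟩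
        · exact Finset.mem_union_left _ h6.1
        · exact Finset.mem_union_right _ (Finset.mem_filter.2 ⟨h6, h8.imp (fun h => by linarith) (fun h => by linarith)⟩)
      · rw [hA]; exact set_c q1' subset_rfl
      · have h3 := hX.area_le' h2
        have := area_cover (D := D) (subset_refl (X ∪ G))
        linarith
      · intro Q' hQ'
        exact PkO.vcut hX.toO (q6 Q' hQ') (by linarith) (by simp) subset_rfl (by simp)
    push Not at hxl
    have g1 := hc2 x (l - x) hx (by linarith) (by linarith)
    rw [sub_sub_cancel] at g1
    have g1' : Pk D x h (X.filter (fun i => c i + D.w i ≤ x)) := by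
      refine g1.subset ?_
      intro i hi
      rw [Finset.mem_filter] at hi ⊢
      exact ⟨hi.1, Or.inl hi.2⟩
    have garea := g1'.area_le' h2
    by_cases hxe : x + η ≤ l
    · have g2 := hc2 0 (x + η) le_rfl (by linarith) (by linarith)
      have g2' : Pk D (l - (x + η)) h (X.filter (fun i => x + η ≤ c i)) := by
        refine g2.subset ?_
        intro i hi
        rw [Finset.mem_filter] at hi ⊢
        exact ⟨hi.1, Or.inr (by linarith [hi.2])⟩
      refine ⟨(X.filter (fun i => x + η ≤ c i)) ∪ (A' ∪ B ∪ C), X.filter (fun i => c i + D.w i ≤ x),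
        w + t - x, h, ?_, ?_, Pk.vcut g2' hin (by linarith) subset_rfl, by linarith, by linarith, ?_⟩
      · intro i hi
        rw [Finset.mem_union, Finset.mem_union] at hi
        simp only [Finset.mem_union, Finset.mem_filter]
        rcases hi with (hi | hi) | hi
        · rcases mem i hi with ⟨h6, h7 | h7⟩ | ⟨h6, h7, h8⟩
          · exact Or.inr ⟨h6, h7⟩
          · exact Or.inl (Or.inl ⟨h6, h7⟩)
          · exact Or.inl (Or.inr (Or.inl (Or.inl h6)))
        · exact Or.inl (Or.inr (Or.inl (Or.inr hi)))
        · exact Or.inl (Or.inr (Or.inr hi))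
      · rw [hA]
        intro i hi
        simp only [Finset.mem_union, Finset.mem_filter] at hi ⊢
        rcases hi with (hi | (hi | hi) | hi) | hi
        · exact Or.inl (Or.inl (Or.inl hi.1))
        · exact Or.inl (Or.inl (Or.inr hi))
        · exact Or.inl (Or.inr hi)
        · exact Or.inr hi
        · exact Or.inl (Or.inl (Or.inl hi.1))
      · intro Q' hQ'
        exact PkO.vcut g1'.toO (PkO.sol le_rfl hQ' rfl) (by linarith) (by simp) (by simp) (by simp)
    · push Not at hxe
      obtain ⟨Q, G, WQ, HQ, q1, q1', q2, q3, q5, q6⟩ := ha 0 (x + η - l) (t + (l - x)) le_rfl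
        (by linarith) (by linarith) (by linarith)
      refine ⟨Q, X.filter (fun i => c i + D.w i ≤ x) ∪ G, WQ, HQ, set_d q1 ?_, ?_, ?_, by linarith, ?_, ?_⟩
      · intro i hi
        rcases mem i hi with h6 | ⟨h6, h7, h8⟩
        · have := (hc1 i h6.1).2
          have := D.wpos i
          exact Finset.mem_union_left _ (Finset.mem_filter.2 ⟨h6.1, h6.2.resolve_right (by linarith)⟩)
        · have h9 : x + η ≤ l + a i := by
            rcases h8 with h8 | h8
            · linarith [D.wpos i, ha0 i h6]
            · exact h8
          exact Finset.mem_union_right _ (Finset.mem_filter.2 ⟨h6, Or.inr (by linarith)⟩)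
      · rw [hA]; exact set_c q1' (Finset.filter_subset _ _)
      · refine q2.mono (by linarith) le_rfl
      · have := area_cover (D := D) (subset_refl (X.filter (fun i => c i + D.w i ≤ x) ∪ G))
        linarith
      · intro Q' hQ'
        have h7 := q6 Q' hQ'
        exact PkO.vcut g1'.toO h7 (by linarith) (by simp) subset_rfl (by simp)

end

/-- the outcome of Lemma T -/
def TRes {ι : Type} [DecidableEq ι] (D : Dims ι) (ε : ℝ) (K : ℕ) (ρ vb : ℝ) (p : ι → ℝ) (W H : ℝ)
    (S : Finset ι) : Prop :=
  ∃ (n : ℕ) (Q G : Finset ι), 1 ≤ n ∧ Q ∪ G ⊆ S ∧ PkO D ε K n W H Q G ∧ n * ρ ^ 2 ≤ W * H ∧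
    ∑ i ∈ G, D.w i * D.h i ≤ (2 * n - 1) * (2 * vb) ∧
    ∑ i ∈ S \ (Q ∪ G), p i ≤ 3 * ε * ∑ i ∈ S, p i

def TBand {ι : Type} (D : Dims ι) (τ ρ : ℝ) (i : ι) : Prop :=
  (D.w i ≤ τ ∨ ρ < D.w i) ∧ (D.h i ≤ τ ∨ ρ < D.h i)

def TGood {ι : Type} [DecidableEq ι] (D : Dims ι) (ε : ℝ) (K : ℕ) (τ ρ vb : ℝ) (p : ι → ℝ) (w h : ℝ)
    (S : Finset ι) : Prop :=
  ∀ T ⊆ S, (∀ i ∈ T, TBand D τ ρ i) → ∀ (wc hc V U W H : ℝ) (A B : Finset ι), w ≤ wc → h ≤ hc →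
    ρ < wc → ρ < hc → Nest D V U W H A B wc hc → V < vb → U < vb → W ≤ 1 → H ≤ 1 →
    (∀ i ∈ A, D.w i ≤ τ) → (∀ i ∈ B, D.h i ≤ τ) → TRes D ε K ρ vb p W H (A ∪ B ∪ T)

section
variable {ι : Type} [DecidableEq ι] {D : Dims ι} {ε : ℝ} {K : ℕ} {τ ρ vb : ℝ} {p : ι → ℝ}

theorem TRes.tr {W H : ℝ} {S : Finset ι} (h : TRes D ε K ρ vb p W H S) :
    TRes D.T ε K ρ vb p H W S := by
  obtain ⟨n, Q, G, h1, h2, h3, h4, h5, h6⟩ := h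
  refine ⟨n, Q, G, h1, h2, h3.tr, by rw [mul_comm H W]; exact h4, ?_, h6⟩
  calc ∑ i ∈ G, D.T.w i * D.T.h i = ∑ i ∈ G, D.w i * D.h i := by
        refine Finset.sum_congr rfl (fun i _ => ?_); exact mul_comm _ _
    _ ≤ _ := h5

theorem TGood.tr {w h : ℝ} {S : Finset ι} (hg : TGood D ε K τ ρ vb p w h S) :
    TGood D.T ε K τ ρ vb p h w S := by
  intro T hT hb wc hc V U W H A B h1 h2 h3 h4 hN hV hU hW hH hA hB
  have := (hg T hT (fun i hi => ⟨(hb i hi).2, (hb i hi).1⟩) hc wc U V H W B A h2 h1 h4 h3 hN.tr hU hV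
    hH hW hB hA).tr
  rwa [Finset.union_comm B A] at this

theorem nest_wh (hρ : 0 ≤ ρ) {V U w h wc hc : ℝ} {A B : Finset ι} (hN : Nest D V U w h A B wc hc)
    (h1 : ρ ≤ wc) (h2 : ρ ≤ hc) : ρ ^ 2 ≤ w * h ∧ wc * hc ≤ w * h ∧ wc ≤ w ∧ hc ≤ h := by
  obtain ⟨a, b, c, d, e, f⟩ := hN.dims
  have h3 : wc ≤ w := by linarith
  have h4 : hc ≤ h := by linarith
  refine ⟨?_, mul_le_mul h3 h4 d (by linarith), h3, h4⟩
  rw [pow_two]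
  exact mul_le_mul (h1.trans h3) (h2.trans h4) hρ (by linarith)

theorem ra_shrink {τ x : ℝ} (hτ : 0 ≤ τ) (hx : x ≤ 1) : (1 + τ) * (x - τ) ≤ x := by nlinarith

theorem Ttrigger (hε : 0 < ε) (hp : ∀ i, 0 ≤ p i) (hτ : 0 < τ) (hK : RAProp ε τ K)
    (hvb : 2 * (⌈1 / ε⌉₊ : ℝ) * τ ≤ vb)
    {V U W H wc hc : ℝ} {A B C S : Finset ι} (hN : Nest D V U W H A B wc hc) (hC : Pk D wc hc C)
    (hV : vb ≤ V) (hU : U < vb) (hW : W ≤ 1) (hH : H ≤ 1) (hA : ∀ i ∈ A, D.w i ≤ τ)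
    (hwh : ρ ^ 2 ≤ W * H) (hS : S = A ∪ B ∪ C) : TRes D ε K ρ vb p W H S := by
  obtain ⟨a, ha0, ha⟩ := hN.win (ε := ε) (K := K) hC hW hH
  have hn : 0 < ⌈1 / ε⌉₊ := Nat.ceil_pos.2 (by positivity)
  obtain ⟨j, hj, hj'⟩ := window p hp A a D.w ⌈1 / ε⌉₊ hn 0 (2 * τ) τ
    (fun i hi => by linarith [hA i hi]) (by linarith)
  rw [zero_add] at hj'
  have hjn : (j : ℝ) + 1 ≤ ⌈1 / ε⌉₊ := by exact_mod_cast hj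
  have hx1 : (j : ℝ) * (2 * τ) + 2 * τ ≤ vb := by
    calc (j : ℝ) * (2 * τ) + 2 * τ = ((j : ℝ) + 1) * (2 * τ) := by ring
      _ ≤ ⌈1 / ε⌉₊ * (2 * τ) := by gcongr
      _ ≤ vb := by linarith
  have hx0 : 0 ≤ (j : ℝ) * (2 * τ) := by positivity
  obtain ⟨Q, G, WQ, HQ, q1, q2, q3, q4, q5, q6⟩ := ha (j * (2 * τ)) τ 0 hx0 hτ.le le_rfl (by linarith)
  set F := A.filter (fun i => a i + D.w i ≤ j * (2 * τ) ∨ j * (2 * τ) + τ ≤ a i) with hF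
  have hnε : 1 ≤ ε * ⌈1 / ε⌉₊ := by
    have := Nat.le_ceil (1 / ε)
    rw [div_le_iff₀ hε] at this
    linarith
  have hlossA : ∑ i ∈ A \ F, p i ≤ ε * ∑ i ∈ A, p i := by
    have h0 : 0 ≤ ∑ i ∈ A \ F, p i := Finset.sum_nonneg (fun i _ => hp i)
    calc ∑ i ∈ A \ F, p i ≤ (ε * ⌈1 / ε⌉₊) * ∑ i ∈ A \ F, p i := le_mul_of_one_le_left h0 hnε
      _ = ε * (⌈1 / ε⌉₊ * ∑ i ∈ A \ F, p i) := by ring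
      _ ≤ ε * ∑ i ∈ A, p i := by gcongr
  rw [sub_zero] at q3
  obtain ⟨Q', hQ', hl, -, hct⟩ := hK ι D.T p Q HQ (WQ - τ) hp q3.tr
  have hct' : Ct D ε NoM K WQ HQ Q' :=
    (hct.noM.mono hε.le le_rfl le_rfl (ra_shrink hτ.le (by linarith))).tr
  have hO := q6 Q' hct'
  rw [add_zero] at hO
  have hAS : A ⊆ S := by rw [hS]; exact Finset.subset_union_left.trans Finset.subset_union_left
  have hQS : Q ⊆ S := by rw [hS]; exact Finset.subset_union_left.trans q2
  refine ⟨1, Q', G, le_rfl, ?_, hO, by simpa using hwh, ?_, ?_⟩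
  · rw [hS]; exact (Finset.union_subset_union hQ' subset_rfl).trans q2
  · push_cast; linarith
  · have hsub : S \ (Q' ∪ G) ⊆ (A \ F) ∪ (Q \ Q') := by
      intro i hi
      have h1 := @q1 i
      rw [hS] at hi
      simp only [Finset.mem_sdiff, Finset.mem_union] at hi h1 ⊢
      clear hO hct' hct hl hlossA hjn hx1 hx0 hnε q3 q4 q5 q6 hj' ha0 ha hN hC
      tauto
    have h1 := sum_cover_le (f := p) hp hsub
    have h2 := sum_mono_set (f := p) hp hAS
    have h3 := sum_mono_set (f := p) hp hQS
    have h4 := mul_le_mul_of_nonneg_left h2 hε.le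
    have h5 := mul_le_mul_of_nonneg_left h3 hε.le
    linarith

theorem Tset1 {A B T S1 : Finset ι} : A ∪ B ∪ T = (A ∪ T ∩ S1) ∪ B ∪ T \ S1 := by
  ext i; simp only [Finset.mem_union, Finset.mem_inter, Finset.mem_sdiff]; tauto

theorem Tset2 {A B T S1 : Finset ι} : A ∪ B ∪ T = (A ∪ T \ S1) ∪ B ∪ T ∩ S1 := by
  ext i; simp only [Finset.mem_union, Finset.mem_inter, Finset.mem_sdiff]; tauto

theorem Tleaf (hε : 0 ≤ ε) (hp : ∀ i, 0 ≤ p i) (hρ : 0 ≤ ρ) (hK : 1 ≤ K) {w h : ℝ} {S : Finset ι}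
    (hS : S.card ≤ 1) (hd : ∀ i ∈ S, D.w i ≤ w ∧ D.h i ≤ h) : TGood D ε K τ ρ vb p w h S := by
  intro T hT hb wc hc V U W H A B h1 h2 h3 h4 hN hV hU hW hH hA hB
  have hc0 := hN.dims
  have hct : Ct D ε NoM K wc hc T := by
    refine Ct.vstack hK hc0.2.2.1 hc0.2.2.2.1 (fun i hi => (hd i (hT hi)).2.trans h2) ?_
    rcases T.eq_empty_or_nonempty with rfl | ⟨x, hx⟩
    · simpa using hc0.2.2.1
    · have : T = {x} := by
        refine Finset.eq_singleton_iff_unique_mem.2 ⟨hx, fun y hy => ?_⟩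
        exact Finset.card_le_one.1 hS y (hT hy) x (hT hx)
      rw [this, Finset.sum_singleton]
      exact (hd x (hT hx)).1.trans h1
  refine ⟨1, T, A ∪ B ∪ ∅, le_rfl, ?_, hN.wrap (PkO.sol le_rfl hct rfl), ?_, ?_, ?_⟩
  · intro i; simp only [Finset.mem_union, Finset.notMem_empty]; tauto
  · have := (nest_wh hρ hN h3.le h4.le).1
    simpa using this
  · have := hN.ring_area hW hH
    rw [Finset.union_empty]; push_cast; linarith
  · have : (A ∪ B ∪ T) \ (T ∪ (A ∪ B ∪ ∅)) = ∅ := by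
      ext i; simp only [Finset.mem_sdiff, Finset.mem_union, Finset.notMem_empty]; tauto
    rw [this, Finset.sum_empty]
    exact mul_nonneg (by linarith) (Finset.sum_nonneg (fun i _ => hp i))

theorem Tset3 {A B T S1 Q1 Q2 G1 G2 : Finset ι} (h1 : Q1 ∪ G1 ⊆ ∅ ∪ ∅ ∪ T ∩ S1)
    (h2 : Q2 ∪ G2 ⊆ ∅ ∪ ∅ ∪ T \ S1) : (Q1 ∪ Q2) ∪ (A ∪ B ∪ (G1 ∪ G2)) ⊆ A ∪ B ∪ T := by
  intro i
  have h3 := @h1 i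
  have h4 := @h2 i
  simp only [Finset.mem_union, Finset.mem_inter, Finset.mem_sdiff, Finset.notMem_empty] at *
  tauto

theorem Tset4 {A B T S1 Q1 Q2 G1 G2 : Finset ι} :
    (A ∪ B ∪ T) \ ((Q1 ∪ Q2) ∪ (A ∪ B ∪ (G1 ∪ G2))) ⊆
      (∅ ∪ ∅ ∪ T ∩ S1) \ (Q1 ∪ G1) ∪ (∅ ∪ ∅ ∪ T \ S1) \ (Q2 ∪ G2) := by
  intro i
  simp only [Finset.mem_union, Finset.mem_inter, Finset.mem_sdiff, Finset.notMem_empty] at *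
  tauto

theorem sum_split (T S1 : Finset ι) (f : ι → ℝ) :
    ∑ i ∈ T, f i = ∑ i ∈ T ∩ S1, f i + ∑ i ∈ T \ S1, f i := (Finset.sum_inter_add_sum_sdiff T S1 f).symm

theorem TgoodV (hε : 0 < ε) (hp : ∀ i, 0 ≤ p i) (hτ : 0 < τ) (hτρ : τ < ρ) (hK : RAProp ε τ K)
    (hvb : 2 * (⌈1 / ε⌉₊ : ℝ) * τ ≤ vb) (hvρ : vb ≤ ρ / 2) {w h w1 w2 : ℝ} {S S1 S2 : Finset ι}
    (p1 : Pk D w1 h S1) (p2 : Pk D w2 h S2) (hw : w1 + w2 ≤ w) (hS : S ⊆ S1 ∪ S2)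
    (g1 : TGood D ε K τ ρ vb p w1 h S1) (g2 : TGood D ε K τ ρ vb p w2 h S2) :
    TGood D ε K τ ρ vb p w h S := by
  intro T hT hb wc hc V U W H A B h1 h2 h3 h4 hN hV hU hW hH hA hB
  have hρ : 0 < ρ := hτ.trans hτρ
  obtain ⟨hwh, hwh2, hwc, hhc⟩ := nest_wh hρ.le hN h3.le h4.le
  have hT1 : T ∩ S1 ⊆ S1 := Finset.inter_subset_right
  have hT2 : T \ S1 ⊆ S2 := by
    intro i hi
    rw [Finset.mem_sdiff] at hi
    exact (Finset.mem_union.1 (hS (hT hi.1))).resolve_left hi.2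
  have b1 : ∀ i ∈ T ∩ S1, TBand D τ ρ i := fun i hi => hb i (Finset.mem_inter.1 hi).1
  have b2 : ∀ i ∈ T \ S1, TBand D τ ρ i := fun i hi => hb i (Finset.mem_sdiff.1 hi).1
  have n1 := p1.nonneg
  have n2 := p2.nonneg
  have q1 : Pk D w1 hc (T ∩ S1) := (p1.subset hT1).mono le_rfl h2
  have q2 : Pk D (wc - w1) hc (T \ S1) := (p2.subset hT2).mono (by linarith) h2
  have Nest1 := hN.snocv (l := w1) (wc' := wc - w1) q1 (by ring) (by linarith)
  have Nest2 := hN.snocv (l := wc - w1) (wc' := w1) q2 (by ring) n1.1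
  have vbn : 0 ≤ vb := by linarith [hN.dims.1]
  have A1 : w1 ≤ ρ → ∀ i ∈ A ∪ T ∩ S1, D.w i ≤ τ := by
    intro hle i hi
    rcases Finset.mem_union.1 hi with hi | hi
    · exact hA i hi
    · rcases (b1 i hi).1 with h | h
      · exact h
      · linarith [(q1.dim_le i hi).1]
  have A2 : wc - w1 ≤ ρ → ∀ i ∈ A ∪ T \ S1, D.w i ≤ τ := by
    intro hle i hi
    rcases Finset.mem_union.1 hi with hi | hi
    · exact hA i hi
    · rcases (b2 i hi).1 with h | h
      · exact h
      · linarith [(q2.dim_le i hi).1]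
  by_cases c1 : w1 ≤ ρ
  · by_cases c2 : vb ≤ V + w1
    · exact Ttrigger hε hp hτ hK hvb Nest1 q2 c2 hU hW hH (A1 c1) hwh Tset1
    by_cases c3 : wc - w1 ≤ ρ
    · exact Ttrigger hε hp hτ hK hvb Nest2 q1 (by linarith [hN.dims.1]) hU hW hH (A2 c3) hwh Tset2
    · push Not at c2 c3
      rw [Tset1 (S1 := S1)]
      exact g2 _ hT2 b2 _ _ _ _ _ _ _ _ (by linarith) h2 c3 h4 Nest1 c2 hU hW hH (A1 c1) hB
  · by_cases c3 : wc - w1 ≤ ρ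
    · by_cases c2 : vb ≤ V + (wc - w1)
      · exact Ttrigger hε hp hτ hK hvb Nest2 q1 c2 hU hW hH (A2 c3) hwh Tset2
      · push Not at c2 c1
        rw [Tset2 (S1 := S1)]
        exact g1 _ hT1 b1 _ _ _ _ _ _ _ _ le_rfl h2 c1 h4 Nest2 c2 hU hW hH (A2 c3) hB
    · push Not at c1 c3
      by_cases hv0 : vb ≤ 0
      · linarith [hN.dims.1]
      push Not at hv0
      obtain ⟨m1, Q1, G1, r1, r2, r3, r4, r5, r6⟩ := g1 _ hT1 b1 w1 hc 0 0 w1 hc ∅ ∅ le_rfl h2 c1 h4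
        (Nest.nil n1.1 (by linarith)) hv0 hv0 (by linarith) (by linarith) (by simp) (by simp)
      obtain ⟨m2, Q2, G2, s1, s2, s3, s4, s5, s6⟩ := g2 _ hT2 b2 (wc - w1) hc 0 0 (wc - w1) hc ∅ ∅
        (by linarith) h2 c3 h4
        (Nest.nil (by linarith) (by linarith)) hv0 hv0 (by linarith) (by linarith) (by simp) (by simp)
      refine ⟨m1 + m2, Q1 ∪ Q2, A ∪ B ∪ (G1 ∪ G2), by omega, Tset3 r2 s2,
        hN.wrap (PkO.vcut r3 s3 (by linarith) subset_rfl subset_rfl le_rfl), ?_, ?_, ?_⟩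
      · push_cast
        have : w1 * hc + (wc - w1) * hc = wc * hc := by ring
        linarith [add_mul (m1 : ℝ) m2 (ρ ^ 2)]
      · have e1 := hN.ring_area hW hH
        have e2 := area_cover (D := D) (subset_refl (A ∪ B ∪ (G1 ∪ G2)))
        have e3 := area_cover (D := D) (subset_refl (G1 ∪ G2))
        push_cast
        linarith
      · have e1 := sum_cover_le (f := p) hp (Tset4 (A := A) (B := B) (T := T) (S1 := S1) (Q1 := Q1)
          (Q2 := Q2) (G1 := G1) (G2 := G2))
        have e2 := sum_mono_set (f := p) hp (Finset.subset_union_right : T ⊆ A ∪ B ∪ T)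
        have e3 := sum_split T S1 p
        simp only [Finset.empty_union] at r6 s6 e1
        have e4 := mul_le_mul_of_nonneg_left e2 hε.le
        have e5 : ε * ∑ i ∈ T, p i = ε * ∑ i ∈ T ∩ S1, p i + ε * ∑ i ∈ T \ S1, p i := by
          rw [e3]; ring
        linarith

theorem Tgood (hε : 0 < ε) (hp : ∀ i, 0 ≤ p i) (hτ : 0 < τ) (hτρ : τ < ρ) (hK : RAProp ε τ K)
    (hK1 : 1 ≤ K)
    (hvb : 2 * (⌈1 / ε⌉₊ : ℝ) * τ ≤ vb) (hvρ : vb ≤ ρ / 2) {w h : ℝ} {S : Finset ι}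
    (hP : Pk D w h S) : TGood D ε K τ ρ vb p w h S := by
  induction hP with
  | leaf h1 h2 h3 h4 => exact Tleaf hε.le hp (hτ.trans hτρ).le hK1 h3 h4
  | vcut p1 p2 hw hS i1 i2 => exact TgoodV hε hp hτ hτρ hK hvb hvρ p1 p2 hw hS i1 i2
  | hcut p1 p2 hw hS i1 i2 =>
    exact (TgoodV hε hp hτ hτρ hK hvb hvρ p1.tr p2.tr hw hS i1.tr i2.tr).tr

end

theorem LemT_level (ε ξ ρ : ℝ) (hε : 0 < ε) (hε1 : ε ≤ 1 / 2) (hξ : 0 < ξ) (hξ1 : ξ ≤ 1) (hρ : 0 < ρ) (hρ1 : ρ < 1) :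
    ∃ (τ : ℝ) (K n : ℕ), 0 < τ ∧ τ < ρ ∧ ∀ (ι : Type) [DecidableEq ι] (D : Dims ι) (p : ι → ℝ) (S : Finset ι),
      (∀ i, 0 ≤ p i) → Pk D 1 1 S → (∀ i ∈ S, TBand D τ ρ i) →
      ∃ Q G : Finset ι, Q ∪ G ⊆ S ∧ PkO D ε K n 1 1 Q G ∧ ∑ i ∈ G, D.w i * D.h i ≤ ξ ∧
        ∑ i ∈ S \ (Q ∪ G), p i ≤ 3 * ε * ∑ i ∈ S, p i := by
  set vb : ℝ := ξ * ρ ^ 2 / 4 with hvb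
  have hvb0 : 0 < vb := by positivity
  have hn : 0 < ⌈1 / ε⌉₊ := Nat.ceil_pos.2 (by positivity)
  have hn' : (1 : ℝ) ≤ ⌈1 / ε⌉₊ := by exact_mod_cast hn
  set τ : ℝ := vb / (4 * ⌈1 / ε⌉₊) with hτd
  have hτ0 : 0 < τ := by positivity
  have hτv : 2 * (⌈1 / ε⌉₊ : ℝ) * τ = vb / 2 := by rw [hτd]; field_simp; norm_num
  have hρ2 : ρ ^ 2 ≤ ρ := by nlinarith
  have hvρ : vb ≤ ρ / 2 := by
    have : ξ * ρ ^ 2 ≤ 1 * ρ := mul_le_mul hξ1 hρ2 (by positivity) (by norm_num)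
    rw [hvb]; linarith
  have hτρ : τ < ρ := by nlinarith
  obtain ⟨K, hK⟩ := RA ε τ hε hε1 hτ0 (by linarith)
  have hK' : RAProp ε τ (K + 1) := fun ι _ D p S W H h1 h2 =>
    (hK ι D p S W H h1 h2).mono hε.le (Nat.le_succ _) le_rfl le_rfl
  refine ⟨τ, K + 1, ⌈1 / ρ ^ 2⌉₊, hτ0, hτρ, ?_⟩
  intro ι _ D p S hp hP hb
  obtain ⟨n, Q, G, h1, h2, h3, h4, h5, h6⟩ := Tgood hε hp hτ0 hτρ hK' (by omega) (vb := vb) (by linarith) hvρ hP S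
    subset_rfl hb 1 1 0 0 1 1 ∅ ∅ le_rfl le_rfl hρ1 hρ1 (Nest.nil zero_le_one zero_le_one) hvb0 hvb0 le_rfl
    le_rfl (by simp) (by simp)
  simp only [Finset.empty_union] at h2 h6
  have hnρ : (n : ℝ) * ρ ^ 2 ≤ 1 := by simpa using h4
  refine ⟨Q, G, h2, h3.mono hε.le le_rfl ?_ le_rfl le_rfl, ?_, h6⟩
  · have : (n : ℝ) ≤ 1 / ρ ^ 2 := by rw [le_div_iff₀ (by positivity)]; exact hnρ
    exact_mod_cast this.trans (Nat.le_ceil _)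
  · calc ∑ i ∈ G, D.w i * D.h i ≤ (2 * n - 1) * (2 * vb) := h5
      _ ≤ 4 * n * vb := by nlinarith
      _ = ξ * (n * ρ ^ 2) := by rw [hvb]; ring
      _ ≤ ξ * 1 := by gcongr
      _ = ξ := mul_one _

theorem LemT (ε ξ : ℝ) (hε : 0 < ε) (hε1 : ε ≤ 1 / 2) (hξ : 0 < ξ) (hξ1 : ξ ≤ 1) :
    ∃ (K n : ℕ), ∀ (ι : Type) [DecidableEq ι] (D : Dims ι) (p : ι → ℝ) (S : Finset ι),
      (∀ i, 0 ≤ p i) → Pk D 1 1 S →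
      ∃ Q G : Finset ι, Q ⊆ S ∧ G ⊆ S ∧ Disjoint Q G ∧ PkO D ε K n 1 1 Q G ∧ ∑ i ∈ G, D.w i * D.h i ≤ ξ ∧
        ∑ i ∈ S \ (Q ∪ G), p i ≤ 5 * ε * ∑ i ∈ S, p i := by
  have H := fun ρ : {x : ℝ // 0 < x ∧ x < 1} => LemT_level ε ξ ρ.1 hε hε1 hξ hξ1 ρ.2.1 ρ.2.2
  choose t K n ht0 ht1 HT using H
  let ds : ℕ → {x : ℝ // 0 < x ∧ x < 1} := fun k => Nat.rec ⟨1 / 2, by norm_num, by norm_num⟩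
    (fun _ x => ⟨t x, ht0 x, (ht1 x).trans x.2.2⟩) k
  have hds : ∀ k, (ds (k + 1)).1 = t (ds k) := fun k => rfl
  have hdec : ∀ k, (ds (k + 1)).1 ≤ (ds k).1 := fun k => by rw [hds]; exact (ht1 _).le
  have han : Antitone (fun k => (ds k).1) := antitone_nat_of_succ_le hdec
  have hN : 0 < ⌈1 / ε⌉₊ := Nat.ceil_pos.2 (by positivity)
  refine ⟨∑ k ∈ Finset.range ⌈1 / ε⌉₊, K (ds k), ∑ k ∈ Finset.range ⌈1 / ε⌉₊, n (ds k), ?_⟩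
  intro ι _ D p S hp hP
  obtain ⟨j, hj, hl⟩ := pigeon p hp S ⌈1 / ε⌉₊ 2 hN
    (fun j => S.filter (fun i => ((ds (j + 1)).1 < D.w i ∧ D.w i ≤ (ds j).1) ∨
      ((ds (j + 1)).1 < D.h i ∧ D.h i ≤ (ds j).1))) (by
    intro i hi
    have aux : ∀ f : ℝ, ((Finset.range ⌈1 / ε⌉₊).filter (fun j => (ds (j + 1)).1 < f ∧ f ≤ (ds j).1)).card ≤ 1 := by
      intro f
      rw [Finset.card_le_one]
      intro a ha b hb
      rw [Finset.mem_filter] at ha hb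
      by_contra hne
      rcases lt_or_gt_of_ne hne with hlt | hlt
      · have := han (show a + 1 ≤ b by omega)
        simp only at this
        linarith [ha.2.1, hb.2.2]
      · have := han (show b + 1 ≤ a by omega)
        simp only at this
        linarith [hb.2.1, ha.2.2]
    refine (Finset.card_le_card (t := _ ∪ _) ?_).trans ((Finset.card_union_le _ _).trans
      (add_le_add (aux (D.w i)) (aux (D.h i))))
    intro j hj
    simp only [Finset.mem_filter, Finset.mem_union] at hj ⊢
    rcases hj.2.2 with h | h
    · exact Or.inl ⟨hj.1, h⟩
    · exact Or.inr ⟨hj.1, h⟩)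
  set R := S.filter (fun i => ((ds (j + 1)).1 < D.w i ∧ D.w i ≤ (ds j).1) ∨
      ((ds (j + 1)).1 < D.h i ∧ D.h i ≤ (ds j).1)) with hR
  have hRS : R ⊆ S := Finset.filter_subset _ _
  rw [Finset.inter_eq_right.2 hRS] at hl
  have hloss : ∑ i ∈ R, p i ≤ 2 * ε * ∑ i ∈ S, p i := by
    have hnε : 1 ≤ ε * ⌈1 / ε⌉₊ := by
      have := Nat.le_ceil (1 / ε)
      rw [div_le_iff₀ hε] at this
      linarith
    have h0 : 0 ≤ ∑ i ∈ R, p i := Finset.sum_nonneg (fun i _ => hp i)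
    calc ∑ i ∈ R, p i ≤ (ε * ⌈1 / ε⌉₊) * ∑ i ∈ R, p i := le_mul_of_one_le_left h0 hnε
      _ = ε * (⌈1 / ε⌉₊ * ∑ i ∈ R, p i) := by ring
      _ ≤ ε * ((2 : ℕ) * ∑ i ∈ S, p i) := by gcongr
      _ = _ := by push_cast; ring
  obtain ⟨Q, G, h1, h2, h3, h4⟩ := HT (ds j) ι D p (S \ R) hp (hP.subset Finset.sdiff_subset) (by
    intro i hi
    rw [Finset.mem_sdiff, hR, Finset.mem_filter] at hi
    have h5 := hi.2
    push Not at h5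
    have h6 := h5 hi.1
    refine ⟨?_, ?_⟩
    · by_contra hc
      push Not at hc
      exact absurd (h6.1 (by rw [hds]; exact hc.1)) (not_lt.2 hc.2)
    · by_contra hc
      push Not at hc
      exact absurd (h6.2 (by rw [hds]; exact hc.1)) (not_lt.2 hc.2))
  have hQ : Q ⊆ S := (Finset.subset_union_left.trans h1).trans Finset.sdiff_subset
  have hG : G ⊆ S := (Finset.subset_union_right.trans h1).trans Finset.sdiff_subset
  refine ⟨Q, G \ Q, hQ, Finset.sdiff_subset.trans hG, Finset.disjoint_sdiff, ?_, ?_, ?_⟩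
  · exact (h2.mono hε.le (le_sum_range (fun k => K (ds k)) _ j hj) (le_sum_range (fun k => n (ds k)) _ j hj)
      le_rfl le_rfl).subset subset_rfl Finset.sdiff_subset
  · exact (sum_mono_set (f := fun i => D.w i * D.h i) (fun i => mul_nonneg (D.w0 i) (D.h0 i))
      Finset.sdiff_subset).trans h3
  · have e1 : S \ (Q ∪ G \ Q) ⊆ R ∪ ((S \ R) \ (Q ∪ G)) := by
      intro i hi
      simp only [Finset.mem_sdiff, Finset.mem_union] at hi ⊢
      by_cases hiR : i ∈ R
      · exact Or.inl hiR
      · refine Or.inr ⟨⟨hi.1, hiR⟩, fun h => hi.2 ?_⟩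
        by_cases hiQ : i ∈ Q
        · exact Or.inl hiQ
        · exact Or.inr ⟨h.resolve_left hiQ, hiQ⟩
    have e2 := sum_cover_le (f := p) hp e1
    have e3 := sum_mono_set (f := p) hp (Finset.sdiff_subset : S \ R ⊆ S)
    have e4 := mul_le_mul_of_nonneg_left e3 hε.le
    linarith

section
variable {ι : Type} [DecidableEq ι] {D : Dims ι} {ε : ℝ} {K : ℕ}

theorem Nest.pkA {V U w h wc hc : ℝ} {A B : Finset ι} (hN : Nest D V U w h A B wc hc) :
    Pk D V h A := by
  induction hN with
  | nil hw hh => exact Pk.empty le_rfl hh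
  | vs hX hN hV hw hA ih => exact Pk.vcut hX ih hV.ge hA.subset
  | hs hX hN hV hw hA ih => exact ih.mono le_rfl (by linarith [hX.nonneg.2])

theorem Nest.pkB {V U w h wc hc : ℝ} {A B : Finset ι} (hN : Nest D V U w h A B wc hc) :
    Pk D w U B := hN.tr.pkA.tr

theorem Nest.subset {V U w h wc hc : ℝ} {A B : Finset ι} (hN : Nest D V U w h A B wc hc) :
    ∀ A1 ⊆ A, ∀ B1 ⊆ B, Nest D V U w h A1 B1 wc hc := by
  induction hN with
  | nil hw hh =>
    intro A1 h1 B1 h2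
    rw [Finset.subset_empty.1 h1, Finset.subset_empty.1 h2]
    exact Nest.nil hw hh
  | @vs V V' U w h w' wc hc l A B X A' hX hN hV hw hA ih =>
    intro A1 h1 B1 h2
    refine Nest.vs (hX.subset (Finset.inter_subset_right (s₁ := A1))) (ih (A1 ∩ A') Finset.inter_subset_right B1 h2) hV hw ?_
    rw [← Finset.inter_union_distrib_left, ← hA]
    exact (Finset.inter_eq_left.2 h1).symm
  | @hs V U U' w h h' wc hc l A B X B' hX hN hV hw hA ih => 
    intro A1 h1 B1 h2
    refine Nest.hs (hX.subset (Finset.inter_subset_right (s₁ := B1))) (ih A1 h1 (B1 ∩ B') Finset.inter_subset_right) hV hw ?_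
    rw [← Finset.inter_union_distrib_left, ← hA]
    exact (Finset.inter_eq_left.2 h2).symm

theorem Nest.congr {D' : Dims ι} {V U w h wc hc : ℝ} {A B : Finset ι} (hN : Nest D V U w h A B wc hc) :
    (∀ i ∈ A ∪ B, D'.w i = D.w i ∧ D'.h i = D.h i) → Nest D' V U w h A B wc hc := by
  induction hN with
  | nil hw hh => intro _; exact Nest.nil hw hh
  | @vs V V' U w h w' wc hc l A B X A' hX hN hV hw hA ih =>
    intro hD
    refine Nest.vs (hX.congr ?_) (ih ?_) hV hw hA
    · intro i hi; have := hD i (by rw [hA]; simp [hi]); exact ⟨this.1.le, this.2.le⟩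
    · intro i hi; refine hD i (by rw [hA]; simp only [Finset.mem_union] at hi ⊢; tauto)
  | @hs V U U' w h h' wc hc l A B X B' hX hN hV hw hA ih => 
    intro hD
    refine Nest.hs (hX.congr ?_) (ih ?_) hV hw hA
    · intro i hi; have := hD i (by rw [hA]; simp [hi]); exact ⟨this.1.le, this.2.le⟩
    · intro i hi; refine hD i (by rw [hA]; simp only [Finset.mem_union] at hi ⊢; tauto)

/-- shapes of the core -/
def Core (D : Dims ι) (ε : ℝ) (K n : ℕ) (wc hc : ℝ) (Q G : Finset ι) : Prop :=
  (Ct D ε NoM K wc hc Q ∧ G = ∅) ∨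
  (∃ (n1 n2 : ℕ) (w1 w2 : ℝ) (Q1 Q2 G1 G2 : Finset ι), n1 + 1 ≤ n ∧ n2 + 1 ≤ n ∧
    PkO D ε K n1 w1 hc Q1 G1 ∧ PkO D ε K n2 w2 hc Q2 G2 ∧ w1 + w2 ≤ wc ∧ Q ⊆ Q1 ∪ Q2 ∧ G ⊆ G1 ∪ G2) ∨
  (∃ (n1 n2 : ℕ) (w1 w2 : ℝ) (Q1 Q2 G1 G2 : Finset ι), n1 + 1 ≤ n ∧ n2 + 1 ≤ n ∧
    PkO D ε K n1 wc w1 Q1 G1 ∧ PkO D ε K n2 wc w2 Q2 G2 ∧ w1 + w2 ≤ hc ∧ Q ⊆ Q1 ∪ Q2 ∧ G ⊆ G1 ∪ G2)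

theorem Core.mono {n n' : ℕ} {wc hc : ℝ} {Q G : Finset ι} (h : Core D ε K n wc hc Q G) (hn : n ≤ n') :
    Core D ε K n' wc hc Q G := by
  rcases h with h | ⟨n1, n2, w1, w2, Q1, Q2, G1, G2, h1, h2, h3⟩ | ⟨n1, n2, w1, w2, Q1, Q2, G1, G2, h1, h2, h3⟩
  · exact Or.inl h
  · exact Or.inr (Or.inl ⟨n1, n2, w1, w2, Q1, Q2, G1, G2, by omega, by omega, h3⟩)
  · exact Or.inr (Or.inr ⟨n1, n2, w1, w2, Q1, Q2, G1, G2, by omega, by omega, h3⟩)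

def NFO (D : Dims ι) (ε : ℝ) (K n : ℕ) (w h : ℝ) (Q G : Finset ι) : Prop :=
  (Q = ∅ ∧ Pk D w h G) ∨
  (1 ≤ n ∧ ∃ (V U wc hc : ℝ) (A B Qc Gc : Finset ι), Nest D V U w h A B wc hc ∧ G ⊆ A ∪ B ∪ Gc ∧ Q ⊆ Qc ∧
    Core D ε K n wc hc Qc Gc)

theorem set_e {G G1 G2 A B Gc : Finset ι} (h : G ⊆ G1 ∪ G2) (h2 : G2 ⊆ A ∪ B ∪ Gc) :
    G ⊆ (G1 ∪ A) ∪ B ∪ Gc := by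
  intro i
  have h3 := @h i
  have h4 := @h2 i
  simp only [Finset.mem_union] at *
  tauto

theorem set_f {G G1 G2 A B Gc : Finset ι} (h : G ⊆ G1 ∪ G2) (h2 : G2 ⊆ A ∪ B ∪ Gc) :
    G ⊆ A ∪ (G1 ∪ B) ∪ Gc := by
  intro i
  have h3 := @h i
  have h4 := @h2 i
  simp only [Finset.mem_union] at *
  tauto

theorem NFO.vslab {n n' : ℕ} {w h w1 w2 : ℝ} {Q Q2 G G1 G2 : Finset ι} (h1 : Pk D w1 h G1)
    (h2 : NFO D ε K n' w2 h Q2 G2) (hw : w1 + w2 ≤ w) (hQ : Q ⊆ Q2) (hG : G ⊆ G1 ∪ G2) (hn : n' ≤ n) :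
    NFO D ε K n w h Q G := by
  rcases h2 with ⟨h2, h3⟩ | ⟨hn', V, U, wc, hc, A, B, Qc, Gc, hN, hG', hQ', hC⟩
  · exact Or.inl ⟨by subst h2; exact Finset.subset_empty.1 hQ, Pk.vcut h1 h3 hw hG⟩
  · exact Or.inr ⟨by omega, _, U, wc, hc, G1 ∪ A, B, Qc, Gc,
      Nest.vs (l := w - w2) (h1.mono (by linarith) le_rfl) hN rfl (by ring) rfl, set_e hG hG',
      hQ.trans hQ', hC.mono hn⟩

theorem NFO.hslab {n n' : ℕ} {w h w1 w2 : ℝ} {Q Q2 G G1 G2 : Finset ι} (h1 : Pk D w w1 G1)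
    (h2 : NFO D ε K n' w w2 Q2 G2) (hw : w1 + w2 ≤ h) (hQ : Q ⊆ Q2) (hG : G ⊆ G1 ∪ G2) (hn : n' ≤ n) :
    NFO D ε K n w h Q G := by
  rcases h2 with ⟨h2, h3⟩ | ⟨hn', V, U, wc, hc, A, B, Qc, Gc, hN, hG', hQ', hC⟩
  · exact Or.inl ⟨by subst h2; exact Finset.subset_empty.1 hQ, Pk.hcut h1 h3 hw hG⟩
  · exact Or.inr ⟨by omega, V, _, wc, hc, A, G1 ∪ B, Qc, Gc,
      Nest.hs (l := h - w2) (h1.mono le_rfl (by linarith)) hN rfl (by ring) rfl, set_f hG hG',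
      hQ.trans hQ', hC.mono hn⟩

theorem PkO.nf {n : ℕ} {w h : ℝ} {Q G : Finset ι} (hp : PkO D ε K n w h Q G) :
    NFO D ε K n w h Q G := by
  induction hp with
  | leaf h1 h2 h3 h4 h5 => exact Or.inl ⟨h3, Pk.leaf h1 h2 h4 h5⟩
  | @sol n w h Q G h1 h2 h3 =>
    exact Or.inr ⟨h1, 0, 0, w, h, ∅, ∅, Q, ∅, Nest.nil h2.nonneg.1 h2.nonneg.2, by simp [h3], subset_rfl,
      Or.inl ⟨h2, rfl⟩⟩
  | @vcut n n1 n2 w h w1 w2 Q Q1 Q2 G G1 G2 p1 p2 hw hQ hG hn i1 i2 =>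
    rcases i1 with ⟨a1, b1⟩ | ⟨a1, b1⟩
    · refine NFO.vslab b1 i2 hw ?_ hG (by omega)
      rw [a1, Finset.empty_union] at hQ; exact hQ
    rcases i2 with ⟨a2, b2⟩ | ⟨a2, b2⟩
    · refine NFO.vslab b2 (Or.inr ⟨a1, b1⟩) (by linarith) ?_ (by rw [Finset.union_comm]; exact hG) (by omega)
      rw [a2, Finset.union_empty] at hQ; exact hQ
    have hnn : 0 ≤ w := by linarith [p1.nonneg.1, p2.nonneg.1]
    exact Or.inr ⟨by omega, 0, 0, w, h, ∅, ∅, Q, G, Nest.nil hnn p1.nonneg.2, by simp, subset_rfl,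
      Or.inr (Or.inl ⟨n1, n2, w1, w2, Q1, Q2, G1, G2, by omega, by omega, p1, p2, hw, hQ, hG⟩)⟩
  | @hcut n n1 n2 w h w1 w2 Q Q1 Q2 G G1 G2 p1 p2 hw hQ hG hn i1 i2 =>
    rcases i1 with ⟨a1, b1⟩ | ⟨a1, b1⟩
    · refine NFO.hslab b1 i2 hw ?_ hG (by omega)
      rw [a1, Finset.empty_union] at hQ; exact hQ
    rcases i2 with ⟨a2, b2⟩ | ⟨a2, b2⟩
    · refine NFO.hslab b2 (Or.inr ⟨a1, b1⟩) (by linarith) ?_ (by rw [Finset.union_comm]; exact hG) (by omega)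
      rw [a2, Finset.union_empty] at hQ; exact hQ
    have hnn : 0 ≤ h := by linarith [p1.nonneg.2, p2.nonneg.2]
    exact Or.inr ⟨by omega, 0, 0, w, h, ∅, ∅, Q, G, Nest.nil p1.nonneg.1 hnn, by simp, subset_rfl,
      Or.inr (Or.inr ⟨n1, n2, w1, w2, Q1, Q2, G1, G2, by omega, by omega, p1, p2, hw, hQ, hG⟩)⟩

/-- a set of big items in a pure piece is small -/
theorem few_big {μ pmax : ℝ} (hμ : 0 < μ) {w h : ℝ} {S : Finset ι} (hP : Pk D w h S) {p : ι → ℝ}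
    (hp : ∀ i ∈ S, p i ≤ pmax) (hpm : 0 ≤ pmax)
    (hb : ∀ i ∈ S, μ * w ≤ D.w i ∧ μ * h ≤ D.h i) : ∑ i ∈ S, p i ≤ 1 / μ ^ 2 * pmax := by
  rcases S.eq_empty_or_nonempty with rfl | ⟨x, hx⟩
  · simp; positivity
  have hw : 0 < w := (D.wpos x).trans_le (hP.dim_le x hx).1
  have hh : 0 < h := (D.hpos x).trans_le (hP.dim_le x hx).2
  have h1 : (S.card : ℝ) * (μ ^ 2 * (w * h)) ≤ w * h := by
    calc (S.card : ℝ) * (μ ^ 2 * (w * h)) = ∑ i ∈ S, (μ * w) * (μ * h) := by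
          rw [Finset.sum_const, nsmul_eq_mul]; ring
      _ ≤ ∑ i ∈ S, D.w i * D.h i := Finset.sum_le_sum (fun i hi =>
          mul_le_mul (hb i hi).1 (hb i hi).2 (by positivity) (D.w0 i))
      _ ≤ w * h := hP.area_le
  have h2 : (S.card : ℝ) ≤ 1 / μ ^ 2 := by
    rw [le_div_iff₀ (by positivity)]
    by_contra hc
    push Not at hc
    have : 1 * (w * h) < (S.card * μ ^ 2) * (w * h) := mul_lt_mul_of_pos_right hc (by positivity)
    linarith
  calc ∑ i ∈ S, p i ≤ ∑ i ∈ S, pmax := Finset.sum_le_sum hp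
    _ = S.card * pmax := by rw [Finset.sum_const, nsmul_eq_mul]
    _ ≤ _ := by gcongr

/-- replacing a tall item by the content of a box of the same size -/
theorem Ct.subst {D' : Dims ι} {M : ι → Prop} {k Kc : ℕ} {w h : ℝ} {S C : Finset ι} {i0 : ι} (hε : 0 ≤ ε)
    (hc : Ct D' ε M k w h S) (hM : M i0) (hD : ∀ i, i ≠ i0 → D.w i = D'.w i ∧ D.h i = D'.h i)
    (hC : Ct D ε NoM Kc (D'.w i0) (D'.h i0) C) :
    Ct D ε NoM (k * (1 + Kc)) w h (S.erase i0 ∪ if i0 ∈ S then C else ∅) := by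
  induction hc with
  | empty h1 h2 h3 => subst h3; exact Ct.empty h1 h2 (by simp)
  | @vstack k w h S h0 h1 h2 h3 h4 =>
    by_cases hi : i0 ∈ S
    · rw [if_pos hi]
      have e := Finset.sum_erase_add S D'.w hi
      have e2 : ∑ i ∈ S.erase i0, D.w i = ∑ i ∈ S.erase i0, D'.w i :=
        Finset.sum_congr rfl (fun i h => (hD i (Finset.ne_of_mem_erase h)).1)
      refine Ct.vcut (k1 := 1) (k2 := Kc) (w1 := ∑ i ∈ S.erase i0, D.w i) (w2 := D'.w i0) 
        (Ct.vstack le_rfl (Finset.sum_nonneg (fun i _ => D.w0 i)) h2 ?_ le_rfl)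
        (hC.mono hε le_rfl le_rfl (h3 i0 hi)) (by linarith) subset_rfl (Nat.le_mul_of_pos_left _ h0)
      intro i hi
      rw [(hD i (Finset.ne_of_mem_erase hi)).2]
      exact h3 i (Finset.mem_of_mem_erase hi)
    · rw [if_neg hi, Finset.union_empty, Finset.erase_eq_of_notMem hi]
      have hne : ∀ i ∈ S, i ≠ i0 := fun i h he => hi (he ▸ h)
      refine Ct.vstack (h0.trans (Nat.le_mul_of_pos_right _ (by omega))) h1 h2 ?_ ?_
      · intro i h; rw [(hD i (hne i h)).2]; exact h3 i h
      · rw [Finset.sum_congr rfl (fun i h => (hD i (hne i h)).1)]; exact h4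
  | @hstack k w h S h0 h1 h2 h3 h4 h5 =>
    have hi : i0 ∉ S := fun h => h5 i0 h hM
    rw [if_neg hi, Finset.union_empty, Finset.erase_eq_of_notMem hi]
    have hne : ∀ i ∈ S, i ≠ i0 := fun i h he => hi (he ▸ h)
    refine Ct.hstack (h0.trans (Nat.le_mul_of_pos_right _ (by omega))) h1 h2 ?_ ?_ (fun i _ h => h)
    · intro i h; rw [(hD i (hne i h)).1]; exact h3 i h
    · rw [Finset.sum_congr rfl (fun i h => (hD i (hne i h)).2)]; exact h4
  | @area k w h S h0 h1 h2 h3 =>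
    have hi : i0 ∉ S := fun h => h3 i0 h hM
    rw [if_neg hi, Finset.union_empty, Finset.erase_eq_of_notMem hi]
    have hne : ∀ i ∈ S, i ≠ i0 := fun i h he => hi (he ▸ h)
    refine Ct.area (h0.trans (Nat.le_mul_of_pos_right _ (by omega))) ?_ (h2.congr ?_) (fun i _ h => h)
    · intro i h; rw [(hD i (hne i h)).1, (hD i (hne i h)).2]; exact h1 i h
    · intro i h; exact ⟨(hD i (hne i h)).1.le, (hD i (hne i h)).2.le⟩
  | @vcut k k1 k2 w h w1 w2 S S1 S2 _ _ hw hS hk i1 i2 =>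
    refine Ct.vcut i1 i2 hw ?_ (by rw [← add_mul]; exact Nat.mul_le_mul_right _ hk)
    intro i hi
    simp only [Finset.mem_union, Finset.mem_erase] at hi ⊢
    rcases hi with hi | hi
    · rcases Finset.mem_union.1 (hS hi.2) with h | h
      · exact Or.inl (Or.inl ⟨hi.1, h⟩)
      · exact Or.inr (Or.inl ⟨hi.1, h⟩)
    · by_cases h0 : i0 ∈ S
      · rw [if_pos h0] at hi
        rcases Finset.mem_union.1 (hS h0) with h | h
        · rw [if_pos h]; exact Or.inl (Or.inr hi)
        · rw [if_pos h]; exact Or.inr (Or.inr hi)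
      · rw [if_neg h0] at hi; exact absurd hi (Finset.notMem_empty _)
  | @hcut k k1 k2 w h w1 w2 S S1 S2 _ _ hw hS hk i1 i2 =>
    refine Ct.hcut i1 i2 hw ?_ (by rw [← add_mul]; exact Nat.mul_le_mul_right _ hk)
    intro i hi
    simp only [Finset.mem_union, Finset.mem_erase] at hi ⊢
    rcases hi with hi | hi
    · rcases Finset.mem_union.1 (hS hi.2) with h | h
      · exact Or.inl (Or.inl ⟨hi.1, h⟩)
      · exact Or.inr (Or.inl ⟨hi.1, h⟩)
    · by_cases h0 : i0 ∈ S
      · rw [if_pos h0] at hi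
        rcases Finset.mem_union.1 (hS h0) with h | h
        · rw [if_pos h]; exact Or.inl (Or.inr hi)
        · rw [if_pos h]; exact Or.inr (Or.inr hi)
      · rw [if_neg h0] at hi; exact absurd hi (Finset.notMem_empty _)

end

theorem one_le_ceil {ε : ℝ} (hε : 0 < ε) : 1 ≤ ε * ⌈1 / ε⌉₊ := by
  have := Nat.le_ceil (1 / ε)
  rw [div_le_iff₀ hε] at this
  linarith

theorem ceil_le {ε : ℝ} (hε : 0 < ε) (hε1 : ε ≤ 1) : ε * (⌈1 / ε⌉₊ : ℝ) ≤ 2 := by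
  have := (Nat.ceil_lt_add_one (show 0 ≤ 1 / ε by positivity)).le
  calc ε * (⌈1 / ε⌉₊ : ℝ) ≤ ε * (1 / ε + 1) := by gcongr
    _ = 1 + ε := by field_simp
    _ ≤ 2 := by linarith

section
variable {ι : Type} [DecidableEq ι] {D : Dims ι} {ε : ℝ} {p : ι → ℝ}

theorem windowE (hε : 0 < ε) (hp : ∀ i, 0 ≤ p i) (S : Finset ι) (a len : ι → ℝ)
    (x0 Δ η : ℝ) (hlen : ∀ i ∈ S, len i ≤ Δ - η) (hΔ : 0 ≤ Δ) :
    ∃ j : ℕ, (j : ℝ) + 1 ≤ ⌈1 / ε⌉₊ ∧ ∑ i ∈ S \ S.filter (fun i => a i + len i ≤ x0 + j * Δ ∨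
        x0 + j * Δ + η ≤ a i), p i ≤ ε * ∑ i ∈ S, p i := by
  obtain ⟨j, hj, h⟩ := window p hp S a len ⌈1 / ε⌉₊ (Nat.ceil_pos.2 (by positivity)) x0 Δ η hlen hΔ
  refine ⟨j, by exact_mod_cast hj, ?_⟩
  set F := S \ S.filter (fun i => a i + len i ≤ x0 + j * Δ ∨ x0 + j * Δ + η ≤ a i)
  have h0 : 0 ≤ ∑ i ∈ F, p i := Finset.sum_nonneg (fun i _ => hp i)
  calc ∑ i ∈ F, p i ≤ (ε * ⌈1 / ε⌉₊) * ∑ i ∈ F, p i := le_mul_of_one_le_left h0 (one_le_ceil hε)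
    _ = ε * (⌈1 / ε⌉₊ * ∑ i ∈ F, p i) := by ring
    _ ≤ ε * ∑ i ∈ S, p i := by gcongr

/-- two losses -/
theorem loss_two (hε : 0 ≤ ε) (hp : ∀ i, 0 ≤ p i) {S F F' : Finset ι} (hF : F ⊆ S)
    (h1 : ∑ i ∈ S \ F, p i ≤ ε * ∑ i ∈ S, p i) (h2 : ∑ i ∈ F \ F', p i ≤ 2 * ε * ∑ i ∈ F, p i) :
    ∑ i ∈ S \ F', p i ≤ 3 * ε * ∑ i ∈ S, p i := by
  have h3 : S \ F' ⊆ (S \ F) ∪ (F \ F') := by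
    intro i hi
    simp only [Finset.mem_sdiff, Finset.mem_union] at hi ⊢
    tauto
  have h4 := sum_cover_le (f := p) hp h3
  have h5 := mul_le_mul_of_nonneg_left (sum_mono_set (f := p) hp hF) hε
  linarith

theorem flat (hε : 0 < ε) (hε1 : ε ≤ 1 / 2) (hp : ∀ i, 0 ≤ p i) {K : ℕ} (hK : RAProp ε (ε / 8) K)
    {w h : ℝ} {S : Finset ι} (hP : Pk D w h S) (hS : ∀ i ∈ S, D.h i ≤ ε / 8 * h) :
    ∃ S' ⊆ S, ∑ i ∈ S \ S', p i ≤ 3 * ε * ∑ i ∈ S, p i ∧ Ct D ε NoM K w ((1 - ε / 4) * h) S' := by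
  obtain ⟨a, ha1, ha2⟩ := hP.stripY
  have hh := hP.nonneg.2
  obtain ⟨j, hj, hl⟩ := windowE hε hp S a D.h 0 (ε / 2 * h) (3 * ε / 8 * h)
    (fun i hi => by linarith [hS i hi]) (by positivity)
  have hx0 : 0 ≤ 0 + j * (ε / 2 * h) := by positivity
  have hx1 : 0 + j * (ε / 2 * h) + 3 * ε / 8 * h ≤ h := by
    have h1 : (j + 1) * (ε / 2 * h) ≤ ⌈1 / ε⌉₊ * (ε / 2 * h) := by gcongr
    have h2 : (⌈1 / ε⌉₊ : ℝ) * (ε / 2 * h) = (ε * ⌈1 / ε⌉₊) / 2 * h := by ring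
    have h3 : (ε * ⌈1 / ε⌉₊) / 2 * h ≤ 1 * h :=
      mul_le_mul_of_nonneg_right (by linarith [ceil_le hε (by linarith)]) hh
    have h4 : 0 ≤ ε * h := by positivity
    linarith
  have hq := ha2 _ _ hx0 (by positivity) hx1
  obtain ⟨S', hS', hl', -, hc⟩ := hK ι D p _ _ _ hp hq
  refine ⟨S', hS'.trans (Finset.filter_subset _ _), loss_two hε.le hp (Finset.filter_subset _ _) hl hl', ?_⟩
  refine hc.noM.mono hε.le le_rfl le_rfl ?_
  have : (1 + ε / 8) * (h - 3 * ε / 8 * h) = (1 - ε / 4) * h - 3 / 64 * (ε ^ 2 * h) := by ring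
  have : 0 ≤ ε ^ 2 * h := by positivity
  linarith

theorem pos_split {ε h a0 hc U : ℝ} (h1 : ε / 8 * h ≤ U) (h2 : h = U + hc) :
    ε / 16 * h ≤ a0 ∨ a0 + hc + ε / 16 * h ≤ h := by
  by_cases h : ε / 16 * h ≤ a0
  · exact Or.inl h
  · right; push Not at h; linarith

/-- dims with one item replaced -/
def Dims.upd (D : Dims ι) (i0 : ι) (a b : ℝ) (ha : 0 < a) (hb : 0 < b) : Dims ι where
  w := fun i => if i = i0 then a else D.w i
  h := fun i => if i = i0 then b else D.h i
  wpos := by intro i; by_cases h : i = i0; · simp [h, ha]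
             · simp [h, D.wpos]
  hpos := by intro i; by_cases h : i = i0; · simp [h, hb]
             · simp [h, D.hpos]

def Kpath (K1 K2 Kc : ℕ) : ℕ := 2 * K1 + 2 * Kc + K2 * (2 + Kc)

theorem path_small (hε : 0 < ε) (hε1 : ε ≤ 1 / 2) (hp : ∀ i, 0 ≤ p i) {K1 K2 Kc : ℕ}
    (hK1 : RAProp ε (ε / 8) K1)
    {V U w h wc hc : ℝ} {A B C : Finset ι} (hN : Nest D V U w h A B wc hc) (hC : Ct D ε NoM Kc wc hc C)
    (hA : ∀ i ∈ A, D.h i ≤ ε ^ 2 / 64 * h) (hB : ∀ i ∈ B, D.h i ≤ ε ^ 2 / 64 * U) (hU : U ≤ ε / 8 * h) :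
    ∃ R ⊆ A ∪ B, ∑ i ∈ (A ∪ B) \ R, p i ≤ 6 * ε * ∑ i ∈ A ∪ B, p i ∧
      Ct D ε NoM (Kpath K1 K2 Kc) w h (R ∪ C) := by
  obtain ⟨d1, d2, d3, d4, d5, d6⟩ := hN.dims
  have hε2 : ε ^ 2 / 64 ≤ ε / 8 := by nlinarith
  have hh : 0 ≤ h := by linarith
  obtain ⟨A', a1, a2, a3⟩ := flat (p := p) hε hε1 hp hK1 hN.pkA
    (fun i hi => (hA i hi).trans (mul_le_mul_of_nonneg_right hε2 hh))
  obtain ⟨B', b1, b2, b3⟩ := flat (p := p) hε hε1 hp hK1 hN.pkB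
    (fun i hi => (hB i hi).trans (mul_le_mul_of_nonneg_right hε2 d2))
  refine ⟨A' ∪ B', Finset.union_subset_union a1 b1, ?_, ?_⟩
  · have e1 : (A ∪ B) \ (A' ∪ B') ⊆ (A \ A') ∪ (B \ B') := by
      intro i hi
      simp only [Finset.mem_sdiff, Finset.mem_union] at hi ⊢
      tauto
    have e2 := sum_cover_le (f := p) hp e1
    have e3 := mul_le_mul_of_nonneg_left (sum_mono_set (f := p) hp (Finset.subset_union_left : A ⊆ A ∪ B)) hε.le
    have e4 := mul_le_mul_of_nonneg_left (sum_mono_set (f := p) hp (Finset.subset_union_right : B ⊆ A ∪ B)) hε.le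
    linarith
  · have hA' : Ct D ε NoM K1 V hc A' := by
      refine a3.mono hε.le le_rfl le_rfl ?_
      have : 0 ≤ ε * h := by positivity
      linarith
    have hB' : Ct D ε NoM K1 w U B' := by
      refine b3.mono hε.le le_rfl le_rfl ?_
      have : 0 ≤ ε * U := by positivity
      linarith
    refine Ct.hcut hB' (Ct.vcut hA' hC d5.ge subset_rfl le_rfl) d6.ge ?_ ?_
    · intro i hi
      simp only [Finset.mem_union] at hi ⊢
      tauto
    · unfold Kpath
      have := Nat.zero_le (K2 * (2 + Kc))
      omega

theorem path_big (hε : 0 < ε) (hε1 : ε ≤ 1 / 2) (hp : ∀ i, 0 ≤ p i) {K1 K2 Kc : ℕ}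
    (hK2 : RAProp ε (ε ^ 2 / 128) K2)
    {V U w h wc hc : ℝ} {A B C : Finset ι} (hN : Nest D V U w h A B wc hc) (hC : Ct D ε NoM Kc wc hc C)
    (hCne : C.Nonempty) (hd : Disjoint C (A ∪ B))
    (hA : ∀ i ∈ A, D.h i ≤ ε ^ 2 / 64 * h) (hB : ∀ i ∈ B, D.h i ≤ ε ^ 2 / 64 * U) (hU : ε / 8 * h < U) :
    ∃ R ⊆ A ∪ B, ∑ i ∈ (A ∪ B) \ R, p i ≤ 3 * ε * ∑ i ∈ A ∪ B, p i ∧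
      Ct D ε NoM (Kpath K1 K2 Kc) w h (R ∪ C) := by
  obtain ⟨d1, d2, d3, d4, d5, d6⟩ := hN.dims
  obtain ⟨i0, hi0⟩ := hCne
  have hwc : 0 < wc := (D.wpos i0).trans_le (hC.toPk.dim_le i0 hi0).1
  have hhc : 0 < hc := (D.hpos i0).trans_le (hC.toPk.dim_le i0 hi0).2
  have hh : 0 < h := by linarith
  have hni : i0 ∉ A ∪ B := Finset.disjoint_left.1 hd hi0
  set D' := D.upd i0 wc hc hwc hhc with hD'
  have ne_i0 : ∀ i ∈ A ∪ B, i ≠ i0 := fun i hi he => hni (he ▸ hi)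
  have hDw : ∀ i, i ≠ i0 → D'.w i = D.w i := fun i hi => if_neg hi
  have hDh : ∀ i, i ≠ i0 → D'.h i = D.h i := fun i hi => if_neg hi
  have hD0w : D'.w i0 = wc := if_pos rfl
  have hD0h : D'.h i0 = hc := if_pos rfl
  have hAB : ∀ i ∈ A ∪ B, D.h i ≤ ε ^ 2 / 64 * h := by
    intro i hi
    rcases Finset.mem_union.1 hi with hi | hi
    · exact hA i hi
    · exact (hB i hi).trans (by gcongr; linarith)
  have hP : Pk D' w h (A ∪ B ∪ {i0}) := by
    refine (hN.congr (D' := D') (fun i hi => ⟨hDw i (ne_i0 i hi), hDh i (ne_i0 i hi)⟩)).toPk ?_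
    refine Pk.leaf d3 d4 (by simp) ?_
    intro i hi
    rw [Finset.mem_singleton] at hi
    subst hi
    exact ⟨hD0w.le, hD0h.le⟩
  obtain ⟨a, ha1, ha2⟩ := hP.stripY
  have hai0 := ha1 i0 (by simp)
  rw [hD0h] at hai0
  set μh : ℝ := ε ^ 2 / 64 * h with hμh
  have hμ0 : 0 < μh := by positivity
  have hx : ∃ x0 : ℝ, 0 ≤ x0 ∧ x0 + ε / 16 * h ≤ h ∧ (x0 + ε / 16 * h ≤ a i0 ∨ a i0 + hc ≤ x0) := by
    rcases pos_split (a0 := a i0) hU.le d6 with hx | hx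
    · exact ⟨0, le_rfl, by linarith, Or.inl (by linarith)⟩
    · exact ⟨a i0 + hc, by linarith, hx, Or.inr le_rfl⟩
  obtain ⟨x0, hx0, hx1, hx2⟩ := hx
  obtain ⟨j, hj, hl⟩ := windowE hε hp (A ∪ B) a D'.h x0 (2 * μh) μh
    (fun i hi => by rw [hDh i (ne_i0 i hi)]; linarith [hAB i hi]) (by positivity)
  have hj0 : 0 ≤ j * (2 * μh) := by positivity
  have hj1 : j * (2 * μh) + μh ≤ ε / 16 * h := by
    have h1 : (j + 1) * (2 * μh) ≤ ⌈1 / ε⌉₊ * (2 * μh) := by gcongr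
    have h2 : (⌈1 / ε⌉₊ : ℝ) * (2 * μh) = (ε * ⌈1 / ε⌉₊) * (ε / 32 * h) := by rw [hμh]; ring
    have h3 : (ε * ⌈1 / ε⌉₊) * (ε / 32 * h) ≤ 2 * (ε / 32 * h) :=
      mul_le_mul_of_nonneg_right (ceil_le hε (by linarith)) (by positivity)
    linarith
  have hq := ha2 (x0 + j * (2 * μh)) μh (by linarith) hμ0.le (by linarith)
  set F := (A ∪ B).filter (fun i => a i + D'.h i ≤ x0 + j * (2 * μh) ∨ x0 + j * (2 * μh) + μh ≤ a i) with hF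
  have hFs : F ⊆ A ∪ B := Finset.filter_subset _ _
  have hq' : Pk D' w (h - μh) (insert i0 F) := by
    refine hq.subset ?_
    intro i hi
    rw [Finset.mem_filter]
    rcases Finset.mem_insert.1 hi with rfl | hi
    · refine ⟨by simp, ?_⟩
      rw [hD0h]
      rcases hx2 with h | h
      · right; linarith
      · left; linarith
    · rw [hF, Finset.mem_filter] at hi
      exact ⟨Finset.mem_union_left _ hi.1, hi.2⟩
  have hfin : (1 + ε ^ 2 / 128) * (h - μh) ≤ h - ε ^ 2 / 128 * h := by
    have : (1 + ε ^ 2 / 128) * (h - μh) = h - ε ^ 2 / 128 * h - ε ^ 2 / 128 * μh := by rw [hμh]; ring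
    have : 0 ≤ ε ^ 2 / 128 * μh := by positivity
    linarith
  have hε2h : 0 ≤ ε ^ 2 / 128 * h := by positivity
  by_cases hcase : ε ^ 2 / 128 * (h - μh) ≤ hc
  · set p' : ι → ℝ := fun i => if i = i0 then 0 else p i with hp'
    have hp'0 : ∀ i, 0 ≤ p' i := by
      intro i; simp only [hp']; split_ifs; · exact le_rfl
      · exact hp i
    obtain ⟨S', hS', hl', hM, hc'⟩ := hK2 ι D' p' _ _ _ hp'0 hq'
    have hiS : i0 ∈ S' := hM i0 (Finset.mem_insert_self _ _)
      (by show ε ^ 2 / 128 * (h - μh) ≤ D'.h i0; rw [hD0h]; exact hcase)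
    have hsub := hc'.subst (D := D) (C := C) (Kc := Kc) (i0 := i0) hε.le
      (by show ε ^ 2 / 128 * (h - μh) ≤ D'.h i0; rw [hD0h]; exact hcase)
      (fun i hi => ⟨(hDw i hi).symm, (hDh i hi).symm⟩) (by rw [hD0h, hD0w]; exact hC)
    rw [if_pos hiS] at hsub
    have hSF : S'.erase i0 ⊆ F := by
      intro i hi
      rw [Finset.mem_erase] at hi
      exact (Finset.mem_insert.1 (hS' hi.2)).resolve_left hi.1
    refine ⟨S'.erase i0, hSF.trans hFs, loss_two hε.le hp hFs hl ?_, hsub.mono hε.le ?_ le_rfl (by linarith)⟩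
    · have e1 : ∑ i ∈ F \ S'.erase i0, p i ≤ ∑ i ∈ insert i0 F \ S', p' i := by
        have e2 : ∑ i ∈ F \ S'.erase i0, p i = ∑ i ∈ F \ S'.erase i0, p' i := by
          refine Finset.sum_congr rfl (fun i hi => ?_)
          have : i ≠ i0 := ne_i0 i (hFs (Finset.mem_sdiff.1 hi).1)
          simp only [hp', if_neg this]
        rw [e2]
        refine sum_mono_set (f := p') hp'0 ?_
        intro i hi
        rw [Finset.mem_sdiff] at hi ⊢
        have hne : i ≠ i0 := ne_i0 i (hFs hi.1)
        exact ⟨Finset.mem_insert_of_mem hi.1, fun h => hi.2 (Finset.mem_erase.2 ⟨hne, h⟩)⟩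
      have e3 : ∑ i ∈ insert i0 F, p' i = ∑ i ∈ F, p i := by
        rw [Finset.sum_insert (fun h => hni (hFs h))]
        simp only [hp', if_true, zero_add]
        refine Finset.sum_congr rfl (fun i hi => ?_)
        rw [if_neg (ne_i0 i (hFs hi))]
      rw [e3] at hl'
      linarith
    · unfold Kpath
      have : K2 * (1 + Kc) ≤ K2 * (2 + Kc) := Nat.mul_le_mul_left _ (by omega)
      omega
  · push Not at hcase
    have hqF : Pk D w (h - μh) F := by
      refine (hq'.subset (Finset.subset_insert _ _)).congr ?_
      intro i hi
      have := ne_i0 i (hFs hi)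
      exact ⟨(hDw i this).ge, (hDh i this).ge⟩
    obtain ⟨S', hS', hl', -, hc'⟩ := hK2 ι D p _ _ _ hp hqF
    refine ⟨S', hS'.trans hFs, loss_two hε.le hp hFs hl hl', ?_⟩
    have hck : hc ≤ ε ^ 2 / 128 * h := by
      refine hcase.le.trans ?_
      gcongr; linarith
    refine Ct.hcut (hc'.noM.mono hε.le le_rfl le_rfl hfin) (hC.mono hε.le le_rfl (show wc ≤ w by linarith) hck)
      (by linarith) subset_rfl ?_
    unfold Kpath
    have : K2 * 1 ≤ K2 * (2 + Kc) := Nat.mul_le_mul_left _ (by omega)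
    omega

theorem pathA (hε : 0 < ε) (hε1 : ε ≤ 1 / 2) (hp : ∀ i, 0 ≤ p i) {K1 K2 Kc : ℕ}
    (hK1 : RAProp ε (ε / 8) K1) (hK2 : RAProp ε (ε ^ 2 / 128) K2)
    {V U w h wc hc : ℝ} {A B C : Finset ι} (hN : Nest D V U w h A B wc hc) (hC : Ct D ε NoM Kc wc hc C)
    (hCne : C.Nonempty) (hd : Disjoint C (A ∪ B))
    (hA : ∀ i ∈ A, D.h i ≤ ε ^ 2 / 64 * h) (hB : ∀ i ∈ B, D.h i ≤ ε ^ 2 / 64 * U) :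
    ∃ R ⊆ A ∪ B, ∑ i ∈ (A ∪ B) \ R, p i ≤ 6 * ε * ∑ i ∈ A ∪ B, p i ∧
      Ct D ε NoM (Kpath K1 K2 Kc) w h (R ∪ C) := by
  by_cases hU : U ≤ ε / 8 * h
  · exact path_small hε hε1 hp hK1 hN hC hA hB hU
  · push Not at hU
    obtain ⟨R, h1, h2, h3⟩ := path_big (K1 := K1) hε hε1 hp hK2 hN hC hCne hd hA hB hU
    refine ⟨R, h1, h2.trans ?_, h3⟩
    have : 0 ≤ ∑ i ∈ A ∪ B, p i := Finset.sum_nonneg (fun i _ => hp i)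
    nlinarith

theorem pathB (hε : 0 < ε) (hε1 : ε ≤ 1 / 2) (hp : ∀ i, 0 ≤ p i) {K1 K2 Kc : ℕ}
    (hK1 : RAProp ε (ε / 8) K1) (hK2 : RAProp ε (ε ^ 2 / 128) K2)
    {V U w h wc hc : ℝ} {A B C : Finset ι} (hN : Nest D V U w h A B wc hc) (hC : Ct D ε NoM Kc wc hc C)
    (hCne : C.Nonempty) (hd : Disjoint C (A ∪ B))
    (hA : ∀ i ∈ A, D.w i ≤ ε ^ 2 / 64 * V) (hB : ∀ i ∈ B, D.w i ≤ ε ^ 2 / 64 * w) :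
    ∃ R ⊆ A ∪ B, ∑ i ∈ (A ∪ B) \ R, p i ≤ 6 * ε * ∑ i ∈ A ∪ B, p i ∧
      Ct D ε NoM (Kpath K1 K2 Kc) w h (R ∪ C) := by
  rw [Finset.union_comm A B] at *
  obtain ⟨R, h1, h2, h3⟩ := pathA (p := p) hε hε1 hp hK1 hK2 hN.tr hC.tr hCne hd hB hA
  exact ⟨R, h1, h2, h3.tr⟩

end

section
variable {ι : Type} [DecidableEq ι] {D : Dims ι} {ε : ℝ} {p : ι → ℝ}

theorem pathA0 (hε : 0 < ε) (hε1 : ε ≤ 1 / 2) (hp : ∀ i, 0 ≤ p i) {K1 K2 Kc : ℕ}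
    (hK1 : RAProp ε (ε / 8) K1) (hK2 : RAProp ε (ε ^ 2 / 128) K2)
    {V U w h wc hc : ℝ} {A B C : Finset ι} (hN : Nest D V U w h A B wc hc) (hC : Ct D ε NoM Kc wc hc C)
    (hd : Disjoint C (A ∪ B))
    (hA : ∀ i ∈ A, D.h i ≤ ε ^ 2 / 64 * h) (hB : ∀ i ∈ B, D.h i ≤ ε ^ 2 / 64 * U) :
    ∃ R ⊆ A ∪ B, ∑ i ∈ (A ∪ B) \ R, p i ≤ 6 * ε * ∑ i ∈ A ∪ B, p i ∧
      Ct D ε NoM (Kpath K1 K2 Kc) w h (R ∪ C) := by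
  rcases C.eq_empty_or_nonempty with rfl | hne
  · obtain ⟨d1, d2, d3, d4, d5, d6⟩ := hN.dims
    have hh : 0 ≤ h := by linarith
    have hε2 : ε ^ 2 / 64 ≤ ε / 8 := by nlinarith
    have hP := hN.toPk (Pk.empty d3 d4)
    rw [Finset.union_empty] at hP
    obtain ⟨R, r1, r2, r3⟩ := flat (p := p) hε hε1 hp hK1 hP (by
      intro i hi
      rcases Finset.mem_union.1 hi with hi | hi
      · exact (hA i hi).trans (mul_le_mul_of_nonneg_right hε2 hh)
      · exact (hB i hi).trans (mul_le_mul hε2 (by linarith) d2 (by positivity)))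
    refine ⟨R, r1, r2.trans ?_, ?_⟩
    · have : 0 ≤ ∑ i ∈ A ∪ B, p i := Finset.sum_nonneg (fun i _ => hp i)
      have := mul_nonneg hε.le this
      linarith
    · rw [Finset.union_empty]
      refine r3.mono hε.le ?_ le_rfl ?_
      · unfold Kpath
        have := Nat.zero_le (K2 * (2 + Kc))
        omega
      · have : 0 ≤ ε * h := by positivity
        linarith
  · exact pathA hε hε1 hp hK1 hK2 hN hC hne hd hA hB

theorem pathB0 (hε : 0 < ε) (hε1 : ε ≤ 1 / 2) (hp : ∀ i, 0 ≤ p i) {K1 K2 Kc : ℕ}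
    (hK1 : RAProp ε (ε / 8) K1) (hK2 : RAProp ε (ε ^ 2 / 128) K2)
    {V U w h wc hc : ℝ} {A B C : Finset ι} (hN : Nest D V U w h A B wc hc) (hC : Ct D ε NoM Kc wc hc C)
    (hd : Disjoint C (A ∪ B))
    (hA : ∀ i ∈ A, D.w i ≤ ε ^ 2 / 64 * V) (hB : ∀ i ∈ B, D.w i ≤ ε ^ 2 / 64 * w) :
    ∃ R ⊆ A ∪ B, ∑ i ∈ (A ∪ B) \ R, p i ≤ 6 * ε * ∑ i ∈ A ∪ B, p i ∧
      Ct D ε NoM (Kpath K1 K2 Kc) w h (R ∪ C) := by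
  rw [Finset.union_comm A B] at *
  obtain ⟨R, h1, h2, h3⟩ := pathA0 (p := p) hε hε1 hp hK1 hK2 hN.tr hC.tr hd hB hA
  exact ⟨R, h1, h2, h3.tr⟩

theorem path2_cover {A B A1 A2 B1 B2 : Finset ι} {P1 P2 P3 P4 : ι → Prop} [DecidablePred P1] [DecidablePred P2]
    [DecidablePred P3] [DecidablePred P4] :
    A ∪ B ⊆ ((A.filter P1 ∪ B.filter P2) ∪ (A.filter P3 ∪ B.filter P4)) ∪
      (A.filter (fun i => ¬ P1 i ∧ ¬ P3 i) ∪ B.filter (fun i => ¬ P2 i ∧ ¬ P4 i)) := by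
  intro i hi
  simp only [Finset.mem_union, Finset.mem_filter] at *
  tauto

theorem path2 (hε : 0 < ε) (hε1 : ε ≤ 1 / 2) (hp : ∀ i, 0 ≤ p i) {K1 K2 Kc : ℕ}
    (hK1 : RAProp ε (ε / 8) K1) (hK2 : RAProp ε (ε ^ 2 / 128) K2)
    {V U w h wc hc pmax : ℝ} {A B C1 C2 : Finset ι} (hN : Nest D V U w h A B wc hc)
    (hC1 : Ct D ε NoM Kc wc hc C1) (hC2 : Ct D ε NoM Kc wc hc C2)
    (hd1 : Disjoint C1 (A ∪ B)) (hd2 : Disjoint C2 (A ∪ B)) (hpm : 0 ≤ pmax) (hpm' : ∀ i ∈ A ∪ B, p i ≤ pmax) :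
    ∃ R1 ⊆ A ∪ B, ∃ R2 ⊆ A ∪ B, ∑ i ∈ A ∪ B, p i ≤ ∑ i ∈ R1, p i + ∑ i ∈ R2, p i + 12 * ε * ∑ i ∈ A ∪ B, p i
        + 2 * (1 / (ε ^ 2 / 64) ^ 2) * pmax ∧
      Ct D ε NoM (Kpath K1 K2 Kc) w h (R1 ∪ C1) ∧ Ct D ε NoM (Kpath K1 K2 Kc) w h (R2 ∪ C2) := by
  set A1 := A.filter (fun i => D.h i ≤ ε ^ 2 / 64 * h) with hA1
  set B1 := B.filter (fun i => D.h i ≤ ε ^ 2 / 64 * U) with hB1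
  set A2 := A.filter (fun i => D.w i ≤ ε ^ 2 / 64 * V) with hA2
  set B2 := B.filter (fun i => D.w i ≤ ε ^ 2 / 64 * w) with hB2
  have s1 : A1 ∪ B1 ⊆ A ∪ B := Finset.union_subset_union (Finset.filter_subset _ _) (Finset.filter_subset _ _)
  have s2 : A2 ∪ B2 ⊆ A ∪ B := Finset.union_subset_union (Finset.filter_subset _ _) (Finset.filter_subset _ _)
  obtain ⟨R1, r1, l1, c1⟩ := pathA0 (p := p) hε hε1 hp hK1 hK2
    (hN.subset A1 (Finset.filter_subset _ _) B1 (Finset.filter_subset _ _)) hC1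
    (hd1.mono_right s1) (fun i hi => (Finset.mem_filter.1 hi).2) (fun i hi => (Finset.mem_filter.1 hi).2)
  obtain ⟨R2, r2, l2, c2⟩ := pathB0 (p := p) hε hε1 hp hK1 hK2
    (hN.subset A2 (Finset.filter_subset _ _) B2 (Finset.filter_subset _ _)) hC2
    (hd2.mono_right s2) (fun i hi => (Finset.mem_filter.1 hi).2) (fun i hi => (Finset.mem_filter.1 hi).2)
  refine ⟨R1, r1.trans s1, R2, r2.trans s2, ?_, c1, c2⟩
  have hcov := path2_cover (A := A) (B := B) (A1 := A) (A2 := A) (B1 := B) (B2 := B)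
    (P1 := fun i => D.h i ≤ ε ^ 2 / 64 * h) (P2 := fun i => D.h i ≤ ε ^ 2 / 64 * U)
    (P3 := fun i => D.w i ≤ ε ^ 2 / 64 * V) (P4 := fun i => D.w i ≤ ε ^ 2 / 64 * w)
  rw [← hA1, ← hB1, ← hA2, ← hB2] at hcov
  have e1 := sum_cover_le (f := p) hp hcov
  have e2 := sum_cover_le (f := p) hp (subset_refl ((A1 ∪ B1) ∪ (A2 ∪ B2)))
  have e3 := sum_cover_le (f := p) hp (subset_refl ((A.filter (fun i => ¬ D.h i ≤ ε ^ 2 / 64 * h ∧ ¬ D.w i ≤ ε ^ 2 / 64 * V)) ∪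
    (B.filter (fun i => ¬ D.h i ≤ ε ^ 2 / 64 * U ∧ ¬ D.w i ≤ ε ^ 2 / 64 * w))))
  have f1 := few_big (p := p) (pmax := pmax) (show 0 < ε ^ 2 / 64 by positivity) (hN.pkA.subset
    (Finset.filter_subset (fun i => ¬ D.h i ≤ ε ^ 2 / 64 * h ∧ ¬ D.w i ≤ ε ^ 2 / 64 * V) A))
    (fun i hi => hpm' i (Finset.mem_union_left _ (Finset.mem_filter.1 hi).1)) hpm
    (fun i hi => ⟨(not_le.1 (Finset.mem_filter.1 hi).2.2).le, (not_le.1 (Finset.mem_filter.1 hi).2.1).le⟩)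
  have f2 := few_big (p := p) (pmax := pmax) (show 0 < ε ^ 2 / 64 by positivity) (hN.pkB.subset
    (Finset.filter_subset (fun i => ¬ D.h i ≤ ε ^ 2 / 64 * U ∧ ¬ D.w i ≤ ε ^ 2 / 64 * w) B))
    (fun i hi => hpm' i (Finset.mem_union_right _ (Finset.mem_filter.1 hi).1)) hpm
    (fun i hi => ⟨(not_le.1 (Finset.mem_filter.1 hi).2.2).le, (not_le.1 (Finset.mem_filter.1 hi).2.1).le⟩)
  have g1 := sum_sdiff' (f := p) r1
  have g2 := sum_sdiff' (f := p) r2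
  have k1 := mul_le_mul_of_nonneg_left (sum_mono_set (f := p) hp s1) hε.le
  have k2 := mul_le_mul_of_nonneg_left (sum_mono_set (f := p) hp s2) hε.le
  linarith

theorem Core.subset {K n : ℕ} {wc hc : ℝ} {Q G Q' G' : Finset ι} (h : Core D ε K n wc hc Q G) (hQ : Q' ⊆ Q)
    (hG : G' ⊆ G) : Core D ε K n wc hc Q' G' := by
  rcases h with ⟨h1, h2⟩ | ⟨n1, n2, w1, w2, Q1, Q2, G1, G2, h1, h2, h3, h4, h5, h6, h7⟩ |
    ⟨n1, n2, w1, w2, Q1, Q2, G1, G2, h1, h2, h3, h4, h5, h6, h7⟩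
  · exact Or.inl ⟨h1.subset hQ, by subst h2; exact Finset.subset_empty.1 hG⟩
  · exact Or.inr (Or.inl ⟨n1, n2, w1, w2, Q1, Q2, G1, G2, h1, h2, h3, h4, h5, hQ.trans h6, hG.trans h7⟩)
  · exact Or.inr (Or.inr ⟨n1, n2, w1, w2, Q1, Q2, G1, G2, h1, h2, h3, h4, h5, hQ.trans h6, hG.trans h7⟩)

end

/-- conclusion of Lemma I -/
def LIC {ι : Type} [DecidableEq ι] (D : Dims ι) (ε : ℝ) (p : ι → ℝ) (k : ℕ) (w h c : ℝ) (Q G : Finset ι) : Prop :=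
  ∃ G1 ⊆ G, ∃ G2 ⊆ G, Ct D ε NoM k w h (Q ∪ G1) ∧ Ct D ε NoM k w h (Q ∪ G2) ∧
    ∑ i ∈ G, p i ≤ ∑ i ∈ G1, p i + ∑ i ∈ G2, p i + 12 * ε * ∑ i ∈ G, p i + c

def LIP (ε : ℝ) (K n Kn : ℕ) (cn : ℝ) : Prop :=
  ∀ (ι : Type) [DecidableEq ι] (D : Dims ι) (p : ι → ℝ) (pmax w h : ℝ) (Q G : Finset ι), (∀ i, 0 ≤ p i) →
    0 ≤ pmax → (∀ i ∈ G, p i ≤ pmax) → Disjoint Q G → PkO D ε K n w h Q G → LIC D ε p Kn w h (cn * pmax) Q G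

section
variable {ι : Type} [DecidableEq ι] {D : Dims ι} {ε : ℝ} {p : ι → ℝ}

theorem set_g {Q Q1 Q2 X1 X2 : Finset ι} (hQ : Q ⊆ Q1 ∪ Q2) :
    Q ∪ (X1 ∪ X2) ⊆ ((Q ∩ Q1) ∪ X1) ∪ ((Q \ Q1) ∪ X2) := by
  intro i
  have h3 := @hQ i
  simp only [Finset.mem_union, Finset.mem_inter, Finset.mem_sdiff] at *
  tauto

theorem sub_of_cover {G G1 G2 : Finset ι} (h : G ⊆ G1 ∪ G2) : G \ G1 ⊆ G2 := by
  intro i hi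
  rw [Finset.mem_sdiff] at hi
  exact (Finset.mem_union.1 (h hi.1)).resolve_left hi.2

/-- combining two sides of a branch -/
theorem LIC.comb {k1 : ℕ} {w1 h1 w2 h2 c w h : ℝ} {Q G Q1 Q2 G1 : Finset ι}
    (hc : ∀ S S1 S2, Ct D ε NoM k1 w1 h1 S1 → Ct D ε NoM k1 w2 h2 S2 → S ⊆ S1 ∪ S2 → Ct D ε NoM (k1 + k1) w h S)
    (hQ : Q ⊆ Q1 ∪ Q2)
    (a : LIC D ε p k1 w1 h1 c (Q ∩ Q1) (G ∩ G1)) (b : LIC D ε p k1 w2 h2 c (Q \ Q1) (G \ G1)) :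
    LIC D ε p (k1 + k1) w h (2 * c) Q G := by
  obtain ⟨X1, x1, Y1, y1, a1, a2, a3⟩ := a
  obtain ⟨X2, x2, Y2, y2, b1, b2, b3⟩ := b
  have dd : Disjoint (G ∩ G1) (G \ G1) := (Finset.disjoint_sdiff_inter G G1).symm
  have dX := Finset.sum_union (f := p) (dd.mono x1 x2)
  have dY := Finset.sum_union (f := p) (dd.mono y1 y2)
  refine ⟨X1 ∪ X2, Finset.union_subset (x1.trans Finset.inter_subset_left) (x2.trans Finset.sdiff_subset),
    Y1 ∪ Y2, Finset.union_subset (y1.trans Finset.inter_subset_left) (y2.trans Finset.sdiff_subset),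
    hc _ _ _ a1 b1 (set_g hQ), hc _ _ _ a2 b2 (set_g hQ), ?_⟩
  have := sum_split G G1 p
  rw [dX, dY, this]
  linarith

theorem LI_core (hε : 0 < ε) {K n Kn : ℕ} {cn pmax : ℝ} (hcn : 0 ≤ cn) (hL : LIP ε K n Kn cn) (hp : ∀ i, 0 ≤ p i)
    (hpm : 0 ≤ pmax) {wc hc : ℝ} {Q G : Finset ι} (hpG : ∀ i ∈ G, p i ≤ pmax) (hd : Disjoint Q G)
    (h : Core D ε K (n + 1) wc hc Q G) : LIC D ε p (K + (Kn + Kn)) wc hc (2 * (cn * pmax)) Q G := by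
  have mm : ∀ {k w h c Q G}, k ≤ K + (Kn + Kn) → LIC D ε p k w h c Q G → LIC D ε p (K + (Kn + Kn)) w h c Q G := by
    rintro k w h c Q G hk ⟨X, x, Y, y, a, b, e⟩
    exact ⟨X, x, Y, y, a.mono hε.le hk le_rfl le_rfl, b.mono hε.le hk le_rfl le_rfl, e⟩
  have d1 : ∀ Q1 G1, Disjoint (Q ∩ Q1) (G ∩ G1) := fun _ _ => hd.mono Finset.inter_subset_left Finset.inter_subset_left
  have d2 : ∀ Q1 G1, Disjoint (Q \ Q1) (G \ G1) := fun _ _ => hd.mono Finset.sdiff_subset Finset.sdiff_subset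
  rcases h with ⟨h1, h2⟩ | ⟨n1, n2, w1, w2, Q1, Q2, G1, G2, h1, h2, h3, h4, h5, h6, h7⟩ |
    ⟨n1, n2, w1, w2, Q1, Q2, G1, G2, h1, h2, h3, h4, h5, h6, h7⟩
  · subst h2
    have := h1.mono hε.le (Nat.le_add_right K (Kn + Kn)) le_rfl le_rfl
    refine ⟨∅, subset_rfl, ∅, subset_rfl, by simpa using this, by simpa using this, ?_⟩
    simp; positivity
  · refine mm (k := Kn + Kn) (by omega) (LIC.comb (Q1 := Q1) (Q2 := Q2) (G1 := G1) (w1 := w1) (w2 := w2) (h1 := hc) (h2 := hc) ?_ h6 ?_ ?_)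
    · intro S S1 S2 c1 c2 hs
      exact Ct.vcut c1 c2 h5 hs le_rfl
    · exact hL ι D p pmax w1 hc _ _ hp hpm (fun i hi => hpG i (Finset.mem_inter.1 hi).1) (d1 _ _)
        ((h3.mono hε.le le_rfl (show n1 ≤ n by omega) le_rfl le_rfl).subset Finset.inter_subset_right Finset.inter_subset_right)
    · exact hL ι D p pmax w2 hc _ _ hp hpm (fun i hi => hpG i (Finset.mem_sdiff.1 hi).1) (d2 _ _)
        ((h4.mono hε.le le_rfl (show n2 ≤ n by omega) le_rfl le_rfl).subset (sub_of_cover h6) (sub_of_cover h7))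
  · refine mm (k := Kn + Kn) (by omega) (LIC.comb (Q1 := Q1) (Q2 := Q2) (G1 := G1) (w1 := wc) (w2 := wc) (h1 := w1) (h2 := w2) ?_ h6 ?_ ?_)
    · intro S S1 S2 c1 c2 hs
      exact Ct.hcut c1 c2 h5 hs le_rfl
    · exact hL ι D p pmax wc w1 _ _ hp hpm (fun i hi => hpG i (Finset.mem_inter.1 hi).1) (d1 _ _)
        ((h3.mono hε.le le_rfl (show n1 ≤ n by omega) le_rfl le_rfl).subset Finset.inter_subset_right Finset.inter_subset_right)
    · exact hL ι D p pmax wc w2 _ _ hp hpm (fun i hi => hpG i (Finset.mem_sdiff.1 hi).1) (d2 _ _)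
        ((h4.mono hε.le le_rfl (show n2 ≤ n by omega) le_rfl le_rfl).subset (sub_of_cover h6) (sub_of_cover h7))

theorem LI_pure (hε : 0 < ε) (hε1 : ε ≤ 1 / 2) (hp : ∀ i, 0 ≤ p i) {K1 K2 Kc : ℕ}
    (hK1 : RAProp ε (ε / 8) K1) (hK2 : RAProp ε (ε ^ 2 / 128) K2) {pmax w h : ℝ} {G : Finset ι}
    (hpm : 0 ≤ pmax) (hpG : ∀ i ∈ G, p i ≤ pmax) (hP : Pk D w h G) :
    LIC D ε p (Kpath K1 K2 Kc) w h (2 * (1 / (ε ^ 2 / 64) ^ 2) * pmax) ∅ G := by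
  have hN : Nest D w 0 w h G ∅ 0 h := Nest.vs hP (Nest.nil (w := 0) le_rfl hP.nonneg.2) (by ring) (by ring) (by simp)
  have hC : Ct D ε NoM Kc 0 h ∅ := Ct.empty le_rfl hP.nonneg.2 rfl
  obtain ⟨R1, r1, R2, r2, e, c1, c2⟩ := path2 (p := p) (pmax := pmax) hε hε1 hp hK1 hK2 hN hC hC (by simp) (by simp) hpm
    (by simpa using hpG)
  rw [Finset.union_empty] at *
  exact ⟨R1, r1, R2, r2, by simpa using c1, by simpa using c2, e⟩

theorem set_h1 {G A B Gc : Finset ι} (hG : G ⊆ A ∪ B ∪ Gc) :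
    G \ Gc ⊆ ((A ∩ G) \ Gc) ∪ ((B ∩ G) \ Gc) := by
  intro i
  have h3 := @hG i
  simp only [Finset.mem_union, Finset.mem_inter, Finset.mem_sdiff] at *
  tauto

theorem set_h2 {G A B Gc : Finset ι} : ((A ∩ G) \ Gc) ∪ ((B ∩ G) \ Gc) ⊆ G \ Gc := by
  intro i
  simp only [Finset.mem_union, Finset.mem_inter, Finset.mem_sdiff] at *
  tauto

theorem LI_step (hε : 0 < ε) (hε1 : ε ≤ 1 / 2) (hp : ∀ i, 0 ≤ p i) {K1 K2 K n Kc : ℕ}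
    (hK1 : RAProp ε (ε / 8) K1) (hK2 : RAProp ε (ε ^ 2 / 128) K2) {pmax w h c : ℝ} {Q G : Finset ι}
    (hpm : 0 ≤ pmax) (hc0 : 0 ≤ c) (hpG : ∀ i ∈ G, p i ≤ pmax) (hd : Disjoint Q G) (hP : PkO D ε K n w h Q G)
    (hcore : 1 ≤ n → ∀ wc hc Gc, Gc ⊆ G → Core D ε K n wc hc Q Gc → LIC D ε p Kc wc hc c Q Gc) :
    LIC D ε p (Kpath K1 K2 Kc) w h (2 * (1 / (ε ^ 2 / 64) ^ 2) * pmax + c) Q G := by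
  rcases hP.nf with ⟨h1, h2⟩ | ⟨hn, V, U, wc, hc, A, B, Qc, Gc, hN, hG, hQ, hC⟩
  · subst h1
    obtain ⟨X, x, Y, y, a, b, e⟩ := LI_pure (p := p) (Kc := Kc) hε hε1 hp hK1 hK2 hpm hpG h2
    exact ⟨X, x, Y, y, a, b, by linarith⟩
  · obtain ⟨X, x, Y, y, a, b, e⟩ := hcore hn wc hc (Gc ∩ G) Finset.inter_subset_right
      (hC.subset hQ Finset.inter_subset_left)
    set A0 := (A ∩ G) \ Gc with hA0
    set B0 := (B ∩ G) \ Gc with hB0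
    have hAB : A0 ∪ B0 = G \ Gc := Finset.Subset.antisymm set_h2 (set_h1 hG)
    have dX : ∀ Z, Z ⊆ Gc ∩ G → Disjoint (Q ∪ Z) (A0 ∪ B0) := by
      intro Z hZ
      rw [hAB, Finset.disjoint_union_left]
      exact ⟨hd.mono_right Finset.sdiff_subset, Finset.disjoint_sdiff.mono_left (hZ.trans Finset.inter_subset_left)⟩
    obtain ⟨R1, r1, R2, r2, e', c1, c2⟩ := path2 (p := p) (pmax := pmax) hε hε1 hp hK1 hK2
      (hN.subset A0 (Finset.sdiff_subset.trans Finset.inter_subset_left) B0 (Finset.sdiff_subset.trans Finset.inter_subset_left))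
      a b (dX _ x) (dX _ y) hpm (by rw [hAB]; exact fun i hi => hpG i (Finset.mem_sdiff.1 hi).1)
    rw [hAB] at *
    have dR1 : Disjoint X R1 := Finset.disjoint_sdiff.mono (x.trans Finset.inter_subset_left) r1
    have dR2 : Disjoint Y R2 := Finset.disjoint_sdiff.mono (y.trans Finset.inter_subset_left) r2
    refine ⟨X ∪ R1, Finset.union_subset (x.trans Finset.inter_subset_right) (r1.trans Finset.sdiff_subset),
      Y ∪ R2, Finset.union_subset (y.trans Finset.inter_subset_right) (r2.trans Finset.sdiff_subset), ?_, ?_, ?_⟩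
    · rw [← Finset.union_assoc, Finset.union_comm]; exact c1
    · rw [← Finset.union_assoc, Finset.union_comm]; exact c2
    · rw [Finset.sum_union dR1, Finset.sum_union dR2]
      have := sum_split G Gc p
      rw [Finset.inter_comm] at this
      rw [this]
      linarith

end

theorem LemI (ε : ℝ) (hε : 0 < ε) (hε1 : ε ≤ 1 / 2) (K : ℕ) (n : ℕ) :
    ∃ (Kn : ℕ) (cn : ℝ), 0 ≤ cn ∧ LIP ε K n Kn cn := by
  obtain ⟨K1, hK1⟩ := RA ε (ε / 8) hε hε1 (by positivity) (by linarith)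
  obtain ⟨K2, hK2⟩ := RA ε (ε ^ 2 / 128) hε hε1 (by positivity) (by nlinarith)
  induction n with
  | zero =>
    refine ⟨Kpath K1 K2 0, 2 * (1 / (ε ^ 2 / 64) ^ 2), by positivity, ?_⟩
    intro ι _ D p pmax w h Q G hp hpm hpG hd hP
    have := LI_step (Kc := 0) (c := 0) hε hε1 hp hK1 hK2 hpm le_rfl hpG hd hP (by omega)
    simpa using this
  | succ n ih =>
    obtain ⟨Kn, cn, hcn, hL⟩ := ih
    refine ⟨Kpath K1 K2 (K + (Kn + Kn)), 2 * (1 / (ε ^ 2 / 64) ^ 2) + 2 * cn, by positivity, ?_⟩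
    intro ι _ D p pmax w h Q G hp hpm hpG hd hP
    have := LI_step (Kc := K + (Kn + Kn)) (c := 2 * (cn * pmax)) hε hε1 hp hK1 hK2 hpm (by positivity) hpG hd hP
      (fun _ wc hc Gc hG hC => LI_core hε hcn hL hp hpm (fun i hi => hpG i (hG hi)) (hd.mono_right hG) hC)
    rw [add_mul, mul_assoc 2 cn pmax]
    exact this

/-- same items up to rotation -/
def IsRot {ι : Type} (D D' : Dims ι) : Prop :=
  ∀ i, (D'.w i = D.w i ∧ D'.h i = D.h i) ∨ (D'.w i = D.h i ∧ D'.h i = D.w i)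

section
variable {ι : Type} [DecidableEq ι] {D : Dims ι} {ε : ℝ} {p : ι → ℝ}

theorem IsRot.ofT {D' : Dims ι} (h : IsRot D.T D') : IsRot D D' := fun i => (h i).symm

theorem IsRot.rfl' : IsRot D D := fun i => Or.inl ⟨rfl, rfl⟩

/-- pigeonhole over the bands `(δ (j+1), δ j]`, two functions at once -/
theorem bandFG (hε : 0 < ε) (hp : ∀ i, 0 ≤ p i) (S : Finset ι) (f g : ι → ℝ)
    (δ : ℕ → ℝ) (hδ : ∀ k, δ (k + 1) ≤ δ k) :
    ∃ j < ⌈1 / ε⌉₊, ∃ T ⊆ S, ∑ i ∈ S \ T, p i ≤ 2 * ε * ∑ i ∈ S, p i ∧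
      ∀ i ∈ T, (f i ≤ δ (j + 1) ∨ δ j < f i) ∧ (g i ≤ δ (j + 1) ∨ δ j < g i) := by
  have han : Antitone δ := antitone_nat_of_succ_le hδ
  have hN : 0 < ⌈1 / ε⌉₊ := Nat.ceil_pos.2 (by positivity)
  obtain ⟨j, hj, hl⟩ := pigeon p hp S ⌈1 / ε⌉₊ 2 hN
    (fun j => S.filter (fun i => (δ (j + 1) < f i ∧ f i ≤ δ j) ∨ (δ (j + 1) < g i ∧ g i ≤ δ j))) (by
    intro i hi
    have aux : ∀ f : ℝ, ((Finset.range ⌈1 / ε⌉₊).filter (fun j => δ (j + 1) < f ∧ f ≤ δ j)).card ≤ 1 := by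
      intro f
      rw [Finset.card_le_one]
      intro a ha b hb
      rw [Finset.mem_filter] at ha hb
      by_contra hne
      rcases lt_or_gt_of_ne hne with hlt | hlt
      · have := han (show a + 1 ≤ b by omega)
        linarith [ha.2.1, hb.2.2]
      · have := han (show b + 1 ≤ a by omega)
        linarith [hb.2.1, ha.2.2]
    refine (Finset.card_le_card (t := _ ∪ _) ?_).trans ((Finset.card_union_le _ _).trans
      (add_le_add (aux (f i)) (aux (g i))))
    intro j hj
    simp only [Finset.mem_filter, Finset.mem_union] at hj ⊢
    rcases hj.2.2 with h | h
    · exact Or.inl ⟨hj.1, h⟩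
    · exact Or.inr ⟨hj.1, h⟩)
  set R := S.filter (fun i => (δ (j + 1) < f i ∧ f i ≤ δ j) ∨ (δ (j + 1) < g i ∧ g i ≤ δ j)) with hR
  have hRS : R ⊆ S := Finset.filter_subset _ _
  refine ⟨j, hj, S \ R, Finset.sdiff_subset, ?_, ?_⟩
  · rw [Finset.sdiff_sdiff_eq_self hRS]
    rw [Finset.inter_eq_right.2 hRS] at hl
    have h0 : 0 ≤ ∑ i ∈ R, p i := Finset.sum_nonneg (fun i _ => hp i)
    calc ∑ i ∈ R, p i ≤ (ε * ⌈1 / ε⌉₊) * ∑ i ∈ R, p i := le_mul_of_one_le_left h0 (one_le_ceil hε)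
      _ = ε * (⌈1 / ε⌉₊ * ∑ i ∈ R, p i) := by ring
      _ ≤ ε * ((2 : ℕ) * ∑ i ∈ S, p i) := by gcongr
      _ = 2 * ε * ∑ i ∈ S, p i := by push_cast; ring
  · intro i hi
    rw [Finset.mem_sdiff, hR, Finset.mem_filter] at hi
    have h2 : ¬ ((δ (j + 1) < f i ∧ f i ≤ δ j) ∨ (δ (j + 1) < g i ∧ g i ≤ δ j)) := fun h => hi.2 ⟨hi.1, h⟩
    push Not at h2
    constructor
    · by_cases h : f i ≤ δ (j + 1)
      · exact Or.inl h
      · exact Or.inr (h2.1 (not_le.1 h))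
    · by_cases h : g i ≤ δ (j + 1)
      · exact Or.inl h
      · exact Or.inr (h2.2 (not_le.1 h))

theorem RAt {θ : ℝ} {K : ℕ} (hK : RAProp ε θ K) (hp : ∀ i, 0 ≤ p i) {W H : ℝ} {S : Finset ι} (hP : Pk D W H S) :
    ∃ S' ⊆ S, ∑ i ∈ S \ S', p i ≤ 2 * ε * ∑ i ∈ S, p i ∧ Ct D ε NoM K ((1 + θ) * W) H S' := by
  obtain ⟨S', h1, h2, -, h3⟩ := hK ι D.T p S H W hp hP.tr
  exact ⟨S', h1, h2, h3.noM.tr⟩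

theorem trash {s : ℝ} (hs : 0 < s) (hs1 : s ≤ 1) {G : Finset ι} (hG : ∀ i ∈ G, D.w i ≤ D.h i ∧ D.h i ≤ 1)
    (ha : ∑ i ∈ G, D.w i * D.h i ≤ (s / 64) ^ 2) : Pk D (3 * s / 16) 1 G := by
  have hξ : (s / 64) ^ 2 ≤ s / 4096 := by nlinarith
  have ha' : ∀ T ⊆ G, ∑ i ∈ T, D.w i * D.h i ≤ (s / 64) ^ 2 := fun T hT =>
    (sum_mono_set (f := fun i => D.w i * D.h i) (fun i => mul_nonneg (D.w0 i) (D.h0 i)) hT).trans ha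
  set L := G.filter (fun i => 1 / 2 < D.h i) with hL
  set R := G.filter (fun i => ¬ 1 / 2 < D.h i) with hR
  have p1 : Pk D (s / 16) 1 L := by
    refine Pk.vstack (by positivity) zero_le_one (fun i hi => (hG i (Finset.mem_filter.1 hi).1).2) ?_
    have h1 : ∑ i ∈ L, D.w i ≤ ∑ i ∈ L, 2 * (D.w i * D.h i) := by
      refine Finset.sum_le_sum (fun i hi => ?_)
      have := (Finset.mem_filter.1 hi).2
      nlinarith [D.wpos i]
    rw [← Finset.mul_sum] at h1
    linarith [ha' L (Finset.filter_subset _ _)]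
  have p2 : Pk D (s / 8) 1 R := by
    refine (nf_pack D.T (s / 64) (s / 8) (by positivity) (by linarith) R (1 / 2) 1 (by norm_num) (by norm_num)
      ?_ ?_ ?_).tr
    · intro i hi
      have h1 := hG i (Finset.mem_filter.1 hi).1
      have h2 : D.w i * D.h i ≤ (s / 64) ^ 2 := (Finset.single_le_sum (f := fun i => D.w i * D.h i)
        (fun i _ => mul_nonneg (D.w0 i) (D.h0 i)) (Finset.mem_filter.1 hi).1).trans ha
      have h3 : (D.w i) ^ 2 ≤ (s / 64) ^ 2 := by nlinarith [D.wpos i]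
      exact le_of_sq_le_sq h3 (by positivity)
    · intro i hi
      exact not_lt.1 (Finset.mem_filter.1 hi).2
    · have e : ∑ i ∈ R, D.T.w i * D.T.h i = ∑ i ∈ R, D.w i * D.h i :=
        Finset.sum_congr rfl (fun i _ => mul_comm _ _)
      rw [e]
      linarith [ha' R (Finset.filter_subset _ _)]
  refine Pk.vcut p1 p2 (by linarith) ?_
  rw [hL, hR, Finset.filter_union_filter_not_eq]

/-- sorted dims on `X` -/
def Dims.srt (D : Dims ι) (X : Finset ι) : Dims ι where
  w := fun i => if i ∈ X then min (D.w i) (D.h i) else D.w i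
  h := fun i => if i ∈ X then max (D.w i) (D.h i) else D.h i
  wpos := by intro i; split_ifs; · exact lt_min (D.wpos i) (D.hpos i)
             · exact D.wpos i
  hpos := by intro i; split_ifs; · exact lt_max_of_lt_left (D.wpos i)
             · exact D.hpos i

theorem Dims.srt_rot (D : Dims ι) (X : Finset ι) : IsRot D (D.srt X) := by
  intro i
  simp only [Dims.srt]
  split_ifs
  · rcases le_total (D.w i) (D.h i) with h | h
    · simp [h]
    · simp [h]
  · simp

theorem II_side (hε : 0 < ε) (hp : ∀ i, 0 ≤ p i) {K1 K2 : ℕ} {s : ℝ} (hs : 0 < s) (hs1 : s ≤ 1 / 4)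
    (hK1 : RAProp ε (s / 2) K1) (hK2 : RAProp ε 1 K2) {T G : Finset ι} (hP : Pk D 1 1 T) (hG : G ⊆ T)
    (ha : ∑ i ∈ G, D.w i * D.h i ≤ (s / 64) ^ 2)
    (hW : ∑ i ∈ T.filter (fun i => 1 - s / 32 ≤ D.w i), D.h i ≤ s / 32)
    (hg : ∀ i ∈ T, 1 - s / 32 ≤ D.w i ∨ D.w i < 1 - 2 * s) :
    ∃ S' ⊆ T, ∃ D', IsRot D D' ∧ Ct D' ε NoM (K1 + K2) 1 1 S' ∧
      (∑ i ∈ G, p i + ∑ i ∈ T, p i) / 2 - 2 * ε * ∑ i ∈ T, p i ≤ ∑ i ∈ S', p i := by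
  set W := T.filter (fun i => 1 - s / 32 ≤ D.w i) with hWd
  have hWT : W ⊆ T := Finset.filter_subset _ _
  set X := W ∪ G with hX
  have hXT : X ⊆ T := Finset.union_subset hWT hG
  set D' := D.srt X with hD'
  have dimT := hP.dim_le
  have hw' : ∀ i ∈ X, D'.w i = min (D.w i) (D.h i) := fun i hi => if_pos hi
  have hh' : ∀ i ∈ X, D'.h i = max (D.w i) (D.h i) := fun i hi => if_pos hi
  have pG : Pk D' (3 * s / 16) 1 G := by
    refine trash hs (by linarith) ?_ ?_
    · intro i hi
      have hiX : i ∈ X := Finset.mem_union_right _ hi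
      rw [hw' i hiX, hh' i hiX]
      exact ⟨min_le_max, max_le (dimT i (hG hi)).1 (dimT i (hG hi)).2⟩
    · refine le_trans (le_of_eq ?_) ha
      refine Finset.sum_congr rfl (fun i hi => ?_)
      have hiX : i ∈ X := Finset.mem_union_right _ hi
      rw [hw' i hiX, hh' i hiX, min_mul_max]
  have pW : Pk D' (s / 32) 1 W := by
    refine Pk.vstack (by positivity) zero_le_one ?_ ?_
    · intro i hi
      rw [hh' i (Finset.mem_union_left _ hi)]
      exact max_le (dimT i (hWT hi)).1 (dimT i (hWT hi)).2
    · refine le_trans (Finset.sum_le_sum (fun i hi => ?_)) hW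
      rw [hw' i (Finset.mem_union_left _ hi)]
      exact min_le_right _ _
  have pX : Pk D' (s / 4) 1 X := Pk.vcut pW pG (by linarith) subset_rfl
  obtain ⟨X', x1, x2, x3⟩ := RAt hK2 hp pX
  set Y := T \ X with hY
  have hYw : ∀ i ∈ Y, D.w i < 1 - 2 * s := by
    intro i hi
    rw [hY, Finset.mem_sdiff] at hi
    rcases hg i hi.1 with h | h
    · exact absurd (Finset.mem_union_left _ (Finset.mem_filter.2 ⟨hi.1, h⟩)) hi.2
    · exact h
  have pY : Pk D 1 1 Y := hP.subset Finset.sdiff_subset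
  obtain ⟨a, a1, a2⟩ := pY.strip
  have key : ∃ Y1 ⊆ Y, Pk D (1 - s) 1 Y1 ∧ (∑ i ∈ Y, p i) / 2 ≤ ∑ i ∈ Y1, p i := by
    have b1 := a2 0 s le_rfl hs.le (by linarith)
    have b2 := a2 (1 - s) s (by linarith) hs.le (by linarith)
    set Y1 := Y.filter (fun i => a i + D.w i ≤ 0 ∨ 0 + s ≤ a i) with hY1
    set Y2 := Y.filter (fun i => a i + D.w i ≤ 1 - s ∨ 1 - s + s ≤ a i) with hY2
    have hc : Y ⊆ Y1 ∪ Y2 := by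
      intro i hi
      rw [Finset.mem_union, hY1, hY2, Finset.mem_filter, Finset.mem_filter]
      by_cases h : s ≤ a i
      · left; exact ⟨hi, Or.inr (by linarith)⟩
      · right; refine ⟨hi, Or.inl ?_⟩
        have := hYw i hi
        push Not at h
        linarith
    have := sum_cover_le (f := p) hp hc
    rcases le_total ((∑ i ∈ Y, p i) / 2) (∑ i ∈ Y1, p i) with h | h
    · exact ⟨Y1, Finset.filter_subset _ _, b1, h⟩
    · exact ⟨Y2, Finset.filter_subset _ _, b2, by linarith⟩
  obtain ⟨Y1, y1, y2, y3⟩ := key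
  obtain ⟨Y', z1, z2, z3⟩ := RAt hK1 hp (y2.congr (D' := D') (by
    intro i hi
    have : i ∉ X := (Finset.mem_sdiff.1 (y1 hi)).2
    exact ⟨(if_neg this).le, (if_neg this).le⟩))
  have dd : Disjoint X Y := Finset.disjoint_sdiff
  refine ⟨X' ∪ Y', Finset.union_subset (x1.trans hXT) ((z1.trans y1).trans Finset.sdiff_subset), D', D.srt_rot X,
    Ct.vcut z3 x3 ?_ (by rw [Finset.union_comm]) le_rfl, ?_⟩
  · nlinarith
  · rw [Finset.sum_union (dd.mono x1 (z1.trans y1))]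
    have e1 := sum_sdiff' (f := p) x1
    have e2 := sum_sdiff' (f := p) z1
    have e3 := sum_sdiff' (f := p) hXT
    have e4 := sum_mono_set (f := p) hp (Finset.subset_union_right : G ⊆ X)
    have e5 := mul_le_mul_of_nonneg_left (sum_mono_set (f := p) hp y1) hε.le
    rw [← hY] at e3
    rw [e3]
    linarith

theorem loss_inter (hp : ∀ i, 0 ≤ p i) {G S T : Finset ι} (hG : G ⊆ S) :
    ∑ i ∈ G, p i ≤ ∑ i ∈ G ∩ T, p i + ∑ i ∈ S \ T, p i := by
  rw [sum_split G T p]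
  have := sum_mono_set (f := p) hp (Finset.sdiff_subset_sdiff hG (subset_refl T))
  linarith

end

theorem OptII (ε : ℝ) (hε : 0 < ε) (hε1 : ε ≤ 1 / 2) :
    ∃ (ξ : ℝ) (K : ℕ), 0 < ξ ∧ ξ ≤ 1 ∧ ∀ (ι : Type) [DecidableEq ι] (D : Dims ι) (p : ι → ℝ) (S G : Finset ι),
      (∀ i, 0 ≤ p i) → Pk D 1 1 S → (∀ i ∈ S, ¬ (1 - ε ≤ D.w i ∧ 1 - ε ≤ D.h i)) → G ⊆ S →
      ∑ i ∈ G, D.w i * D.h i ≤ ξ →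
      ∃ S' ⊆ S, ∃ D', IsRot D D' ∧ Ct D' ε NoM K 1 1 S' ∧
        (∑ i ∈ G, p i + ∑ i ∈ S, p i) / 2 - 4 * ε * ∑ i ∈ S, p i ≤ ∑ i ∈ S', p i := by
  let δ : ℕ → ℝ := fun k => ε / 2 / 64 ^ k
  have hδ0 : ∀ k, 0 < δ k := fun k => by simp only [δ]; positivity
  have hδs : ∀ k, δ (k + 1) = δ k / 64 := fun k => by simp only [δ]; rw [pow_succ]; field_simp
  have hδ : ∀ k, δ (k + 1) ≤ δ k := fun k => by rw [hδs]; linarith [hδ0 k]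
  have han : Antitone δ := antitone_nat_of_succ_le hδ
  have hδ1 : ∀ k, δ k ≤ ε / 2 := fun k => (han (Nat.zero_le k)).trans (by simp [δ])
  have hR := fun k => RA ε (δ k / 2 / 2) hε hε1 (by have := hδ0 k; positivity) (by linarith [hδ1 k])
  choose K1 hK1 using hR
  obtain ⟨K2, hK2⟩ := RA ε 1 hε hε1 one_pos le_rfl
  set n := ⌈1 / ε⌉₊ with hn
  refine ⟨(δ n / 2 / 64) ^ 2, (∑ k ∈ Finset.range n, K1 k) + K2, ?_, ?_, ?_⟩
  · have := hδ0 n; positivity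
  · have := hδ0 n
    have := hδ1 n
    exact pow_le_one₀ (by positivity) (by linarith)
  intro ι _ D p S G hp hP hm hG ha
  obtain ⟨j, hj, T, hT, hl, hb⟩ := bandFG hε hp S (fun i => 1 - D.w i) (fun i => 1 - D.h i) δ hδ
  have hs0 := hδ0 j
  have hs1 := hδ1 j
  have hss := hδs j
  have hPT := hP.subset hT
  have hGT : G ∩ T ⊆ T := Finset.inter_subset_right
  have ha' : ∑ i ∈ G ∩ T, D.w i * D.h i ≤ (δ j / 2 / 64) ^ 2 := by
    refine (sum_mono_set (f := fun i => D.w i * D.h i) (fun i => mul_nonneg (D.w0 i) (D.h0 i))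
      Finset.inter_subset_left).trans (ha.trans ?_)
    have h1 := hδ0 n
    have h2 : δ n ≤ δ j := han hj.le
    gcongr
  have hkk : K1 j + K2 ≤ (∑ k ∈ Finset.range n, K1 k) + K2 := by
    have := le_sum_range K1 n j hj
    omega
  have fin : ∀ S' : Finset ι, (∑ i ∈ G ∩ T, p i + ∑ i ∈ T, p i) / 2 - 2 * ε * ∑ i ∈ T, p i ≤ ∑ i ∈ S', p i →
      (∑ i ∈ G, p i + ∑ i ∈ S, p i) / 2 - 4 * ε * ∑ i ∈ S, p i ≤ ∑ i ∈ S', p i := by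
    intro S' h
    have e1 := loss_inter (p := p) hp (T := T) hG
    have e2 := sum_sdiff' (f := p) hT
    have e3 := mul_le_mul_of_nonneg_left (sum_mono_set (f := p) hp hT) hε.le
    linarith
  have hwt := hPT.wide_tall (1 - δ j / 2 / 32) (1 - δ j / 2 / 32) (fun i hi h => hm i (hT hi)
    ⟨by linarith [h.1], by linarith [h.2]⟩) (by linarith) (by linarith)
  have hmax : max (1 - (1 - δ j / 2 / 32)) 0 = δ j / 2 / 32 := by
    rw [max_eq_left (by linarith)]; ring
  rw [hmax] at hwt
  rcases hwt with h | h
  · obtain ⟨S', s1, D', s2, s3, s4⟩ := II_side (s := δ j / 2) hε hp (by linarith) (by linarith) (hK1 j) hK2 hPT hGT ha' h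
      (by
        intro i hi
        rcases (hb i hi).1 with h | h
        · left; rw [hss] at h; linarith
        · right; linarith)
    exact ⟨S', s1.trans hT, D', s2, s3.mono hε.le hkk le_rfl le_rfl, fin S' s4⟩
  · obtain ⟨S', s1, D', s2, s3, s4⟩ := II_side (D := D.T) (s := δ j / 2) hε hp (by linarith) (by linarith) (hK1 j) hK2
      hPT.tr hGT (le_trans (le_of_eq (Finset.sum_congr rfl (fun i _ => mul_comm _ _))) ha') h
      (by
        intro i hi
        rcases (hb i hi).2 with h | h
        · left; rw [hss] at h; show 1 - δ j / 2 / 32 ≤ D.h i; linarith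
        · right; show D.h i < _; linarith)
    exact ⟨S', s1.trans hT, D', s2.ofT, s3.mono hε.le hkk le_rfl le_rfl, fin S' s4⟩

section
variable {ι : Type} [DecidableEq ι] {D : Dims ι} {ε : ℝ} {p : ι → ℝ}

theorem prot_set1 {Q Q1 Q2 E G1 : Finset ι} (hQ : Q ⊆ Q1 ∪ Q2) :
    Q ∪ E ⊆ (Q1 ∪ E ∩ G1) ∪ (Q2 ∪ E \ G1) := by
  intro i
  have h3 := @hQ i
  simp only [Finset.mem_union, Finset.mem_inter, Finset.mem_sdiff] at *
  tauto

theorem prot_set2 {G G1 G2 E : Finset ι} (hG : G ⊆ G1 ∪ G2) :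
    G \ E ⊆ (G1 \ (E ∩ G1)) ∪ (G2 \ (E \ G1)) := by
  intro i
  have h3 := @hG i
  simp only [Finset.mem_union, Finset.mem_inter, Finset.mem_sdiff] at *
  tauto

theorem prot_card {E G1 : Finset ι} : (E ∩ G1).card + (E \ G1).card = E.card := Finset.card_inter_add_card_sdiff E G1

theorem PkO.protect {K n : ℕ} (hK : 1 ≤ K) {w h : ℝ} {Q G : Finset ι} (hP : PkO D ε K n w h Q G) :
    ∀ E ⊆ G, PkO D ε K (n + E.card) w h (Q ∪ E) (G \ E) := by
  induction hP with
  | @leaf n w h Q G h1 h2 h3 h4 h5 =>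
    intro E hE
    subst h3
    rcases E.eq_empty_or_nonempty with rfl | hne
    · exact PkO.leaf h1 h2 (by simp) (by simpa using h4) (by simpa using h5)
    · have hc : 1 ≤ E.card := hne.card_pos
      have hEG : E = G := Finset.eq_of_subset_of_card_le hE (by omega)
      subst hEG
      refine PkO.sol (by omega) ?_ (by simp)
      rw [Finset.empty_union]
      obtain ⟨x, hx⟩ := Finset.card_eq_one.1 (le_antisymm h4 hc)
      subst hx
      have := h5 x (by simp)
      exact Ct.vstack hK h1 h2 (fun i hi => (h5 i hi).2) (by simpa using this.1)
  | @sol n w h Q G h1 h2 h3 =>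
    intro E hE
    subst h3
    have := Finset.subset_empty.1 hE
    subst this
    exact PkO.sol (by omega) (by simpa using h2) (by simp)
  | vcut _ _ hw hQ hG hn i1 i2 =>
    intro E hE
    rename_i n n1 n2 w h w1 w2 Q Q1 Q2 G G1 G2 _ _
    have := prot_card (E := E) (G1 := G1)
    exact PkO.vcut (i1 (E ∩ G1) Finset.inter_subset_right) (i2 (E \ G1) (sub_of_cover (hE.trans hG))) hw
      (prot_set1 hQ) (prot_set2 hG) (by omega)
  | hcut _ _ hw hQ hG hn i1 i2 =>
    intro E hE
    rename_i n n1 n2 w h w1 w2 Q Q1 Q2 G G1 G2 _ _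
    have := prot_card (E := E) (G1 := G1)
    exact PkO.hcut (i1 (E ∩ G1) Finset.inter_subset_right) (i2 (E \ G1) (sub_of_cover (hE.trans hG))) hw
      (prot_set1 hQ) (prot_set2 hG) (by omega)

theorem few_exp (hp : ∀ i, 0 ≤ p i) {e : ℝ} (he : 0 < e) {S E : Finset ι} (hE : E ⊆ S)
    (h : ∀ i ∈ E, e * ∑ i ∈ S, p i < p i) : E.card ≤ ⌈1 / e⌉₊ := by
  rcases E.eq_empty_or_nonempty with rfl | ⟨x, hx⟩
  · simp
  set P := ∑ i ∈ S, p i with hP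
  have hxP : p x ≤ P := Finset.single_le_sum (fun i _ => hp i) (hE hx)
  have hP0 : 0 ≤ P := (hp x).trans hxP
  have hPpos : 0 < P := by
    have h1 := h x hx
    have : 0 ≤ e * P := by positivity
    linarith
  have h1 : (E.card : ℝ) * (e * P) ≤ P := by
    calc (E.card : ℝ) * (e * P) = ∑ i ∈ E, e * P := by rw [Finset.sum_const, nsmul_eq_mul]
      _ ≤ ∑ i ∈ E, p i := Finset.sum_le_sum (fun i hi => (h i hi).le)
      _ ≤ P := sum_mono_set (f := p) hp hE
  have h2 : (E.card : ℝ) * e ≤ 1 := by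
    by_contra hc
    push Not at hc
    nlinarith
  have h3 : (E.card : ℝ) ≤ 1 / e := by rw [le_div_iff₀ he]; exact h2
  exact_mod_cast h3.trans (Nat.le_ceil _)

end

theorem OptI (ε : ℝ) (hε : 0 < ε) (hε1 : ε ≤ 1 / 2) (K0 n : ℕ) :
    ∃ (K : ℕ), ∀ (ι : Type) [DecidableEq ι] (D : Dims ι) (p : ι → ℝ) (S Q G : Finset ι),
      (∀ i, 0 ≤ p i) → Q ⊆ S → G ⊆ S → Disjoint Q G → PkO D ε K0 n 1 1 Q G →
      ∃ S' ⊆ S, Ct D ε NoM K 1 1 S' ∧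
        ∑ i ∈ Q, p i + (∑ i ∈ G, p i) / 2 - 8 * ε * ∑ i ∈ S, p i ≤ ∑ i ∈ S', p i := by
  have hL := fun m : ℕ => LemI ε hε hε1 (K0 + 1) m
  choose Kn cn hcn hLI using hL
  let es : ℕ → {x : ℝ // 0 < x} := fun k => Nat.rec ⟨1, one_pos⟩
    (fun _ x => ⟨min x.1 (ε / (cn (n + ⌈1 / x.1⌉₊) + 1)), lt_min x.2 (by
      have := hcn (n + ⌈1 / x.1⌉₊); positivity)⟩) k
  have hes : ∀ k, (es (k + 1)).1 = min (es k).1 (ε / (cn (n + ⌈1 / (es k).1⌉₊) + 1)) := fun k => rfl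
  set N := ⌈1 / ε⌉₊ with hN
  refine ⟨∑ k ∈ Finset.range N, Kn (n + ⌈1 / (es k).1⌉₊), ?_⟩
  intro ι _ D p S Q G hp hQS hGS hd hP
  set P := ∑ i ∈ S, p i with hPd
  have hP0 : 0 ≤ P := Finset.sum_nonneg (fun i _ => hp i)
  obtain ⟨j, hj, hl⟩ := band2 ε hε p hp G p (fun k => (es k).1 * P) (fun k => by
    rw [hes]; exact mul_le_mul_of_nonneg_right (min_le_left _ _) hP0)
  set G0 := G.filter (fun i => p i ≤ (es (j + 1)).1 * P ∨ (es j).1 * P < p i) with hG0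
  have hG0G : G0 ⊆ G := Finset.filter_subset _ _
  set E := G0.filter (fun i => (es j).1 * P < p i) with hE
  have hEG : E ⊆ G0 := Finset.filter_subset _ _
  have hcard : E.card ≤ ⌈1 / (es j).1⌉₊ := few_exp hp (es j).2 ((hEG.trans hG0G).trans hGS)
    (fun i hi => (Finset.mem_filter.1 hi).2)
  have hP1 : PkO D ε (K0 + 1) (n + ⌈1 / (es j).1⌉₊) 1 1 (Q ∪ E) (G0 \ E) := by
    have h1 := (hP.subset subset_rfl hG0G).mono hε.le (Nat.le_succ K0) le_rfl le_rfl le_rfl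
    exact (h1.protect (by omega) E hEG).mono hε.le le_rfl (by omega) le_rfl le_rfl
  have hdisj : Disjoint (Q ∪ E) (G0 \ E) := by
    rw [Finset.disjoint_union_left]
    exact ⟨hd.mono_right (Finset.sdiff_subset.trans hG0G), Finset.disjoint_sdiff⟩
  obtain ⟨G1, g1, G2, g2, c1, c2, e⟩ := hLI (n + ⌈1 / (es j).1⌉₊) ι D p ((es (j + 1)).1 * P) 1 1 (Q ∪ E) (G0 \ E) hp
    (mul_nonneg (es (j + 1)).2.le hP0) (by
      intro i hi
      have hi2 := Finset.mem_sdiff.1 hi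
      rcases (Finset.mem_filter.1 hi2.1).2 with h | h
      · exact h
      · exact absurd (Finset.mem_filter.2 ⟨hi2.1, h⟩) hi2.2) hdisj hP1
  have hsmall : cn (n + ⌈1 / (es j).1⌉₊) * ((es (j + 1)).1 * P) ≤ ε * P := by
    have hc := hcn (n + ⌈1 / (es j).1⌉₊)
    have h1 : (es (j + 1)).1 ≤ ε / (cn (n + ⌈1 / (es j).1⌉₊) + 1) := by rw [hes]; exact min_le_right _ _
    have h2 : cn (n + ⌈1 / (es j).1⌉₊) * (es (j + 1)).1 ≤ ε := by
      rw [le_div_iff₀ (by positivity)] at h1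
      nlinarith [(es (j + 1)).2]
    calc _ = (cn (n + ⌈1 / (es j).1⌉₊) * (es (j + 1)).1) * P := by ring
      _ ≤ ε * P := by gcongr
  have hsub : ∀ X ⊆ G0 \ E, (Q ∪ E) ∪ X ⊆ S := fun X hX => Finset.union_subset
    (Finset.union_subset hQS ((hEG.trans hG0G).trans hGS)) (((hX.trans Finset.sdiff_subset).trans hG0G).trans hGS)
  have hsum : ∀ X ⊆ G0 \ E, ∑ i ∈ (Q ∪ E) ∪ X, p i = ∑ i ∈ Q, p i + ∑ i ∈ E, p i + ∑ i ∈ X, p i := by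
    intro X hX
    rw [Finset.sum_union (hdisj.mono_right hX), Finset.sum_union (hd.mono_right (hEG.trans hG0G))]
  have hKj : Kn (n + ⌈1 / (es j).1⌉₊) ≤ ∑ k ∈ Finset.range N, Kn (n + ⌈1 / (es k).1⌉₊) :=
    le_sum_range (fun k => Kn (n + ⌈1 / (es k).1⌉₊)) N j hj
  have f1 := sum_sdiff' (f := p) hG0G
  have f2 := sum_sdiff' (f := p) hEG
  have f3 := mul_le_mul_of_nonneg_left (sum_mono_set (f := p) hp hGS) hε.le
  have f4 := mul_le_mul_of_nonneg_left (sum_mono_set (f := p) hp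
    ((Finset.sdiff_subset.trans hG0G).trans hGS : G0 \ E ⊆ S)) hε.le
  have f5 : 0 ≤ ∑ i ∈ E, p i := Finset.sum_nonneg (fun i _ => hp i)
  have f6 : 0 ≤ ε * P := by positivity
  rw [← hPd] at f3 f4
  rcases le_total (∑ i ∈ G1, p i) (∑ i ∈ G2, p i) with h | h
  · refine ⟨_, hsub G2 g2, c2.mono hε.le hKj le_rfl le_rfl, ?_⟩
    rw [hsum G2 g2]
    linarith
  · refine ⟨_, hsub G1 g1, c1.mono hε.le hKj le_rfl le_rfl, ?_⟩
    rw [hsum G1 g1]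
    linarith

theorem UnitThm (ε : ℝ) (hε : 0 < ε) (hε1 : ε ≤ 1 / 2) :
    ∃ (K : ℕ), ∀ (ι : Type) [DecidableEq ι] (D : Dims ι) (p : ι → ℝ) (S : Finset ι),
      (∀ i, 0 ≤ p i) → Pk D 1 1 S → (∀ i ∈ S, ¬ (1 - ε ≤ D.w i ∧ 1 - ε ≤ D.h i)) →
      ∃ S' ⊆ S, ∃ D', IsRot D D' ∧ Ct D' ε NoM K 1 1 S' ∧
        (3 / 4 - 10 * ε) * ∑ i ∈ S, p i ≤ ∑ i ∈ S', p i := by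
  obtain ⟨ξ, K2, hξ, hξ1, H2⟩ := OptII ε hε hε1
  obtain ⟨K0, n, HT⟩ := LemT ε ξ hε hε1 hξ hξ1
  obtain ⟨K1, H1⟩ := OptI ε hε hε1 K0 n
  refine ⟨K1 + K2, ?_⟩
  intro ι _ D p S hp hP hm
  obtain ⟨Q, G, hQ, hG, hd, hO, ha, hl⟩ := HT ι D p S hp hP
  obtain ⟨S1, s1, c1, e1⟩ := H1 ι D p S Q G hp hQ hG hd hO
  obtain ⟨S2, s2, D', r2, c2, e2⟩ := H2 ι D p S G hp hP hm hG ha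
  have f1 := sum_sdiff' (f := p) (Finset.union_subset hQ hG)
  rw [Finset.sum_union hd] at f1
  have f2 : 0 ≤ ε * ∑ i ∈ S, p i := mul_nonneg hε.le (Finset.sum_nonneg (fun i _ => hp i))
  rcases le_total (∑ i ∈ S1, p i) (∑ i ∈ S2, p i) with h | h
  · exact ⟨S2, s2, D', r2, c2.mono hε.le (by omega) le_rfl le_rfl, by linarith⟩
  · exact ⟨S1, s1, D, IsRot.rfl', c1.mono hε.le (by omega) le_rfl le_rfl, by linarith⟩

section Place
variable {ι : Type} [DecidableEq ι]

theorem GS_trans {p : ι → Rect} {P : Rect} {S : Finset ι} (hg : GuillotineSep p P S) :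
    ∀ (q : ι → Rect) (Q : Rect) (T : Finset ι), T ⊆ S → P.SubRect Q →
      (∀ i ∈ T, (q i).x2 = (p i).x2 ∧ (q i).y2 = (p i).y2 ∧ (p i).x1 ≤ (q i).x1 ∧
        (p i).y1 ≤ (q i).y1) → GuillotineSep q Q T := by
  induction hg with
  | base P S hS =>
    intro q Q T hT _ _
    exact GuillotineSep.base _ _ ((Finset.card_le_card hT).trans hS)
  | vcut P S c h1 h2 hc hL hR iL iR =>
    intro q Q T hT hPQ hq
    obtain ⟨a1, a2, a3, a4⟩ := hPQ
    refine GuillotineSep.vcut Q T c (lt_of_le_of_lt a1 h1) (lt_of_lt_of_le h2 a2) ?_ ?_ ?_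
    · intro i hi
      obtain ⟨b1, b2, b3, b4⟩ := hq i hi
      rcases hc i (hT hi) with h | h
      · left; rw [b1]; exact h
      · right; exact h.trans b3
    · refine iL q _ _ ?_ ⟨a1, le_rfl, a3, a4⟩ (fun i hi => hq i (Finset.mem_filter.1 hi).1)
      intro i hi
      rw [Finset.mem_filter] at hi ⊢
      exact ⟨hT hi.1, by rw [← (hq i hi.1).1]; exact hi.2⟩
    · refine iR q _ _ ?_ ⟨le_rfl, a2, a3, a4⟩ (fun i hi => hq i (Finset.mem_filter.1 hi).1)
      intro i hi
      rw [Finset.mem_filter] at hi ⊢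
      exact ⟨hT hi.1, by rw [← (hq i hi.1).1]; exact hi.2⟩
  | hcut P S c h1 h2 hc hL hR iL iR =>
    intro q Q T hT hPQ hq
    obtain ⟨a1, a2, a3, a4⟩ := hPQ
    refine GuillotineSep.hcut Q T c (lt_of_le_of_lt a3 h1) (lt_of_lt_of_le h2 a4) ?_ ?_ ?_
    · intro i hi
      obtain ⟨b1, b2, b3, b4⟩ := hq i hi
      rcases hc i (hT hi) with h | h
      · left; rw [b2]; exact h
      · right; exact h.trans b4
    · refine iL q _ _ ?_ ⟨a1, a2, a3, le_rfl⟩ (fun i hi => hq i (Finset.mem_filter.1 hi).1)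
      intro i hi
      rw [Finset.mem_filter] at hi ⊢
      exact ⟨hT hi.1, by rw [← (hq i hi.1).2.1]; exact hi.2⟩
    · refine iR q _ _ ?_ ⟨a1, a2, le_rfl, a4⟩ (fun i hi => hq i (Finset.mem_filter.1 hi).1)
      intro i hi
      rw [Finset.mem_filter] at hi ⊢
      exact ⟨hT hi.1, by rw [← (hq i hi.1).2.1]; exact hi.2⟩

theorem GS_congr {p q : ι → Rect} {P Q : Rect} {S T : Finset ι} (hg : GuillotineSep p P S)
    (hT : T ⊆ S) (hPQ : P.SubRect Q) (h : ∀ i ∈ T, q i = p i) : GuillotineSep q Q T :=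
  GS_trans hg q Q T hT hPQ (fun i hi => by rw [h i hi]; exact ⟨rfl, rfl, le_rfl, le_rfl⟩)

theorem disj_x {r s : Rect} (h : r.x2 ≤ s.x1) : Disjoint r.toSet s.toSet := by
  rw [Set.disjoint_left]
  rintro ⟨a, b⟩ h1 h2
  simp only [Rect.toSet, Set.mem_setOf_eq] at h1 h2
  linarith [h1.2.1, h2.1]

theorem disj_y {r s : Rect} (h : r.y2 ≤ s.y1) : Disjoint r.toSet s.toSet := by
  rw [Set.disjoint_left]
  rintro ⟨a, b⟩ h1 h2
  simp only [Rect.toSet, Set.mem_setOf_eq] at h1 h2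
  linarith [h1.2.2.2, h2.2.2.1]

theorem disj_deg {r s : Rect} (h : r.x2 ≤ r.x1) : Disjoint r.toSet s.toSet := by
  rw [Set.disjoint_left]
  rintro ⟨a, b⟩ h1 h2
  simp only [Rect.toSet, Set.mem_setOf_eq] at h1 h2
  linarith [h1.1, h1.2.1]

theorem GS_disj {p : ι → Rect} {P : Rect} {S : Finset ι} (hg : GuillotineSep p P S) :
    ∀ i ∈ S, ∀ j ∈ S, i ≠ j → Disjoint (p i).toSet (p j).toSet := by
  induction hg with
  | base P S hS =>
    intro i hi j hj hij
    exact absurd (Finset.card_le_one.1 hS i hi j hj) hij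
  | vcut P S c h1 h2 hc hL hR iL iR =>
    intro i hi j hj hij
    by_cases hi2 : (p i).x2 ≤ c <;> by_cases hj2 : (p j).x2 ≤ c
    · exact iL i (Finset.mem_filter.2 ⟨hi, hi2⟩) j (Finset.mem_filter.2 ⟨hj, hj2⟩) hij
    · exact disj_x (hi2.trans ((hc j hj).resolve_left hj2))
    · exact (disj_x (hj2.trans ((hc i hi).resolve_left hi2))).symm
    · exact iR i (Finset.mem_filter.2 ⟨hi, hi2⟩) j (Finset.mem_filter.2 ⟨hj, hj2⟩) hij
  | hcut P S c h1 h2 hc hL hR iL iR =>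
    intro i hi j hj hij
    by_cases hi2 : (p i).y2 ≤ c <;> by_cases hj2 : (p j).y2 ≤ c
    · exact iL i (Finset.mem_filter.2 ⟨hi, hi2⟩) j (Finset.mem_filter.2 ⟨hj, hj2⟩) hij
    · exact disj_y (hi2.trans ((hc j hj).resolve_left hj2))
    · exact (disj_y (hj2.trans ((hc i hi).resolve_left hi2))).symm
    · exact iR i (Finset.mem_filter.2 ⟨hi, hi2⟩) j (Finset.mem_filter.2 ⟨hj, hj2⟩) hij

/-- transposed rectangle -/
def rtr (r : Rect) : Rect := ⟨r.y1, r.y2, r.x1, r.x2⟩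

theorem SubRect_tr {r s : Rect} (h : r.SubRect s) : (rtr r).SubRect (rtr s) :=
  ⟨h.2.2.1, h.2.2.2, h.1, h.2.1⟩

theorem SubRect_trans {r s t : Rect} (h : r.SubRect s) (h' : s.SubRect t) : r.SubRect t :=
  ⟨h'.1.trans h.1, h.2.1.trans h'.2.1, h'.2.2.1.trans h.2.2.1, h.2.2.2.trans h'.2.2.2⟩

theorem SubRect_refl (r : Rect) : r.SubRect r := ⟨le_rfl, le_rfl, le_rfl, le_rfl⟩

theorem disj_tr {r s : Rect} (h : Disjoint r.toSet s.toSet) :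
    Disjoint (rtr r).toSet (rtr s).toSet := by
  rw [Set.disjoint_left] at h ⊢
  rintro ⟨a, b⟩ h1 h2
  refine @h (b, a) ?_ ?_
  · exact ⟨h1.2.2.1, h1.2.2.2, h1.1, h1.2.1⟩
  · exact ⟨h2.2.2.1, h2.2.2.2, h2.1, h2.2.1⟩

theorem GS_tr {p : ι → Rect} {P : Rect} {S : Finset ι} (hg : GuillotineSep p P S) :
    GuillotineSep (fun i => rtr (p i)) (rtr P) S := by
  induction hg with
  | base P S hS => exact GuillotineSep.base _ _ hS
  | vcut P S c h1 h2 hc hL hR iL iR => exact GuillotineSep.hcut _ S c h1 h2 hc iL iR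
  | hcut P S c h1 h2 hc hL hR iL iR => exact GuillotineSep.vcut _ S c h1 h2 hc iL iR

/-- a positioned guillotine packing with exact dimensions -/
def Fit (D : Dims ι) (P : Rect) (S : Finset ι) (p : ι → Rect) : Prop :=
  (∀ i ∈ S, (p i).width = D.w i ∧ (p i).height = D.h i ∧ (p i).SubRect P) ∧ GuillotineSep p P S

theorem Fit.tr {D : Dims ι} {P : Rect} {S : Finset ι} {p : ι → Rect} (h : Fit D P S p) :
    Fit D.T (rtr P) S (fun i => rtr (p i)) :=
  ⟨fun i hi => ⟨(h.1 i hi).2.1, (h.1 i hi).1, SubRect_tr (h.1 i hi).2.2⟩, GS_tr h.2⟩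

theorem Fit.mono {D : Dims ι} {P Q : Rect} {S T : Finset ι} {p : ι → Rect} (h : Fit D P S p)
    (hT : T ⊆ S) (hPQ : P.SubRect Q) : Fit D Q T p :=
  ⟨fun i hi => ⟨(h.1 i (hT hi)).1, (h.1 i (hT hi)).2.1, SubRect_trans (h.1 i (hT hi)).2.2 hPQ⟩,
    GS_congr h.2 hT hPQ (fun _ _ => rfl)⟩

theorem Fit.glue {D : Dims ι} {x0 x1 y0 y1 c : ℝ} {S1 S2 : Finset ι} {p1 p2 : ι → Rect}
    (f1 : Fit D ⟨x0, c, y0, y1⟩ S1 p1) (f2 : Fit D ⟨c, x1, y0, y1⟩ S2 p2)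
    (hd : Disjoint S1 S2) (h0 : x0 ≤ c) (h1 : c ≤ x1) :
    Fit D ⟨x0, x1, y0, y1⟩ (S1 ∪ S2) (fun i => if i ∈ S1 then p1 i else p2 i) := by
  have s1 : Rect.SubRect ⟨x0, c, y0, y1⟩ ⟨x0, x1, y0, y1⟩ := ⟨le_rfl, h1, le_rfl, le_rfl⟩
  have s2 : Rect.SubRect ⟨c, x1, y0, y1⟩ ⟨x0, x1, y0, y1⟩ := ⟨h0, le_rfl, le_rfl, le_rfl⟩
  have e1 : ∀ i ∈ S1, (if i ∈ S1 then p1 i else p2 i) = p1 i := fun i hi => if_pos hi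
  have e2 : ∀ i ∈ S2, (if i ∈ S1 then p1 i else p2 i) = p2 i := fun i hi =>
    if_neg (fun h => Finset.disjoint_left.1 hd h hi)
  refine ⟨?_, ?_⟩
  · intro i hi
    rcases Finset.mem_union.1 hi with h | h
    · show Rect.width (if i ∈ S1 then p1 i else p2 i) = _ ∧ Rect.height (if i ∈ S1 then p1 i else p2 i) = _ ∧
        Rect.SubRect (if i ∈ S1 then p1 i else p2 i) _
      rw [e1 i h]
      exact ⟨(f1.1 i h).1, (f1.1 i h).2.1, SubRect_trans (f1.1 i h).2.2 s1⟩
    · show Rect.width (if i ∈ S1 then p1 i else p2 i) = _ ∧ Rect.height (if i ∈ S1 then p1 i else p2 i) = _ ∧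
        Rect.SubRect (if i ∈ S1 then p1 i else p2 i) _
      rw [e2 i h]
      exact ⟨(f2.1 i h).1, (f2.1 i h).2.1, SubRect_trans (f2.1 i h).2.2 s2⟩
  · rcases S1.eq_empty_or_nonempty with hS1 | ⟨a, ha⟩
    · have : S1 ∪ S2 = S2 := by rw [hS1, Finset.empty_union]
      rw [this]
      exact GS_congr f2.2 subset_rfl s2 e2
    rcases S2.eq_empty_or_nonempty with hS2 | ⟨b, hb⟩
    · have : S1 ∪ S2 = S1 := by rw [hS2, Finset.union_empty]
      rw [this]
      exact GS_congr f1.2 subset_rfl s1 e1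
    have hL : ∀ i ∈ S1, (p1 i).x2 ≤ c := fun i hi => (f1.1 i hi).2.2.2.1
    have hR : ∀ i ∈ S2, c ≤ (p2 i).x1 ∧ c < (p2 i).x2 := by
      intro i hi
      have t1 : c ≤ (p2 i).x1 := (f2.1 i hi).2.2.1
      have t2 := (f2.1 i hi).1
      have t3 := D.wpos i
      unfold Rect.width at t2
      exact ⟨t1, by linarith⟩
    have hx0 : x0 < c := by
      have t1 : x0 ≤ (p1 a).x1 := (f1.1 a ha).2.2.1
      have t2 := (f1.1 a ha).1
      have t3 := D.wpos a
      have t4 := hL a ha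
      unfold Rect.width at t2
      linarith
    have hx1 : c < x1 := (hR b hb).2.trans_le (f2.1 b hb).2.2.2.1
    refine GuillotineSep.vcut _ _ c hx0 hx1 ?_ ?_ ?_
    · intro i hi
      rcases Finset.mem_union.1 hi with h | h
      · left
        show Rect.x2 (if i ∈ S1 then p1 i else p2 i) ≤ c
        rw [e1 i h]; exact hL i h
      · right
        show c ≤ Rect.x1 (if i ∈ S1 then p1 i else p2 i)
        rw [e2 i h]; exact (hR i h).1
    · have hsub : ((S1 ∪ S2).filter fun i => Rect.x2 (if i ∈ S1 then p1 i else p2 i) ≤ c) ⊆ S1 := by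
        intro i hi
        obtain ⟨u, v⟩ := Finset.mem_filter.1 hi
        rcases Finset.mem_union.1 u with h | h
        · exact h
        · rw [e2 i h] at v
          exact absurd v (not_le.2 (hR i h).2)
      exact GS_congr f1.2 hsub (SubRect_refl _) (fun i hi => e1 i (hsub hi))
    · have hsub : ((S1 ∪ S2).filter fun i => ¬ Rect.x2 (if i ∈ S1 then p1 i else p2 i) ≤ c) ⊆ S2 := by
        intro i hi
        obtain ⟨u, v⟩ := Finset.mem_filter.1 hi
        rcases Finset.mem_union.1 u with h | h
        · rw [e1 i h] at v
          exact absurd (hL i h) v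
        · exact h
      exact GS_congr f2.2 hsub (SubRect_refl _) (fun i hi => e2 i (hsub hi))

theorem cover_split1 {S S1 S2 : Finset ι} : S ∩ S1 ⊆ S1 := Finset.inter_subset_right
theorem cover_split2 {S S1 S2 : Finset ι} (h : S ⊆ S1 ∪ S2) : S \ S1 ⊆ S2 := by
  intro i hi
  obtain ⟨a, b⟩ := Finset.mem_sdiff.1 hi
  exact (Finset.mem_union.1 (h a)).resolve_left b
theorem cover_split3 {S S1 : Finset ι} : S ∩ S1 ∪ S \ S1 = S := by
  rw [Finset.union_comm]; exact Finset.sdiff_union_inter S S1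
theorem cover_split4 {S S1 : Finset ι} : Disjoint (S ∩ S1) (S \ S1) :=
  (Finset.disjoint_sdiff_inter S S1).symm

theorem PkFit_v {D : Dims ι} {w h w1 w2 x0 y0 : ℝ} {S S1 S2 : Finset ι} {p1 p2 : ι → Rect}
    (hw1 : 0 ≤ w1) (hw2 : 0 ≤ w2)
    (f1 : Fit D ⟨x0, x0 + w1, y0, y0 + h⟩ S1 p1)
    (f2 : Fit D ⟨x0 + w1, x0 + w1 + w2, y0, y0 + h⟩ S2 p2)
    (hw : w1 + w2 ≤ w) (hS : S ⊆ S1 ∪ S2) : ∃ p, Fit D ⟨x0, x0 + w, y0, y0 + h⟩ S p := by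
  have g1 := f1.mono (T := S ∩ S1) Finset.inter_subset_right (SubRect_refl _)
  have g2 := f2.mono (T := S \ S1) (Q := ⟨x0 + w1, x0 + w, y0, y0 + h⟩) (cover_split2 hS)
    ⟨le_rfl, by show x0 + w1 + w2 ≤ x0 + w; linarith, le_rfl, le_rfl⟩
  have g3 := g1.glue g2 cover_split4 (by linarith) (by linarith)
  rw [cover_split3] at g3
  exact ⟨_, g3⟩

theorem PkFit {D : Dims ι} {w h : ℝ} {S : Finset ι} (hp : Pk D w h S) :
    ∀ x0 y0, ∃ p, Fit D ⟨x0, x0 + w, y0, y0 + h⟩ S p := by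
  induction hp with
  | @leaf w h S hw hh hS hd =>
    intro x0 y0
    refine ⟨fun i => ⟨x0, x0 + D.w i, y0, y0 + D.h i⟩, ?_, GuillotineSep.base _ _ hS⟩
    intro i hi
    obtain ⟨a, b⟩ := hd i hi
    refine ⟨by simp [Rect.width], by simp [Rect.height], le_rfl, ?_, le_rfl, ?_⟩
    · show x0 + D.w i ≤ x0 + w
      linarith
    · show y0 + D.h i ≤ y0 + h
      linarith
  | vcut h1 h2 hw hS i1 i2 =>
    intro x0 y0
    obtain ⟨p1, f1⟩ := i1 x0 y0
    obtain ⟨p2, f2⟩ := i2 (x0 + _) y0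
    exact PkFit_v h1.nonneg.1 h2.nonneg.1 f1 f2 hw hS
  | hcut h1 h2 hw hS i1 i2 =>
    intro x0 y0
    obtain ⟨p1, f1⟩ := i1 x0 y0
    obtain ⟨p2, f2⟩ := i2 x0 (y0 + _)
    obtain ⟨p, f⟩ := PkFit_v h1.nonneg.2 h2.nonneg.2 f1.tr f2.tr hw hS
    exact ⟨_, f.tr⟩

theorem VFit {D : Dims ι} (y0 y1 : ℝ) (S : Finset ι) (hd : ∀ i ∈ S, D.h i ≤ y1 - y0) :
    ∀ x0 x1, ∑ i ∈ S, D.w i ≤ x1 - x0 → ∃ p, Fit D ⟨x0, x1, y0, y1⟩ S p ∧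
      ∀ i ∈ S, ∀ j ∈ S, i ≠ j → (p i).x2 ≤ (p j).x1 ∨ (p j).x2 ≤ (p i).x1 := by
  induction S using Finset.induction_on with
  | empty =>
    intro x0 x1 h
    exact ⟨fun _ => ⟨x0, x1, y0, y1⟩, ⟨by simp, GuillotineSep.base _ _ (by simp)⟩, by simp⟩
  | insert a S ha ih =>
    intro x0 x1 h
    rw [Finset.sum_insert ha] at h
    have hs0 : 0 ≤ ∑ i ∈ S, D.w i := Finset.sum_nonneg (fun i _ => D.w0 i)
    have hwa := D.wpos a
    obtain ⟨p, f, hp⟩ := ih (fun i hi => hd i (Finset.mem_insert_of_mem hi)) (x0 + D.w a) x1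
      (by linarith)
    have f1 : Fit D ⟨x0, x0 + D.w a, y0, y1⟩ {a} (fun i => ⟨x0, x0 + D.w a, y0, y0 + D.h a⟩) := by
      refine ⟨?_, GuillotineSep.base _ _ (by simp)⟩
      intro i hi
      rw [Finset.mem_singleton] at hi
      subst hi
      have := hd i (Finset.mem_insert_self _ _)
      refine ⟨by simp [Rect.width], by simp [Rect.height], le_rfl, le_rfl, le_rfl, ?_⟩
      show y0 + D.h i ≤ y1
      linarith
    have hdj : Disjoint {a} S := Finset.disjoint_singleton_left.2 ha
    have g := f1.glue f hdj (by linarith) (by linarith)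
    have ei : ({a} : Finset ι) ∪ S = insert a S := rfl
    rw [ei] at g
    refine ⟨_, g, ?_⟩
    have ea : ∀ j ∈ S, j ∉ ({a} : Finset ι) := fun j hj h => Finset.disjoint_left.1 hdj h hj
    have hx : ∀ j ∈ S, x0 + D.w a ≤ (p j).x1 := fun j hj => (f.1 j hj).2.2.1
    intro i hi j hj hij
    rcases Finset.mem_insert.1 hi with h1 | h1 <;> rcases Finset.mem_insert.1 hj with h2 | h2
    · exact absurd (h1.trans h2.symm) hij
    · left
      rw [if_pos (Finset.mem_singleton.2 h1), if_neg (ea j h2)]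
      exact hx j h2
    · right
      rw [if_pos (Finset.mem_singleton.2 h2), if_neg (ea i h1)]
      exact hx i h1
    · rw [if_neg (ea i h1), if_neg (ea j h2)]
      exact hp i h1 j h2 hij

/-- positioned container packing -/
def CP (D : Dims ι) (ε : ℝ) (k : ℕ) (P : Rect) (S : Finset ι) (p : ι → Rect) : Prop :=
  Fit D P S p ∧ ∃ (cont : ℕ → Rect) (lab : ℕ → CLabel) (asg : ι → ℕ),
    (∀ j < k, (cont j).SubRect P) ∧
    (∀ j < k, ∀ j' < k, j ≠ j' → Disjoint (cont j).toSet (cont j').toSet) ∧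
    (∀ i ∈ S, asg i < k ∧ (p i).SubRect (cont (asg i))) ∧
    ContainerLabelOK S p k cont lab asg ε

/-- swap of labels -/
def ltr : CLabel → CLabel
  | CLabel.large => CLabel.large
  | CLabel.horizontal => CLabel.vertical
  | CLabel.vertical => CLabel.horizontal
  | CLabel.area => CLabel.area

theorem ltr_ltr (l : CLabel) : ltr (ltr l) = l := by cases l <;> rfl

theorem CP.tr {D : Dims ι} {ε : ℝ} {k : ℕ} {P : Rect} {S : Finset ι} {p : ι → Rect}
    (h : CP D ε k P S p) : CP D.T ε k (rtr P) S (fun i => rtr (p i)) := by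
  obtain ⟨f, cont, lab, asg, h1, h2, h3, h4, h5, h6, h7⟩ := h
  have key : ∀ j l, ltr (lab j) = l → lab j = ltr l := fun j l h => by rw [← h, ltr_ltr]
  refine ⟨f.tr, fun j => rtr (cont j), fun j => ltr (lab j), asg, fun j hj => SubRect_tr (h1 j hj),
    fun j hj j' hj' hne => disj_tr (h2 j hj j' hj' hne),
    fun i hi => ⟨(h3 i hi).1, SubRect_tr (h3 i hi).2⟩, ?_, ?_, ?_, ?_⟩
  · exact fun j hj hl => h4 j hj (key j _ hl)
  · exact fun j hj hl => h6 j hj (key j _ hl)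
  · exact fun j hj hl => h5 j hj (key j _ hl)
  · exact fun j hj hl i hi ha => ⟨(h7 j hj (key j _ hl) i hi ha).2, (h7 j hj (key j _ hl) i hi ha).1⟩

theorem CP.mono {D : Dims ι} {ε : ℝ} {k k' : ℕ} {P Q : Rect} {S T : Finset ι} {p : ι → Rect}
    (h : CP D ε k P S p) (hT : T ⊆ S) (hPQ : P.SubRect Q) (hk : k ≤ k')
    (hx : Q.x1 ≤ Q.x2) (hy : Q.y1 ≤ Q.y2) : CP D ε k' Q T p := by
  obtain ⟨f, cont, lab, asg, h1, h2, h3, h4, h5, h6, h7⟩ := h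
  have hlt : ∀ i ∈ T, ∀ j, asg i = j → j < k := fun i hi j hj => hj ▸ (h3 i (hT hi)).1
  refine ⟨f.mono hT hPQ, fun j => if j < k then cont j else ⟨Q.x1, Q.x1, Q.y1, Q.y1⟩, lab, asg,
    ?_, ?_, ?_, ?_, ?_, ?_, ?_⟩
  · intro j hj
    by_cases hjk : j < k
    · simp only [if_pos hjk]
      exact SubRect_trans (h1 j hjk) hPQ
    · simp only [if_neg hjk]
      exact ⟨le_rfl, hx, le_rfl, hy⟩
  · intro j hj j' hj' hne
    by_cases hjk : j < k
    · by_cases hjk' : j' < k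
      · simp only [if_pos hjk, if_pos hjk']
        exact h2 j hjk j' hjk' hne
      · simp only [if_neg hjk']
        exact (disj_deg le_rfl).symm
    · simp only [if_neg hjk]
      exact disj_deg le_rfl
  · intro i hi
    refine ⟨(h3 i (hT hi)).1.trans_le hk, ?_⟩
    simp only [if_pos (h3 i (hT hi)).1]
    exact (h3 i (hT hi)).2
  · exact fun j hj hl i hi i' hi' ha ha' => h4 j (hlt i hi j ha) hl i (hT hi) i' (hT hi') ha ha'
  · exact fun j hj hl i hi i' hi' ha ha' => h5 j (hlt i hi j ha) hl i (hT hi) i' (hT hi') ha ha'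
  · exact fun j hj hl i hi i' hi' ha ha' => h6 j (hlt i hi j ha) hl i (hT hi) i' (hT hi') ha ha'
  · intro j hj hl i hi ha
    simp only [if_pos (hlt i hi j ha)]
    exact h7 j (hlt i hi j ha) hl i (hT hi) ha

theorem CP.one {D : Dims ι} {ε : ℝ} {P : Rect} {S : Finset ι} {p : ι → Rect} (f : Fit D P S p)
    (l : CLabel) (hl : l ≠ CLabel.large)
    (hh : l = CLabel.horizontal → ∀ i ∈ S, ∀ j ∈ S, i ≠ j → (p i).y2 ≤ (p j).y1 ∨ (p j).y2 ≤ (p i).y1)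
    (hv : l = CLabel.vertical → ∀ i ∈ S, ∀ j ∈ S, i ≠ j → (p i).x2 ≤ (p j).x1 ∨ (p j).x2 ≤ (p i).x1)
    (ha : l = CLabel.area → ∀ i ∈ S, D.w i ≤ ε * P.width ∧ D.h i ≤ ε * P.height) :
    CP D ε 1 P S p := by
  refine ⟨f, fun _ => P, fun _ => l, fun _ => 0, fun j _ => SubRect_refl P, ?_,
    fun i hi => ⟨by norm_num, (f.1 i hi).2.2⟩, ?_, ?_, ?_, ?_⟩
  · intro j hj j' hj' hne
    omega
  · exact fun j hj h => absurd h hl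
  · exact fun j hj h i hi i' hi' _ _ hne => hh h i hi i' hi' hne
  · exact fun j hj h i hi i' hi' _ _ hne => hv h i hi i' hi' hne
  · intro j hj h i hi _
    rw [(f.1 i hi).1, (f.1 i hi).2.1]
    exact ha h i hi

theorem CP.glue {D : Dims ι} {ε : ℝ} {k1 k2 : ℕ} {x0 x1 y0 y1 c : ℝ} {S1 S2 : Finset ι}
    {p1 p2 : ι → Rect}
    (f1 : CP D ε k1 ⟨x0, c, y0, y1⟩ S1 p1) (f2 : CP D ε k2 ⟨c, x1, y0, y1⟩ S2 p2)
    (hd : Disjoint S1 S2) (h0 : x0 ≤ c) (h1 : c ≤ x1) :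
    CP D ε (k1 + k2) ⟨x0, x1, y0, y1⟩ (S1 ∪ S2) (fun i => if i ∈ S1 then p1 i else p2 i) := by
  have s1 : Rect.SubRect ⟨x0, c, y0, y1⟩ ⟨x0, x1, y0, y1⟩ := ⟨le_rfl, h1, le_rfl, le_rfl⟩
  have s2 : Rect.SubRect ⟨c, x1, y0, y1⟩ ⟨x0, x1, y0, y1⟩ := ⟨h0, le_rfl, le_rfl, le_rfl⟩
  obtain ⟨f, cont, lab, asg, a1, a2, a3, a4, a5, a6, a7⟩ := f1
  obtain ⟨g, cont', lab', asg', b1, b2, b3, b4, b5, b6, b7⟩ := f2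
  set q : ι → Rect := fun i => if i ∈ S1 then p1 i else p2 i with hq
  have hn : ∀ i ∈ S2, i ∉ S1 := fun i hi h => Finset.disjoint_left.1 hd h hi
  have e1 : ∀ i ∈ S1, q i = p1 i := fun i hi => if_pos hi
  have e2 : ∀ i ∈ S2, q i = p2 i := fun i hi => if_neg (hn i hi)
  set C : ℕ → Rect := fun j => if j < k1 then cont j else cont' (j - k1) with hC
  set L : ℕ → CLabel := fun j => if j < k1 then lab j else lab' (j - k1) with hL
  set A : ι → ℕ := fun i => if i ∈ S1 then asg i else k1 + asg' i with hA
  have A1 : ∀ i ∈ S1, A i = asg i := fun i hi => if_pos hi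
  have A2 : ∀ i ∈ S2, A i = k1 + asg' i := fun i hi => if_neg (hn i hi)
  have C1 : ∀ j, j < k1 → C j = cont j := fun j hj => if_pos hj
  have C2 : ∀ j, ¬ j < k1 → C j = cont' (j - k1) := fun j hj => if_neg hj
  have L1 : ∀ j, j < k1 → L j = lab j := fun j hj => if_pos hj
  have L2 : ∀ j, ¬ j < k1 → L j = lab' (j - k1) := fun j hj => if_neg hj
  -- items assigned to small index are in S1
  have M1 : ∀ i ∈ S1 ∪ S2, ∀ j, A i = j → j < k1 → i ∈ S1 ∧ asg i = j := by
    intro i hi j hj hlt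
    rcases Finset.mem_union.1 hi with h | h
    · exact ⟨h, by rw [← A1 i h]; exact hj⟩
    · rw [A2 i h] at hj; omega
  have M2 : ∀ i ∈ S1 ∪ S2, ∀ j, A i = j → ¬ j < k1 → i ∈ S2 ∧ asg' i = j - k1 := by
    intro i hi j hj hlt
    rcases Finset.mem_union.1 hi with h | h
    · rw [A1 i h] at hj
      have := (a3 i h).1
      omega
    · rw [A2 i h] at hj
      exact ⟨h, by omega⟩
  refine ⟨f.glue g hd h0 h1, C, L, A, ?_, ?_, ?_, ?_, ?_, ?_, ?_⟩
  · intro j hj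
    by_cases hk : j < k1
    · rw [C1 j hk]; exact SubRect_trans (a1 j hk) s1
    · rw [C2 j hk]; exact SubRect_trans (b1 _ (by omega)) s2
  · intro j hj j' hj' hne
    by_cases hk : j < k1 <;> by_cases hk' : j' < k1
    · rw [C1 j hk, C1 j' hk']; exact a2 j hk j' hk' hne
    · rw [C1 j hk, C2 j' hk']
      exact disj_x ((a1 j hk).2.1.trans (b1 (j' - k1) (by omega)).1)
    · rw [C2 j hk, C1 j' hk']
      exact (disj_x ((a1 j' hk').2.1.trans (b1 (j - k1) (by omega)).1)).symm
    · rw [C2 j hk, C2 j' hk']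
      exact b2 _ (by omega) _ (by omega) (by omega)
  · intro i hi
    rcases Finset.mem_union.1 hi with h | h
    · have := a3 i h
      rw [A1 i h, C1 _ this.1, e1 i h]
      exact ⟨by omega, this.2⟩
    · have := b3 i h
      rw [A2 i h, C2 _ (by omega), e2 i h, Nat.add_sub_cancel_left]
      exact ⟨by omega, this.2⟩
  · intro j hj hl i hi i' hi' ha ha'
    by_cases hk : j < k1
    · rw [L1 j hk] at hl
      have m := M1 i hi j ha hk
      have m' := M1 i' hi' j ha' hk
      exact a4 j hk hl i m.1 i' m'.1 m.2 m'.2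
    · rw [L2 j hk] at hl
      have m := M2 i hi j ha hk
      have m' := M2 i' hi' j ha' hk
      exact b4 (j - k1) (by omega) hl i m.1 i' m'.1 m.2 m'.2
  · intro j hj hl i hi i' hi' ha ha'
    by_cases hk : j < k1
    · rw [L1 j hk] at hl
      have m := M1 i hi j ha hk
      have m' := M1 i' hi' j ha' hk
      rw [e1 i m.1, e1 i' m'.1]
      exact a5 j hk hl i m.1 i' m'.1 m.2 m'.2
    · rw [L2 j hk] at hl
      have m := M2 i hi j ha hk
      have m' := M2 i' hi' j ha' hk
      rw [e2 i m.1, e2 i' m'.1]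
      exact b5 (j - k1) (by omega) hl i m.1 i' m'.1 m.2 m'.2
  · intro j hj hl i hi i' hi' ha ha'
    by_cases hk : j < k1
    · rw [L1 j hk] at hl
      have m := M1 i hi j ha hk
      have m' := M1 i' hi' j ha' hk
      rw [e1 i m.1, e1 i' m'.1]
      exact a6 j hk hl i m.1 i' m'.1 m.2 m'.2
    · rw [L2 j hk] at hl
      have m := M2 i hi j ha hk
      have m' := M2 i' hi' j ha' hk
      rw [e2 i m.1, e2 i' m'.1]
      exact b6 (j - k1) (by omega) hl i m.1 i' m'.1 m.2 m'.2
  · intro j hj hl i hi ha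
    by_cases hk : j < k1
    · rw [L1 j hk] at hl
      have m := M1 i hi j ha hk
      rw [e1 i m.1, C1 j hk]
      exact a7 j hk hl i m.1 m.2
    · rw [L2 j hk] at hl
      have m := M2 i hi j ha hk
      rw [e2 i m.1, C2 j hk]
      exact b7 (j - k1) (by omega) hl i m.1 m.2

theorem CtCP_v {D : Dims ι} {ε w h w1 w2 x0 y0 : ℝ} {k k1 k2 : ℕ} {S S1 S2 : Finset ι}
    {p1 p2 : ι → Rect} (hw1 : 0 ≤ w1) (hw2 : 0 ≤ w2) (hh : 0 ≤ h)
    (f1 : CP D ε k1 ⟨x0, x0 + w1, y0, y0 + h⟩ S1 p1)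
    (f2 : CP D ε k2 ⟨x0 + w1, x0 + w1 + w2, y0, y0 + h⟩ S2 p2)
    (hw : w1 + w2 ≤ w) (hS : S ⊆ S1 ∪ S2) (hk : k1 + k2 ≤ k) :
    ∃ p, CP D ε k ⟨x0, x0 + w, y0, y0 + h⟩ S p := by
  have g1 := f1.mono (T := S ∩ S1) Finset.inter_subset_right (SubRect_refl _) le_rfl
    (by show x0 ≤ x0 + w1; linarith) (by show y0 ≤ y0 + h; linarith)
  have g2 := f2.mono (T := S \ S1) (Q := ⟨x0 + w1, x0 + w, y0, y0 + h⟩) (cover_split2 hS)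
    ⟨le_rfl, by show x0 + w1 + w2 ≤ x0 + w; linarith, le_rfl, le_rfl⟩ le_rfl
    (by show x0 + w1 ≤ x0 + w; linarith) (by show y0 ≤ y0 + h; linarith)
  have g3 := g1.glue g2 cover_split4 (by linarith) (by linarith)
  rw [cover_split3] at g3
  exact ⟨_, g3.mono subset_rfl (SubRect_refl _) hk
    (by show x0 ≤ x0 + w; linarith) (by show y0 ≤ y0 + h; linarith)⟩

theorem CtCP {D : Dims ι} {ε : ℝ} {M : ι → Prop} {k : ℕ} {w h : ℝ} {S : Finset ι}
    (hp : Ct D ε M k w h S) : ∀ x0 y0, ∃ p, CP D ε k ⟨x0, x0 + w, y0, y0 + h⟩ S p := by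
  induction hp with
  | @empty k w h S hw hh hS =>
    intro x0 y0
    subst hS
    refine ⟨fun _ => ⟨x0, x0, y0, y0⟩, ⟨by simp, GuillotineSep.base _ _ (by simp)⟩,
      fun _ => ⟨x0, x0, y0, y0⟩, fun _ => CLabel.large, fun _ => 0, ?_, ?_, by simp, ?_⟩
    · intro j _
      exact ⟨le_rfl, by show x0 ≤ x0 + w; linarith, le_rfl, by show y0 ≤ y0 + h; linarith⟩
    · intro j _ j' _ _
      exact disj_deg le_rfl
    · unfold ContainerLabelOK
      simp
  | @vstack k w h S hk hw hh hd hs =>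
    intro x0 y0
    obtain ⟨p, f, hsep⟩ := VFit (D := D) y0 (y0 + h) S (fun i hi => by linarith [hd i hi]) x0 (x0 + w)
      (by linarith)
    exact ⟨p, (CP.one f CLabel.vertical (by simp) (by simp) (fun _ => hsep) (by simp)).mono subset_rfl
      (SubRect_refl _) hk (by show x0 ≤ x0 + w; linarith) (by show y0 ≤ y0 + h; linarith)⟩
  | @hstack k w h S hk hw hh hd hs hM =>
    intro x0 y0
    obtain ⟨p, f, hsep⟩ := VFit (D := D.T) x0 (x0 + w) S (fun i hi => by
      have : D.T.h i ≤ w := hd i hi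
      linarith) y0 (y0 + h)
      (by
        have : ∑ i ∈ S, D.T.w i ≤ h := hs
        linarith)
    have c := (CP.one (ε := ε) f CLabel.vertical (by simp) (by simp) (fun _ => hsep) (by simp)).mono subset_rfl
      (SubRect_refl _) hk (by show y0 ≤ y0 + h; linarith) (by show x0 ≤ x0 + w; linarith)
    exact ⟨_, c.tr⟩
  | @area k w h S hk hd hp hM =>
    intro x0 y0
    obtain ⟨p, f⟩ := PkFit hp x0 y0
    have hn := hp.nonneg
    refine ⟨p, (CP.one f CLabel.area (by simp) (by simp) (by simp) (fun _ => ?_)).mono subset_rfl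
      (SubRect_refl _) hk (by show x0 ≤ x0 + w; linarith) (by show y0 ≤ y0 + h; linarith)⟩
    intro i hi
    simp only [Rect.width, Rect.height, add_sub_cancel_left]
    exact hd i hi
  | vcut h1 h2 hw hS hk i1 i2 =>
    intro x0 y0
    obtain ⟨p1, f1⟩ := i1 x0 y0
    obtain ⟨p2, f2⟩ := i2 (x0 + _) y0
    exact CtCP_v h1.nonneg.1 h2.nonneg.1 h1.nonneg.2 f1 f2 hw hS hk
  | hcut h1 h2 hw hS hk i1 i2 =>
    intro x0 y0
    obtain ⟨p1, f1⟩ := i1 x0 y0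
    obtain ⟨p2, f2⟩ := i2 x0 (y0 + _)
    obtain ⟨p, f⟩ := CtCP_v h1.nonneg.2 h2.nonneg.2 h1.nonneg.1 f1.tr f2.tr hw hS hk
    exact ⟨_, f.tr⟩

/-- passing to smaller real dimensions -/
theorem CP.real {D : Dims ι} {ε : ℝ} {k : ℕ} {P : Rect} {S : Finset ι} {p : ι → Rect}
    (h : CP D ε k P S p) (rwd rhd wd ht : ι → ℝ) (hw : ∀ i ∈ S, rwd i ≤ D.w i) (hh : ∀ i ∈ S, rhd i ≤ D.h i)
    (hr : ∀ i ∈ S, (rwd i = wd i ∧ rhd i = ht i) ∨ (rwd i = ht i ∧ rhd i = wd i)) :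
    ∃ q, IsContainerPackingRot wd ht ε S q P k ∧ GuillotineSep q P S := by
  obtain ⟨f, cont, lab, asg, h1, h2, h3, h4, h5, h6, h7⟩ := h
  let q : ι → Rect := fun i => ⟨(p i).x2 - rwd i, (p i).x2, (p i).y2 - rhd i, (p i).y2⟩
  have hqw : ∀ i, (q i).width = rwd i := fun i => by simp [q, Rect.width]
  have hqh : ∀ i, (q i).height = rhd i := fun i => by simp [q, Rect.height]
  have hx : ∀ i ∈ S, (p i).x1 ≤ (q i).x1 := by
    intro i hi
    have := (f.1 i hi).1
    unfold Rect.width at this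
    show (p i).x1 ≤ (p i).x2 - rwd i
    linarith [hw i hi]
  have hy : ∀ i ∈ S, (p i).y1 ≤ (q i).y1 := by
    intro i hi
    have := (f.1 i hi).2.1
    unfold Rect.height at this
    show (p i).y1 ≤ (p i).y2 - rhd i
    linarith [hh i hi]
  have hs : ∀ i ∈ S, (q i).SubRect (p i) := fun i hi => ⟨hx i hi, le_rfl, hy i hi, le_rfl⟩
  have hg : GuillotineSep q P S := GS_trans f.2 q P S subset_rfl (SubRect_refl P)
    (fun i hi => ⟨rfl, rfl, hx i hi, hy i hi⟩)
  refine ⟨q, ⟨⟨?_, ?_, GS_disj hg⟩, cont, lab, asg, h1, h2, ?_, h4, ?_, ?_, ?_⟩, hg⟩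
  · intro i hi
    rw [hqw, hqh]
    exact hr i hi
  · exact fun i hi => SubRect_trans (hs i hi) (f.1 i hi).2.2
  · exact fun i hi => ⟨(h3 i hi).1, SubRect_trans (hs i hi) (h3 i hi).2⟩
  · intro j hj hl i hi i' hi' ha ha' hne
    rcases h5 j hj hl i hi i' hi' ha ha' hne with h | h
    · exact Or.inl (h.trans (hy i' hi'))
    · exact Or.inr (h.trans (hy i hi))
  · intro j hj hl i hi i' hi' ha ha' hne
    rcases h6 j hj hl i hi i' hi' ha ha' hne with h | h
    · exact Or.inl (h.trans (hx i' hi'))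
    · exact Or.inr (h.trans (hx i hi))
  · intro j hj hl i hi ha
    have h := h7 j hj hl i hi ha
    rw [(f.1 i hi).1, (f.1 i hi).2.1] at h
    rw [hqw, hqh]
    exact ⟨(hw i hi).trans h.1, (hh i hi).trans h.2⟩

/-- effective dimensions -/
noncomputable def effD (p : ι → Rect) (τ : ℝ) (hτ : 0 < τ) : Dims ι :=
  ⟨fun i => max (p i).width τ, fun i => max (p i).height τ,
    fun _ => lt_max_of_lt_right hτ, fun _ => lt_max_of_lt_right hτ⟩

theorem PkOf {p : ι → Rect} {P : Rect} {S : Finset ι} (hg : GuillotineSep p P S) :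
    P.x1 < P.x2 → P.y1 < P.y2 → (∀ i ∈ S, (p i).SubRect P) →
    ∃ τ0 > 0, ∀ τ (hτ : 0 < τ), τ ≤ τ0 → Pk (effD p τ hτ) P.width P.height S := by
  induction hg with
  | base P S hS =>
    intro hx hy hs
    refine ⟨min P.width P.height, lt_min (sub_pos.2 hx) (sub_pos.2 hy), ?_⟩
    intro τ hτ hle
    refine Pk.leaf (sub_nonneg.2 hx.le) (sub_nonneg.2 hy.le) hS ?_
    intro i hi
    obtain ⟨a1, a2, a3, a4⟩ := hs i hi
    refine ⟨max_le ?_ (hle.trans (min_le_left _ _)), max_le ?_ (hle.trans (min_le_right _ _))⟩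
    · unfold Rect.width; linarith
    · unfold Rect.height; linarith
  | vcut P S c h1 h2 hc hL hR iL iR =>
    intro hx hy hs
    obtain ⟨t1, ht1, k1⟩ := iL h1 hy (by
      intro i hi
      obtain ⟨u, v⟩ := Finset.mem_filter.1 hi
      exact ⟨(hs i u).1, v, (hs i u).2.2⟩)
    obtain ⟨t2, ht2, k2⟩ := iR h2 hy (by
      intro i hi
      obtain ⟨u, v⟩ := Finset.mem_filter.1 hi
      exact ⟨(hc i u).resolve_left v, (hs i u).2⟩)
    refine ⟨min t1 t2, lt_min ht1 ht2, ?_⟩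
    intro τ hτ hle
    refine Pk.vcut (k1 τ hτ (hle.trans (min_le_left _ _))) (k2 τ hτ (hle.trans (min_le_right _ _))) ?_ ?_
    · simp only [Rect.width]; linarith
    · rw [Finset.filter_union_filter_not_eq]
  | hcut P S c h1 h2 hc hL hR iL iR =>
    intro hx hy hs
    obtain ⟨t1, ht1, k1⟩ := iL hx h1 (by
      intro i hi
      obtain ⟨u, v⟩ := Finset.mem_filter.1 hi
      exact ⟨(hs i u).1, (hs i u).2.1, (hs i u).2.2.1, v⟩)
    obtain ⟨t2, ht2, k2⟩ := iR hx h2 (by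
      intro i hi
      obtain ⟨u, v⟩ := Finset.mem_filter.1 hi
      exact ⟨(hs i u).1, (hs i u).2.1, (hc i u).resolve_left v, (hs i u).2.2.2⟩)
    refine ⟨min t1 t2, lt_min ht1 ht2, ?_⟩
    intro τ hτ hle
    refine Pk.hcut (k1 τ hτ (hle.trans (min_le_left _ _))) (k2 τ hτ (hle.trans (min_le_right _ _))) ?_ ?_
    · simp only [Rect.height]; linarith
    · rw [Finset.filter_union_filter_not_eq]

end Place

/-- With rotations allowed and no massive item in the optimal guillotine packing, a `(3/4 - O(ε))`-profit subset admits a guillotine-separable container packing with `O_ε(1)` containers. -/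
theorem rotated_weighted_three_fourths_no_massive :
    ∃ C : ℝ, 0 < C ∧
    ∀ ε : ℝ, 0 < ε → ε < 1 / 10 →
    ∃ kb : ℕ,
    ∀ (ι : Type) (N : ℝ) (wd ht : ι → ℝ) (pr : ι → ℕ)
      (items OPT : Finset ι),
      0 < N →
      OPT ⊆ items →
      (∃ place, IsPackingRot wd ht OPT place (knapsack N) ∧
        GuillotineSep place (knapsack N) OPT) →
      (∀ T : Finset ι, T ⊆ items →
        (∃ place, IsPackingRot wd ht T place (knapsack N) ∧
          GuillotineSep place (knapsack N) T) →
        (∑ i ∈ T, (pr i : ℝ)) ≤ ∑ i ∈ OPT, (pr i : ℝ)) →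
      (∀ m ∈ OPT, ¬ ((1 - ε) * N ≤ wd m ∧ (1 - ε) * N ≤ ht m)) →

      ∃ (APX : Finset ι) (place : ι → Rect) (k : ℕ),
        APX ⊆ OPT ∧ k ≤ kb ∧
        IsContainerPackingRot wd ht ε APX place (knapsack N) k ∧
        GuillotineSep place (knapsack N) APX ∧
        (3 / 4 - C * ε) * (∑ i ∈ OPT, (pr i : ℝ)) ≤ ∑ i ∈ APX, (pr i : ℝ) := by
  refine ⟨10, by norm_num, ?_⟩
  intro ε hε hε1
  obtain ⟨K, HK⟩ := UnitThm ε hε (by linarith)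
  refine ⟨K, ?_⟩
  intro ι N wd ht pr items OPT hN _ hpk _ hmass
  classical
  obtain ⟨place, hpack, hg⟩ := hpk
  obtain ⟨τ0, hτ0, hP⟩ := PkOf hg hN hN hpack.hin
  have hεN : 0 < (1 - ε) * N := mul_pos (by linarith) hN
  set τ := min τ0 ((1 - ε) * N / 2) with hτd
  have hτ : 0 < τ := lt_min hτ0 (by linarith)
  have hτ2 : τ < (1 - ε) * N := lt_of_le_of_lt (min_le_right _ _) (by linarith)
  have h1 := hP τ hτ (min_le_left _ _)
  have hNi : 0 < N⁻¹ := inv_pos.2 hN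
  have h2 := h1.scale hNi hNi
  have ew : N⁻¹ * (knapsack N).width = 1 := by
    simp only [knapsack, Rect.width, sub_zero]; exact inv_mul_cancel₀ hN.ne'
  have eh : N⁻¹ * (knapsack N).height = 1 := by
    simp only [knapsack, Rect.height, sub_zero]; exact inv_mul_cancel₀ hN.ne'
  rw [ew, eh] at h2
  set D := (effD place τ hτ).sc N⁻¹ N⁻¹ hNi hNi with hD
  have key : ∀ a : ℝ, 1 - ε ≤ N⁻¹ * max a τ → (1 - ε) * N ≤ a := by
    intro a h
    have h3 : (1 - ε) * N ≤ max a τ := by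
      have := mul_le_mul_of_nonneg_right h hN.le
      rwa [mul_assoc, mul_comm (max a τ), ← mul_assoc, inv_mul_cancel₀ hN.ne', one_mul] at this
    rcases le_max_iff.1 h3 with h4 | h4
    · exact h4
    · linarith
  obtain ⟨S', hS', D', hrot, hct, hsum⟩ := HK ι D (fun i => (pr i : ℝ)) OPT
    (fun i => Nat.cast_nonneg _) h2 (by
      rintro i hi ⟨a, b⟩
      have a1 := key _ a
      have b1 := key _ b
      rcases hpack.hdims i hi with ⟨u, v⟩ | ⟨u, v⟩
      · rw [u] at a1; rw [v] at b1
        exact hmass i hi ⟨a1, b1⟩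
      · rw [u] at a1; rw [v] at b1
        exact hmass i hi ⟨b1, a1⟩)
  have hct2 := hct.map (D' := D'.sc N N hN hN) hN hN subset_rfl (fun i _ => ⟨le_rfl, le_rfl⟩)
  rw [mul_one] at hct2
  obtain ⟨p, hp⟩ := CtCP hct2 0 0
  rw [zero_add] at hp
  have nD : ∀ a : ℝ, a ≤ N * (N⁻¹ * max a τ) := by
    intro a
    rw [← mul_assoc, mul_inv_cancel₀ hN.ne', one_mul]
    exact le_max_left _ _
  have hex : ∀ i, ∃ q : ℝ × ℝ, i ∈ S' → (q.1 ≤ (D'.sc N N hN hN).w i ∧ q.2 ≤ (D'.sc N N hN hN).h i) ∧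
      ((q.1 = wd i ∧ q.2 = ht i) ∨ (q.1 = ht i ∧ q.2 = wd i)) := by
    intro i
    rcases hrot i with ⟨u, v⟩ | ⟨u, v⟩
    · refine ⟨((place i).width, (place i).height), fun hi => ⟨⟨?_, ?_⟩, hpack.hdims i (hS' hi)⟩⟩
      · show _ ≤ N * D'.w i
        rw [u]; exact nD _
      · show _ ≤ N * D'.h i
        rw [v]; exact nD _
    · refine ⟨((place i).height, (place i).width), fun hi => ⟨⟨?_, ?_⟩, ?_⟩⟩
      · show _ ≤ N * D'.w i
        rw [u]; exact nD _
      · show _ ≤ N * D'.h i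
        rw [v]; exact nD _
      · rcases hpack.hdims i (hS' hi) with ⟨a, b⟩ | ⟨a, b⟩
        · exact Or.inr ⟨b, a⟩
        · exact Or.inl ⟨b, a⟩
  choose q hq using hex
  obtain ⟨r, c1, c2⟩ := hp.real (fun i => (q i).1) (fun i => (q i).2) wd ht
    (fun i hi => (hq i hi).1.1) (fun i hi => (hq i hi).1.2) (fun i hi => (hq i hi).2)
  exact ⟨S', r, K, hS', le_rfl, c1, c2, hsum⟩
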